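/- Let n ≥ 3 and let L₁ and L₂ be distinct projective hyperplanes of ℙ. There exist ρ > 0 and a profinitely dense subgroup H of SL(n,ℤ) which is a free group, such that for every g ∈ SL(n,ℤ) and every projective hyperplane L with L ⊆ (L₂)_ρ and g • L ⊆ (L₁)_ρ, the subgroup generated by H ∪ {g} is all of SL(n,ℤ). -/

import Mathlib

/- Common setup: `SL(n,ℤ)`, `SL(n,ℝ)`, the real projective space `ℙ^{n-1}(ℝ)`
with its quotient topology and the projective action, rank-1 unipotent elements
and their attracting points / fixed hyperplanes, metrics compatible with the
topology of `ℙ`, `ε`-neighbourhoods, Schottky systems, profinite density,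
maximal subgroups, and lattices in `SL(n,ℝ)`. -/

open Matrix LinearAlgebra.Projectivization

abbrev SLZ (n : ℕ) := Matrix.SpecialLinearGroup (Fin n) ℤ

abbrev SLR (n : ℕ) := Matrix.SpecialLinearGroup (Fin n) ℝ

/-- The real projective space `ℙ^{n-1}(ℝ)`: the projectivization of `ℝⁿ`. -/
abbrev Proj (n : ℕ) := Projectivization ℝ (Fin n → ℝ)

/-- The quotient topology on `ℙ^{n-1}(ℝ)`. -/
noncomputable instance (n : ℕ) : TopologicalSpace (Proj n) :=
  inferInstanceAs (TopologicalSpace (Quotient _))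

/-- The action of `SL(n,ℝ)` on `ℙ^{n-1}(ℝ)` induced by the linear action on `ℝⁿ`. -/
noncomputable def actR {n : ℕ} (g : SLR n) (x : Proj n) : Proj n :=
  Projectivization.map (Matrix.SpecialLinearGroup.toLin' g).toLinearMap
    (Matrix.SpecialLinearGroup.toLin' g).injective x

/-- The action of `SL(n,ℤ)` on `ℙ^{n-1}(ℝ)` induced by the linear action on `ℝⁿ`. -/
noncomputable def act {n : ℕ} (g : SLZ n) (x : Proj n) : Proj n :=
  actR (Matrix.SpecialLinearGroup.map (Int.castRingHom ℝ) g) x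

/-- The real matrix attached to `g ∈ SL(n,ℤ)`. -/
noncomputable def matR {n : ℕ} (g : SLZ n) : Matrix (Fin n) (Fin n) ℝ :=
  ((Matrix.SpecialLinearGroup.map (Int.castRingHom ℝ)) g : Matrix (Fin n) (Fin n) ℝ)

/-- The subspace `Im(u - I) ⊆ ℝⁿ` (a line when `u` is rank-1 unipotent). -/
noncomputable def lineOf {n : ℕ} (u : SLZ n) : Submodule ℝ (Fin n → ℝ) :=
  LinearMap.range (Matrix.mulVecLin (matR u - 1))

/-- The subspace `ker(u - I) ⊆ ℝⁿ` (a hyperplane when `u` is rank-1 unipotent). -/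
noncomputable def hypOf {n : ℕ} (u : SLZ n) : Submodule ℝ (Fin n → ℝ) :=
  LinearMap.ker (Matrix.mulVecLin (matR u - 1))

/-- The rational matrix attached to `g ∈ SL(n,ℤ)`. -/
noncomputable def matQ {n : ℕ} (g : SLZ n) : Matrix (Fin n) (Fin n) ℚ :=
  ((Matrix.SpecialLinearGroup.map (Int.castRingHom ℚ)) g : Matrix (Fin n) (Fin n) ℚ)

/-- `g - I`, as a `ℚ`-linear endomorphism of `ℚⁿ`. -/
noncomputable def linQ {n : ℕ} (g : SLZ n) : (Fin n → ℚ) →ₗ[ℚ] (Fin n → ℚ) :=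
  Matrix.mulVecLin (matQ g - 1)

/-- `u` is a rank-1 unipotent element of `SL(n,ℤ)`: `u - I` is nilpotent of rank one. -/
def IsR1U {n : ℕ} (u : SLZ n) : Prop :=
  IsNilpotent (linQ u) ∧ Module.finrank ℚ (LinearMap.range (linQ u)) = 1

/-- The point of attraction `p_u` of `u`, as a subset of `ℙ` (a singleton when `u` is a
rank-1 unipotent): the projective points whose representative spans `Im(u - I)`. -/
def attSet {n : ℕ} (u : SLZ n) : Set (Proj n) :=
  {x | x.submodule = lineOf u}

/-- The fixed hyperplane `L_u` of `u`, as a subset of `ℙ`. -/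
def fixSet {n : ℕ} (u : SLZ n) : Set (Proj n) :=
  {x | x.submodule ≤ hypOf u}

/-- The subset of `ℙ` corresponding to a linear subspace `W ⊆ ℝⁿ`. -/
def projSet {n : ℕ} (W : Submodule ℝ (Fin n → ℝ)) : Set (Proj n) :=
  {x | x.submodule ≤ W}

/-- The image `g • W` of a subspace of `ℝⁿ` under `g ∈ SL(n,ℤ)`. -/
noncomputable def actSub {n : ℕ} (g : SLZ n) (W : Submodule ℝ (Fin n → ℝ)) :
    Submodule ℝ (Fin n → ℝ) :=
  Submodule.map (Matrix.mulVecLin (matR g)) W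

/-- The image `g • W` of a subspace of `ℝⁿ` under `g ∈ SL(n,ℝ)`. -/
noncomputable def actSubR {n : ℕ} (g : SLR n) (W : Submodule ℝ (Fin n → ℝ)) :
    Submodule ℝ (Fin n → ℝ) :=
  Submodule.map (Matrix.mulVecLin (g : Matrix (Fin n) (Fin n) ℝ)) W

/-- `d` is a metric on `ℙ^{n-1}(ℝ)` inducing the quotient topology. -/
structure IsCompatMetric {n : ℕ} (d : Proj n → Proj n → ℝ) : Prop where
  self : ∀ x, d x x = 0
  eq_of : ∀ x y, d x y = 0 → x = y
  symm : ∀ x y, d x y = d y x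
  triangle : ∀ x y z, d x z ≤ d x y + d y z
  inducing : ∀ s : Set (Proj n), IsOpen s ↔ ∀ x ∈ s, ∃ ε > 0, ∀ y, d x y < ε → y ∈ s

/-- The distance from a point to a set. -/
noncomputable def setDist {n : ℕ} (d : Proj n → Proj n → ℝ) (x : Proj n)
    (A : Set (Proj n)) : ℝ :=
  sInf (d x '' A)

/-- The open `ε`-neighbourhood `(A)_ε = {x | dist(x, A) < ε}`. -/
def oThick {n : ℕ} (d : Proj n → Proj n → ℝ) (A : Set (Proj n)) (ε : ℝ) : Set (Proj n) :=
  {x | setDist d x A < ε}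

/-- The closed `ε`-neighbourhood `[A]_ε = {x | dist(x, A) ≤ ε}`. -/
def cThick {n : ℕ} (d : Proj n → Proj n → ℝ) (A : Set (Proj n)) (ε : ℝ) : Set (Proj n) :=
  {x | setDist d x A ≤ ε}

/-- The Hausdorff distance between two subsets of `ℙ`. -/
noncomputable def hDist {n : ℕ} (d : Proj n → Proj n → ℝ) (A B : Set (Proj n)) : ℝ :=
  max (sSup ((fun a => setDist d a B) '' A)) (sSup ((fun b => setDist d b A) '' B))

/-- A rational point of `ℙ`: one spanned by a vector of `ℚⁿ`. -/
def RatPoint {n : ℕ} (p : Proj n) : Prop :=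
  ∃ v : Fin n → ℚ, p.submodule = Submodule.span ℝ {fun i => ((v i : ℝ))}

/-- A subspace of `ℝⁿ` spanned by vectors of `ℚⁿ`. -/
def IsRatSubmodule {n : ℕ} (W : Submodule ℝ (Fin n → ℝ)) : Prop :=
  ∃ T : Set (Fin n → ℚ),
    W = Submodule.span ℝ ((fun (v : Fin n → ℚ) (i : Fin n) => ((v i : ℝ))) '' T)

/-- A Schottky system `(S, 𝒜, ℛ)` with respect to the metric `d`: `S` is a nonempty
set of rank-1 unipotents, `𝒜 ⊆ ℛ` are closed, and for each `u ∈ S` there are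
`δ_u ≥ ε_u > 0` satisfying the ping-pong conditions. -/
structure IsSchottky {n : ℕ} (d : Proj n → Proj n → ℝ) (S : Set (SLZ n))
    (A R : Set (Proj n)) : Prop where
  nonempty : S.Nonempty
  unip : ∀ u ∈ S, IsR1U u
  AsubR : A ⊆ R
  closedA : IsClosed A
  closedR : IsClosed R
  cond : ∃ ε δ : SLZ n → ℝ, (∀ u ∈ S, 0 < ε u ∧ ε u ≤ δ u) ∧
    (∀ u ∈ S, ∀ k : ℤ, k ≠ 0 → ∀ x, x ∉ oThick d (fixSet u) (δ u) →
      act (u ^ k) x ∈ oThick d (attSet u) (ε u)) ∧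
    (∀ u ∈ S, ∀ v ∈ S, u ≠ v → oThick d (attSet u) (ε u) ∩ oThick d (fixSet v) (δ v) = ∅) ∧
    (∀ u ∈ S, oThick d (attSet u) (ε u) ⊆ A) ∧
    (∀ u ∈ S, oThick d (fixSet u) (δ u) ⊆ R)

/-- `H` is profinitely dense in `G`: `HN = G` for every finite-index normal `N ⊴ G`. -/
def ProfinitelyDense {G : Type*} [Group G] (H : Subgroup G) : Prop :=
  ∀ N : Subgroup G, N.Normal → N.FiniteIndex → H ⊔ N = ⊤

/-- `M` is a maximal (proper) subgroup of `G`. -/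
def IsMaxSubgroup {G : Type*} [Group G] (M : Subgroup G) : Prop :=
  M ≠ ⊤ ∧ ∀ K : Subgroup G, M < K → K = ⊤

noncomputable instance (n : ℕ) : TopologicalSpace (SLR n) :=
  inferInstanceAs (TopologicalSpace {A : Matrix (Fin n) (Fin n) ℝ // A.det = 1})

noncomputable instance (n : ℕ) : MeasurableSpace (SLR n) := borel _

/-- `Γ ≤ SL(n,ℝ)` is a lattice: a discrete subgroup admitting a Borel fundamental
domain of finite Haar measure. -/
def IsLatticeIn {n : ℕ} (Γ : Subgroup (SLR n)) : Prop :=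
  DiscreteTopology Γ ∧
  ∃ μ : MeasureTheory.Measure (SLR n), μ.IsHaarMeasure ∧
    ∃ D : Set (SLR n), MeasurableSet D ∧ μ D < ⊤ ∧
      ∀ g : SLR n, ∃! γ : Γ, (γ : SLR n)⁻¹ * g ∈ D

open Filter Topology

section Basics

variable {n : ℕ}

/-- The linear action of `g ∈ SL(n,ℤ)` on `ℝⁿ`. -/
noncomputable def av (g : SLZ n) : (Fin n → ℝ) →ₗ[ℝ] (Fin n → ℝ) := Matrix.mulVecLin (matR g)

lemma matR_one : matR (1 : SLZ n) = 1 := by simp [matR]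

lemma matR_mul (g h : SLZ n) : matR (g * h) = matR g * matR h := by simp [matR]

lemma matR_apply (g : SLZ n) (i j : Fin n) : matR g i j = ((g : Matrix _ _ ℤ) i j : ℝ) := by
  simp [matR, Matrix.SpecialLinearGroup.map_apply_coe]

lemma av_apply (g : SLZ n) (x : Fin n → ℝ) : av g x = matR g *ᵥ x := rfl

@[simp] lemma av_one (x : Fin n → ℝ) : av (1 : SLZ n) x = x := by simp [av_apply, matR_one]

lemma av_mul (g h : SLZ n) (x : Fin n → ℝ) : av (g * h) x = av g (av h x) := by
  simp [av_apply, matR_mul, Matrix.mulVec_mulVec]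

@[simp] lemma av_inv_av (g : SLZ n) (x : Fin n → ℝ) : av g⁻¹ (av g x) = x := by
  rw [← av_mul]; simp

@[simp] lemma av_av_inv (g : SLZ n) (x : Fin n → ℝ) : av g (av g⁻¹ x) = x := by
  rw [← av_mul]; simp

lemma av_injective (g : SLZ n) : Function.Injective (av g) := fun x y h => by
  rw [← av_inv_av g x, h, av_inv_av]

lemma av_ne_zero {g : SLZ n} {x : Fin n → ℝ} (hx : x ≠ 0) : av g x ≠ 0 := fun h =>
  hx (av_injective g (by simpa using h))

lemma continuous_av (g : SLZ n) : Continuous (av g) := LinearMap.continuous_of_finiteDimensional _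

lemma dot_av (f : Fin n → ℝ) (g : SLZ n) (x : Fin n → ℝ) :
    f ⬝ᵥ av g x = (f ᵥ* matR g) ⬝ᵥ x := by
  rw [av_apply, Matrix.dotProduct_mulVec]

lemma abs_dot_le (f x : Fin n → ℝ) : |f ⬝ᵥ x| ≤ (∑ i, |f i|) * ‖x‖ := by
  rw [dotProduct, Finset.sum_mul]
  refine (Finset.abs_sum_le_sum_abs _ _).trans (Finset.sum_le_sum fun i _ => ?_)
  rw [abs_mul]
  exact mul_le_mul_of_nonneg_left (norm_le_pi_norm x i) (abs_nonneg _)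

lemma norm_mulVec_le (M : Matrix (Fin n) (Fin n) ℝ) (x : Fin n → ℝ) :
    ‖M *ᵥ x‖ ≤ (∑ i, ∑ j, |M i j|) * ‖x‖ := by
  refine (pi_norm_le_iff_of_nonneg (by positivity)).2 fun i => ?_
  refine (abs_dot_le (M i) x).trans (mul_le_mul_of_nonneg_right ?_ (norm_nonneg x))
  exact Finset.single_le_sum (f := fun i => ∑ j, |M i j|) (fun i _ => by positivity)
    (Finset.mem_univ i)

/-- The size of the wedge product of two vectors. -/
noncomputable def wd (x y : Fin n → ℝ) : ℝ :=
  ‖fun p : Fin n × Fin n => x p.1 * y p.2 - x p.2 * y p.1‖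

lemma wd_nonneg (x y : Fin n → ℝ) : 0 ≤ wd x y := norm_nonneg _

lemma wd_coord (x y : Fin n → ℝ) (i j : Fin n) : |x i * y j - x j * y i| ≤ wd x y :=
  norm_le_pi_norm (fun p : Fin n × Fin n => x p.1 * y p.2 - x p.2 * y p.1) (i, j)

lemma wd_le {x y : Fin n → ℝ} {r : ℝ} (hr : 0 ≤ r) (h : ∀ i j, |x i * y j - x j * y i| ≤ r) :
    wd x y ≤ r := (pi_norm_le_iff_of_nonneg hr).2 fun p => h p.1 p.2

lemma wd_comm (x y : Fin n → ℝ) : wd x y = wd y x := by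
  apply le_antisymm <;> refine wd_le (wd_nonneg _ _) fun i j => ?_ <;>
  · refine (le_of_eq ?_).trans (wd_coord _ _ i j)
    rw [abs_sub_comm]; congr 1; ring

lemma wd_le_mul (x y : Fin n → ℝ) : wd x y ≤ 2 * ‖x‖ * ‖y‖ := by
  refine wd_le (by positivity) fun i j => ?_
  have h (i j : Fin n) : |x i * y j| ≤ ‖x‖ * ‖y‖ := by
    rw [abs_mul]; gcongr
    · exact norm_le_pi_norm x i
    · exact norm_le_pi_norm y j
  have h1 := h i j
  have h2 := h j i
  have := abs_sub (x i * y j) (x j * y i)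
  linarith

lemma wd_smul_left (c : ℝ) (x y : Fin n → ℝ) : wd (c • x) y = |c| * wd x y := by
  rw [wd, wd, ← Real.norm_eq_abs, ← norm_smul]
  congr 1; ext p; simp; ring

lemma wd_smul_right (c : ℝ) (x y : Fin n → ℝ) : wd x (c • y) = |c| * wd x y := by
  rw [wd_comm, wd_smul_left, wd_comm]

lemma wd_sub_smul (x y : Fin n → ℝ) (c : ℝ) : wd (x - c • y) y = wd x y := by
  rw [wd, wd]
  congr 1; ext p; simp; ring

@[simp] lemma wd_self (x : Fin n → ℝ) : wd x x = 0 := by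
  apply le_antisymm (wd_le le_rfl fun i j => by simp [mul_comm]) (wd_nonneg _ _)

@[simp] lemma wd_zero_left (x : Fin n → ℝ) : wd 0 x = 0 := by
  apply le_antisymm (wd_le le_rfl fun i j => by simp) (wd_nonneg _ _)

@[simp] lemma wd_zero_right (x : Fin n → ℝ) : wd x 0 = 0 := by
  rw [wd_comm, wd_zero_left]

lemma continuous_wd_left (y : Fin n → ℝ) : Continuous fun x => wd x y := by
  unfold wd; fun_prop

/-- Every nonzero vector has a multiple close to `p`, as measured by the wedge product. -/
lemma exists_smul_close {u : Fin n → ℝ} (hu : u ≠ 0) (p : Fin n → ℝ) :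
    ∃ c : ℝ, ‖c • u - p‖ * ‖u‖ ≤ wd u p := by
  have : Nonempty (Fin n) := by
    by_contra h; rw [not_nonempty_iff] at h; exact hu (Subsingleton.elim _ _)
  obtain ⟨i, hi⟩ := (Finite.exists_max fun i => |u i|)
  have hn : ‖u‖ = |u i| := by
    apply le_antisymm
    · exact (pi_norm_le_iff_of_nonneg (abs_nonneg _)).2 hi
    · exact norm_le_pi_norm u i
  have h0 : u i ≠ 0 := by
    intro h; rw [h, abs_zero, norm_eq_zero] at hn; exact hu hn
  refine ⟨p i / u i, ?_⟩
  rw [mul_comm, ← Real.norm_of_nonneg (norm_nonneg u), ← norm_smul]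
  refine (pi_norm_le_iff_of_nonneg (wd_nonneg _ _)).2 fun j => ?_
  refine (le_of_eq ?_).trans (wd_coord u p i j)
  rw [hn]
  simp only [Pi.smul_apply, Pi.sub_apply, smul_eq_mul, Real.norm_eq_abs, abs_mul, abs_abs]
  rw [← abs_mul, abs_sub_comm]
  congr 1
  have h3 : u i * (p i / u i * u j - p j) = p i * u j - u i * p j := by field_simp
  rw [h3]; ring

/-- The largest `2 × 2` minor. -/
noncomputable def mm (M : Matrix (Fin n) (Fin n) ℝ) : ℝ :=
  ‖fun p : (Fin n × Fin n) × (Fin n × Fin n) =>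
    M p.1.1 p.2.1 * M p.1.2 p.2.2 - M p.1.2 p.2.1 * M p.1.1 p.2.2‖

lemma mm_nonneg (M : Matrix (Fin n) (Fin n) ℝ) : 0 ≤ mm M := norm_nonneg _

lemma mm_coord (M : Matrix (Fin n) (Fin n) ℝ) (i j k l : Fin n) :
    |M i k * M j l - M j k * M i l| ≤ mm M :=
  norm_le_pi_norm (fun p : (Fin n × Fin n) × (Fin n × Fin n) =>
    M p.1.1 p.2.1 * M p.1.2 p.2.2 - M p.1.2 p.2.1 * M p.1.1 p.2.2) ((i, j), (k, l))

lemma wd_mulVec_le (M : Matrix (Fin n) (Fin n) ℝ) (x y : Fin n → ℝ) :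
    wd (M *ᵥ x) (M *ᵥ y) ≤ n ^ 2 * mm M * wd x y := by
  have hmm := mm_nonneg M
  have hw := wd_nonneg x y
  refine wd_le (by positivity) fun i j => ?_
  have key : 2 * ((M *ᵥ x) i * (M *ᵥ y) j - (M *ᵥ x) j * (M *ᵥ y) i) =
      ∑ k, ∑ l, (M i k * M j l - M j k * M i l) * (x k * y l - x l * y k) := by
    have e1 : (M *ᵥ x) i * (M *ᵥ y) j - (M *ᵥ x) j * (M *ᵥ y) i =
        ∑ k, ∑ l, (M i k * M j l - M j k * M i l) * (x k * y l) := by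
      simp only [mulVec, dotProduct, Finset.sum_mul_sum, ← Finset.sum_sub_distrib]
      refine Finset.sum_congr rfl fun k _ => Finset.sum_congr rfl fun l _ => by ring
    have e2 : (M *ᵥ x) i * (M *ᵥ y) j - (M *ᵥ x) j * (M *ᵥ y) i =
        - ∑ k, ∑ l, (M i k * M j l - M j k * M i l) * (x l * y k) := by
      rw [e1, Finset.sum_comm, ← Finset.sum_neg_distrib]
      refine Finset.sum_congr rfl fun k _ => ?_
      rw [← Finset.sum_neg_distrib]
      refine Finset.sum_congr rfl fun l _ => by ring
    rw [two_mul]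
    nth_rw 2 [e2]
    rw [e1, ← sub_eq_add_neg, ← Finset.sum_sub_distrib]
    refine Finset.sum_congr rfl fun k _ => ?_
    rw [← Finset.sum_sub_distrib]
    refine Finset.sum_congr rfl fun l _ => by ring
  have b : |2 * ((M *ᵥ x) i * (M *ᵥ y) j - (M *ᵥ x) j * (M *ᵥ y) i)| ≤ n ^ 2 * mm M * wd x y := by
    rw [key]
    refine (Finset.abs_sum_le_sum_abs _ _).trans ?_
    have : ∀ k ∈ Finset.univ, |∑ l, (M i k * M j l - M j k * M i l) * (x k * y l - x l * y k)| ≤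
        ∑ l : Fin n, mm M * wd x y := fun k _ => by
      refine (Finset.abs_sum_le_sum_abs _ _).trans (Finset.sum_le_sum fun l _ => ?_)
      rw [abs_mul]
      exact mul_le_mul (mm_coord M i j k l) (wd_coord x y k l) (abs_nonneg _) hmm
    refine (Finset.sum_le_sum this).trans (le_of_eq ?_)
    simp; ring
  rw [abs_mul, abs_two] at b
  have := abs_nonneg ((M *ᵥ x) i * (M *ᵥ y) j - (M *ᵥ x) j * (M *ᵥ y) i)
  linarith

lemma continuous_mm : Continuous (mm : Matrix (Fin n) (Fin n) ℝ → ℝ) := by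
  unfold mm
  refine continuous_norm.comp (continuous_pi fun p => ?_)
  have h (i j : Fin n) : Continuous fun M : Matrix (Fin n) (Fin n) ℝ => M i j :=
    continuous_apply_apply i j
  exact ((h _ _).mul (h _ _)).sub ((h _ _).mul (h _ _))

lemma mm_vecMulVec (p f : Fin n → ℝ) : mm (vecMulVec p f) = 0 := by
  rw [mm, norm_eq_zero]
  ext q
  simp [vecMulVec_apply]; ring

/-- A scale invariant distance between directions. -/
noncomputable def dl (x y : Fin n → ℝ) : ℝ := wd x y / (‖x‖ * ‖y‖)

lemma dl_nonneg (x y : Fin n → ℝ) : 0 ≤ dl x y := div_nonneg (wd_nonneg _ _) (by positivity)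

lemma dl_le_two (x y : Fin n → ℝ) : dl x y ≤ 2 := by
  apply div_le_of_le_mul₀ (by positivity) (by norm_num)
  linarith [wd_le_mul x y]

lemma dl_smul_smul {c : ℝ} (hc : c ≠ 0) (x y : Fin n → ℝ) : dl (c • x) (c • y) = dl x y := by
  have := abs_pos.2 hc
  rw [dl, dl, wd_smul_left, wd_smul_right, norm_smul, norm_smul, Real.norm_eq_abs]
  field_simp

/-- The map `x ↦ h x` is `s`-Lipschitz on `S` for the distance `dl`. -/
def LipOn (h : SLZ n) (S : Set (Fin n → ℝ)) (s : ℝ) : Prop :=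
  0 ≤ s ∧ ∀ x ∈ S, ∀ y ∈ S, dl (av h x) (av h y) ≤ s * dl x y

lemma LipOn.mono {h : SLZ n} {S T : Set (Fin n → ℝ)} {s t : ℝ} (H : LipOn h S s) (hT : T ⊆ S)
    (hst : s ≤ t) : LipOn h T t :=
  ⟨H.1.trans hst, fun x hx y hy => (H.2 x (hT hx) y (hT hy)).trans
    (mul_le_mul_of_nonneg_right hst (dl_nonneg _ _))⟩

lemma LipOn.mul {g h : SLZ n} {S T : Set (Fin n → ℝ)} {s t : ℝ} (Hg : LipOn g T s)
    (Hh : LipOn h S t) (hST : ∀ x ∈ S, av h x ∈ T) : LipOn (g * h) S (s * t) := by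
  refine ⟨mul_nonneg Hg.1 Hh.1, fun x hx y hy => ?_⟩
  rw [av_mul, av_mul, mul_assoc]
  exact (Hg.2 _ (hST x hx) _ (hST y hy)).trans
    (mul_le_mul_of_nonneg_left (Hh.2 x hx y hy) Hg.1)

lemma dl_mulVec_le {M : Matrix (Fin n) (Fin n) ℝ} {a : ℝ} (ha : 0 < a) {x y : Fin n → ℝ}
    (hx : x ≠ 0) (hy : y ≠ 0) (hax : a * ‖x‖ ≤ ‖M *ᵥ x‖) (hay : a * ‖y‖ ≤ ‖M *ᵥ y‖) :
    dl (M *ᵥ x) (M *ᵥ y) ≤ n ^ 2 * mm M / a ^ 2 * dl x y := by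
  have h1 := norm_pos_iff.2 hx
  have h2 := norm_pos_iff.2 hy
  have hp : a ^ 2 * (‖x‖ * ‖y‖) ≤ ‖M *ᵥ x‖ * ‖M *ᵥ y‖ := by
    calc a ^ 2 * (‖x‖ * ‖y‖) = (a * ‖x‖) * (a * ‖y‖) := by ring
      _ ≤ _ := mul_le_mul hax hay (by positivity) (norm_nonneg _)
  calc dl (M *ᵥ x) (M *ᵥ y) ≤ (n ^ 2 * mm M * wd x y) / (a ^ 2 * (‖x‖ * ‖y‖)) := by
        have := wd_nonneg x y
        have := mm_nonneg M
        apply div_le_div₀ (by positivity) (wd_mulVec_le M x y) (by positivity) hp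
    _ = _ := by rw [dl]; field_simp

lemma dl_zero_left (y : Fin n → ℝ) : dl 0 y = 0 := by simp [dl]

lemma dl_zero_right (y : Fin n → ℝ) : dl y 0 = 0 := by simp [dl]

lemma exists_lipOn (h : SLZ n) : ∃ s, LipOn h Set.univ s := by
  set b : ℝ := (∑ i, ∑ j, |matR h⁻¹ i j|) + 1 with hb
  have hb0 : 0 < b := by positivity
  refine ⟨n ^ 2 * mm (matR h) / (b⁻¹) ^ 2, by have := mm_nonneg (matR h); positivity,
    fun x _ y _ => ?_⟩
  have key (x : Fin n → ℝ) : b⁻¹ * ‖x‖ ≤ ‖matR h *ᵥ x‖ := by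
    rw [inv_mul_le_iff₀ hb0]
    have := norm_mulVec_le (matR h⁻¹) (matR h *ᵥ x)
    rw [← av_apply, ← av_apply, av_inv_av, av_apply] at this
    refine this.trans (mul_le_mul_of_nonneg_right ?_ (norm_nonneg _))
    linarith
  by_cases hx : x = 0
  · subst hx; simp [dl_zero_left]
  by_cases hy : y = 0
  · subst hy; simp [dl_zero_right]
  exact dl_mulVec_le (by positivity) hx hy (key x) (key y)

/-- The cone of directions close to `p`. -/
def U (p : Fin n → ℝ) (η : ℝ) : Set (Fin n → ℝ) := {u | wd u p < η * ‖u‖}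

lemma isOpen_U (p : Fin n → ℝ) (η : ℝ) : IsOpen (U p η) :=
  isOpen_lt (continuous_wd_left p) (by fun_prop)

lemma ne_zero_of_mem_U {p u : Fin n → ℝ} {η : ℝ} (h : u ∈ U p η) : u ≠ 0 := by
  rintro rfl; simp [U] at h

lemma smul_mem_U {p u : Fin n → ℝ} {η : ℝ} {c : ℝ} (hc : c ≠ 0) (h : u ∈ U p η) :
    c • u ∈ U p η := by
  have := abs_pos.2 hc
  simp only [U, Set.mem_ofPred_eq, wd_smul_left, norm_smul, Real.norm_eq_abs] at h ⊢
  nlinarith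

lemma self_mem_U {p : Fin n → ℝ} {η : ℝ} (hp : p ≠ 0) (hη : 0 < η) : p ∈ U p η := by
  have := norm_pos_iff.2 hp
  simp only [U, Set.mem_ofPred_eq, wd_self]; positivity

/-- Small cones around `p` consist of multiples of vectors in a given neighbourhood of `p`. -/
lemma eventually_U_smul_mem {O : Set (Fin n → ℝ)} {p : Fin n → ℝ} (hO : O ∈ 𝓝 p) (hp : p ≠ 0) :
    ∀ᶠ η in 𝓝[>] (0 : ℝ), ∀ u ∈ U p η, ∃ c : ℝ, c ≠ 0 ∧ c • u ∈ O := by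
  have hO' : O ∩ {0}ᶜ ∈ 𝓝 p := inter_mem hO (isOpen_compl_singleton.mem_nhds hp)
  obtain ⟨r, hr, hrO⟩ := Metric.mem_nhds_iff.1 hO'
  filter_upwards [Ioo_mem_nhdsGT hr] with η hη u hu
  have hu0 := ne_zero_of_mem_U hu
  have hn := norm_pos_iff.2 hu0
  obtain ⟨c, hc⟩ := exists_smul_close hu0 p
  have h1 : ‖c • u - p‖ < r := by
    have : ‖c • u - p‖ * ‖u‖ < r * ‖u‖ := hc.trans_lt (lt_trans hu (by nlinarith [hη.2]))
    exact lt_of_mul_lt_mul_right this hn.le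
  have h2 := hrO (mem_ball_iff_norm.2 h1)
  refine ⟨c, ?_, h2.1⟩
  rintro rfl
  exact h2.2 (by simp)

/-- A set invariant under multiplication by nonzero scalars. -/
def IsCone (S : Set (Fin n → ℝ)) : Prop := ∀ x ∈ S, ∀ c : ℝ, c ≠ 0 → c • x ∈ S

lemma isCone_U (p : Fin n → ℝ) (η : ℝ) : IsCone (U p η) := fun _ hx _ hc => smul_mem_U hc hx

lemma eventually_U_subset {O : Set (Fin n → ℝ)} {p : Fin n → ℝ} (hO : O ∈ 𝓝 p) (hp : p ≠ 0)
    (hc : IsCone O) : ∀ᶠ η in 𝓝[>] (0 : ℝ), U p η ⊆ O := by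
  filter_upwards [eventually_U_smul_mem hO hp] with η hη u hu
  obtain ⟨c, hc0, hcu⟩ := hη u hu
  simpa [smul_smul, inv_mul_cancel₀ hc0] using hc _ hcu c⁻¹ (inv_ne_zero hc0)

/-- Contraction: if multiples of `A N` tend to the rank one matrix `p ⊗ φ`, then `A N` eventually
maps the complement of a neighbourhood of `ker φ` into a small cone around `p`, contracting. -/
lemma eventually_contract {A : ℕ → SLZ n} {c : ℕ → ℝ} {p φ : Fin n → ℝ}
    (hA : Tendsto (fun N => c N • matR (A N)) atTop (𝓝 (vecMulVec p φ))) (hp : p ≠ 0)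
    {κ η ε : ℝ} (hκ : 0 < κ) (hη : 0 < η) (hε : 0 < ε) :
    ∀ᶠ N in atTop, (∀ y, y ≠ 0 → κ * ‖y‖ ≤ |φ ⬝ᵥ y| → av (A N) y ∈ U p η) ∧
      LipOn (A N) {y | κ * ‖y‖ ≤ |φ ⬝ᵥ y|} ε := by
  have hp0 := norm_pos_iff.2 hp
  set δ : ℕ → ℝ := fun N => ∑ i, ∑ j, |(c N • matR (A N) - vecMulVec p φ) i j| with hδ
  have hδ0 : Tendsto δ atTop (𝓝 0) := by
    have hc : Continuous fun M : Matrix (Fin n) (Fin n) ℝ => ∑ i, ∑ j, |M i j| := by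
      refine continuous_finsetSum _ fun i _ => continuous_finsetSum _ fun j _ => ?_
      exact (continuous_apply_apply i j).abs
    have h1 := hA.sub_const (vecMulVec p φ)
    rw [sub_self] at h1
    have h2 := (hc.tendsto 0).comp h1
    simp only [Matrix.zero_apply, abs_zero, Finset.sum_const_zero] at h2
    exact h2
  have hm0 : Tendsto (fun N => mm (c N • matR (A N))) atTop (𝓝 0) := by
    have := (continuous_mm.tendsto (vecMulVec p φ)).comp hA
    rwa [mm_vecMulVec] at this
  set a : ℝ := κ * ‖p‖ / 2 with ha
  have ha0 : 0 < a := by positivity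
  have e1 : ∀ᶠ N in atTop, δ N < a := hδ0.eventually (gt_mem_nhds ha0)
  have e2 : ∀ᶠ N in atTop, 2 * δ N * ‖p‖ < η * a := by
    have : Tendsto (fun N => 2 * δ N * ‖p‖) atTop (𝓝 0) := by
      simpa using (hδ0.const_mul 2).mul_const ‖p‖
    exact this.eventually (gt_mem_nhds (by positivity))
  have e3 : ∀ᶠ N in atTop, n ^ 2 * mm (c N • matR (A N)) / a ^ 2 < ε := by
    have : Tendsto (fun N => (n : ℝ) ^ 2 * mm (c N • matR (A N)) / a ^ 2) atTop (𝓝 0) := by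
      simpa using (hm0.const_mul ((n : ℝ) ^ 2)).div_const (a ^ 2)
    exact this.eventually (gt_mem_nhds hε)
  filter_upwards [e1, e2, e3] with N h1 h2 h3
  have close (y : Fin n → ℝ) :
      ‖(c N • matR (A N)) *ᵥ y - (φ ⬝ᵥ y) • p‖ ≤ δ N * ‖y‖ := by
    have := norm_mulVec_le (c N • matR (A N) - vecMulVec p φ) y
    rw [Matrix.sub_mulVec] at this
    convert this using 3
    ext i
    simp [vecMulVec_mulVec, mul_comm]
  have low (y : Fin n → ℝ) (hy : κ * ‖y‖ ≤ |φ ⬝ᵥ y|) :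
      a * ‖y‖ ≤ ‖(c N • matR (A N)) *ᵥ y‖ := by
    have h4 : ‖(φ ⬝ᵥ y) • p‖ ≤ ‖(c N • matR (A N)) *ᵥ y‖ + δ N * ‖y‖ := by
      have := norm_sub_norm_le ((φ ⬝ᵥ y) • p) ((c N • matR (A N)) *ᵥ y)
      rw [norm_sub_rev] at this
      linarith [close y]
    rw [norm_smul, Real.norm_eq_abs] at h4
    have h5 := mul_le_mul_of_nonneg_right hy hp0.le
    have h6 := mul_le_mul_of_nonneg_right h1.le (norm_nonneg y)
    have : κ * ‖y‖ * ‖p‖ = 2 * (a * ‖y‖) := by rw [ha]; ring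
    linarith
  refine ⟨fun y hy0 hy => ?_, ?_⟩
  · have hyp := norm_pos_iff.2 hy0
    have hl := low y hy
    have hcN : c N ≠ 0 := by
      intro h
      rw [h, zero_smul, zero_mulVec, norm_zero] at hl
      nlinarith
    have : c N • av (A N) y ∈ U p η := by
      rw [av_apply, ← smul_mulVec]
      show wd _ _ < _
      rw [← wd_sub_smul _ _ (φ ⬝ᵥ y)]
      calc _ ≤ _ := wd_le_mul _ _
        _ ≤ 2 * (δ N * ‖y‖) * ‖p‖ := by gcongr; exact close y
        _ = (2 * δ N * ‖p‖) * ‖y‖ := by ring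
        _ < η * a * ‖y‖ := by gcongr
        _ = η * (a * ‖y‖) := by ring
        _ ≤ _ := by gcongr
    simpa [smul_smul, inv_mul_cancel₀ hcN] using smul_mem_U (inv_ne_zero hcN) this
  · refine ⟨hε.le, fun x hx y hy => ?_⟩
    by_cases hx0 : x = 0
    · subst hx0; simp [dl_zero_left]
    by_cases hy0 : y = 0
    · subst hy0; simp [dl_zero_right]
    have hl := low x hx
    have hcN : c N ≠ 0 := by
      intro h
      rw [h, zero_smul, zero_mulVec, norm_zero] at hl
      have := norm_pos_iff.2 hx0
      nlinarith
    rw [← dl_smul_smul hcN, av_apply, av_apply, ← smul_mulVec, ← smul_mulVec]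
    refine (dl_mulVec_le ha0 hx0 hy0 hl (low y hy)).trans ?_
    exact mul_le_mul_of_nonneg_right h3.le (dl_nonneg _ _)

/-- `S` is a finite union of sets whose diameters (for `dl`) add up to at most the given bound. -/
inductive Cov : Set (Fin n → ℝ) → ℝ → Prop
  | single (S : Set (Fin n → ℝ)) (a : ℝ) (ha : 0 ≤ a) (h : ∀ x ∈ S, ∀ y ∈ S, dl x y ≤ a) : Cov S a
  | union (S T : Set (Fin n → ℝ)) (a b : ℝ) (hS : Cov S a) (hT : Cov T b) : Cov (S ∪ T) (a + b)
  | mono (S T : Set (Fin n → ℝ)) (a b : ℝ) (hS : Cov S a) (hTS : T ⊆ S) (hab : a ≤ b) : Cov T b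

lemma cov_empty : Cov (∅ : Set (Fin n → ℝ)) 0 := Cov.single _ _ le_rfl (by simp)

lemma Cov.image {S T : Set (Fin n → ℝ)} {a s : ℝ} {h : SLZ n} (H : Cov S a) (hL : LipOn h T s) :
    Cov (av h '' (S ∩ T)) (s * a) := by
  induction H with
  | single S a ha h' =>
    refine Cov.single _ _ (mul_nonneg hL.1 ha) ?_
    rintro _ ⟨x, hx, rfl⟩ _ ⟨y, hy, rfl⟩
    exact (hL.2 x hx.2 y hy.2).trans (mul_le_mul_of_nonneg_left (h' x hx.1 y hy.1) hL.1)
  | union S T a b _ _ h1 h2 =>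
    rw [Set.union_inter_distrib_right, Set.image_union, mul_add]
    exact Cov.union _ _ _ _ h1 h2
  | mono S T a b _ hTS hab h1 =>
    exact Cov.mono _ _ _ _ h1 (Set.image_mono (Set.inter_subset_inter_left _ hTS))
      (mul_le_mul_of_nonneg_left hab hL.1)

lemma cov_biUnion {ι : Type*} (J : Finset ι) (S : ι → Set (Fin n → ℝ)) (a : ι → ℝ)
    (h : ∀ i ∈ J, Cov (S i) (a i)) : Cov (⋃ i ∈ J, S i) (∑ i ∈ J, a i) := by
  classical
  induction J using Finset.induction_on with
  | empty => simpa using cov_empty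
  | insert i J hi ih =>
    rw [Finset.set_biUnion_insert, Finset.sum_insert hi]
    exact Cov.union _ _ _ _ (h i (by simp)) (ih fun j hj => h j (by simp [hj]))

end Basics

section Words

variable {G : Type*} [Group G] {X : Type*}

/-- Reduced words in the letters `c x` and elements of `A`, starting with the letter `c x`. -/
inductive Red (A : Subgroup G) (bar : X → X) (c : X → G) : X → G → Prop
  | last (x : X) (h : G) (hh : h ∈ A) : Red A bar c x (c x * h)
  | cons (x y : X) (h v : G) (hh : h ∈ A) (hv : Red A bar c y v) (hr : h = 1 → y ≠ bar x) :
      Red A bar c x (c x * (h * v))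

lemma Red.decomp {A : Subgroup G} {bar : X → X} {c : X → G}
    (hc : ∀ x, c (bar x) = (c x)⁻¹) {g : G}
    (hg : g ∈ Subgroup.closure ((A : Set G) ∪ Set.range c)) :
    g ∈ A ∨ ∃ h ∈ A, ∃ y v, Red A bar c y v ∧ g = h * v := by
  have hA {h g : G} (hh : h ∈ A) (hg : g ∈ A ∨ ∃ h ∈ A, ∃ y v, Red A bar c y v ∧ g = h * v) :
      h * g ∈ A ∨ ∃ h' ∈ A, ∃ y v, Red A bar c y v ∧ h * g = h' * v := by
    rcases hg with hg | ⟨h', hh', y, v, hv, rfl⟩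
    · exact Or.inl (A.mul_mem hh hg)
    · exact Or.inr ⟨h * h', A.mul_mem hh hh', y, v, hv, by rw [mul_assoc]⟩
  have hX {g : G} (x : X) (hg : g ∈ A ∨ ∃ h ∈ A, ∃ y v, Red A bar c y v ∧ g = h * v) :
      c x * g ∈ A ∨ ∃ h' ∈ A, ∃ y v, Red A bar c y v ∧ c x * g = h' * v := by
    rcases hg with hg | ⟨h, hh, y, v, hv, rfl⟩
    · exact Or.inr ⟨1, A.one_mem, x, _, Red.last x g hg, by simp⟩
    · by_cases hr : h = 1 → y ≠ bar x
      · exact Or.inr ⟨1, A.one_mem, x, _, Red.cons x y h v hh hv hr, by simp⟩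
      · push Not at hr
        obtain ⟨rfl, rfl⟩ := hr
        cases hv with
        | last _ h' hh' => left; simpa [hc] using hh'
        | cons _ y' h' v' hh' hv' hr' =>
          exact Or.inr ⟨h', hh', y', v', hv', by simp [hc]⟩
  induction hg using Subgroup.closure_induction_left with
  | one => exact Or.inl A.one_mem
  | mul_left x hx y hy ih =>
    rcases hx with hx | ⟨x, rfl⟩
    · exact hA hx ih
    · exact hX x ih
  | inv_mul_cancel x hx y hy ih =>
    rcases hx with hx | ⟨x, rfl⟩
    · exact hA (A.inv_mem hx) ih
    · rw [← hc]; exact hX _ ih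

lemma Red.mem {A : Subgroup G} {bar : X → X} {c : X → G} {x : X} {v : G} (h : Red A bar c x v) :
    v ∈ Subgroup.closure ((A : Set G) ∪ Set.range c) := by
  have h1 {a : G} (ha : a ∈ A) : a ∈ Subgroup.closure ((A : Set G) ∪ Set.range c) :=
    Subgroup.subset_closure (Or.inl ha)
  have h2 (x : X) : c x ∈ Subgroup.closure ((A : Set G) ∪ Set.range c) :=
    Subgroup.subset_closure (Or.inr ⟨x, rfl⟩)
  induction h with
  | last x h hh => exact mul_mem (h2 x) (h1 hh)
  | cons x y h v hh _ _ ih => exact mul_mem (h2 x) (mul_mem (h1 hh) ih)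

lemma Red.map {G' : Type*} [Group G'] {A : Subgroup G} {A' : Subgroup G'} {bar : X → X}
    {c : X → G} (f : G →* G') (hf : ∀ a ∈ A, f a ∈ A') (hf1 : ∀ a ∈ A, f a = 1 → a = 1)
    {x : X} {v : G} (h : Red A bar c x v) : Red A' bar (fun x => f (c x)) x (f v) := by
  induction h with
  | last x h hh => rw [map_mul]; exact Red.last x _ (hf h hh)
  | cons x y h v hh _ hr ih =>
    rw [map_mul, map_mul]
    exact Red.cons x y _ _ (hf h hh) ih fun h1 => hr (hf1 h hh h1)

end Words

section State

variable {n : ℕ}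

/-- The best Lipschitz constant of `h` on `S`. -/
noncomputable def lip (S : Set (Fin n → ℝ)) (h : SLZ n) : ℝ := sInf {s | LipOn h S s}

lemma lip_nonneg (S : Set (Fin n → ℝ)) (h : SLZ n) : 0 ≤ lip S h :=
  Real.sInf_nonneg fun _ hs => hs.1

lemma lip_le {S : Set (Fin n → ℝ)} {h : SLZ n} {s : ℝ} (H : LipOn h S s) : lip S h ≤ s :=
  csInf_le ⟨0, fun _ hs => hs.1⟩ H

lemma lipOn_lip (S : Set (Fin n → ℝ)) (h : SLZ n) : LipOn h S (lip S h) := by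
  refine ⟨lip_nonneg S h, fun x hx y hy => ?_⟩
  obtain ⟨s, hs⟩ := exists_lipOn h
  have hne : {s | LipOn h S s}.Nonempty := ⟨s, hs.mono (Set.subset_univ _) le_rfl⟩
  rcases (dl_nonneg x y).eq_or_lt with h0 | h0
  · have := hs.2 x (Set.mem_univ _) y (Set.mem_univ _)
    rw [← h0] at this ⊢; simpa using this
  · rw [← div_le_iff₀ h0]
    exact le_csInf hne fun s hs => by
      rw [div_le_iff₀ h0]; exact hs.2 x hx y hy

/-- The subsets swept out by the elements of `H` outside `T`. -/
def sweep (H : Subgroup (SLZ n)) (T : Finset (SLZ n)) (F : Set (Fin n → ℝ)) : Set (Fin n → ℝ) :=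
  {y | ∃ h ∈ H, h ∉ T ∧ ∃ x ∈ F, y = av h x}

/-- The inductive state of the construction: a free set `S`, and an open cone `F` whose translates
under `⟨S⟩` are disjoint and accumulate on a small set, avoiding the hyperplanes from `B₁`, `B₂`. -/
structure IsState (B₁ B₂ : Set (Submodule ℝ (Fin n → ℝ))) (S : Set (SLZ n))
    (F : Set (Fin n → ℝ)) : Prop where
  isOpen : IsOpen F
  nonempty : F.Nonempty
  cone : IsCone F
  ne_zero : ∀ x ∈ F, x ≠ 0
  free : Function.Injective (FreeGroup.lift ((↑) : S → SLZ n))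
  move : ∀ h ∈ Subgroup.closure S, h ≠ 1 → ∀ x ∈ F, av h x ∉ F
  tail : ∃ C : ℝ, ∀ ε > 0, ∃ T : Finset (SLZ n), (∀ h ∈ T, h ∈ Subgroup.closure S) ∧
    ∑ h ∈ T, lip F h ≤ C ∧ Cov (sweep (Subgroup.closure S) T F) ε
  miss : ∀ W ∈ B₁ ∪ B₂, ∀ h ∈ Subgroup.closure S, ∀ w ∈ W, av h w ∉ F
  sep : ∀ W ∈ B₂, ∀ h ∈ Subgroup.closure S, W.map (av h) ∉ B₁

/-- Ping-pong data for adding the letters `c x` to a state. -/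
structure IsPingPong (H : Subgroup (SLZ n)) (F F' : Set (Fin n → ℝ)) {X : Type} (bar : X → X)
    (c : X → SLZ n) (P Q : X → Set (Fin n → ℝ)) (ε : ℝ) : Prop where
  bar_bar : ∀ x, bar (bar x) = x
  inv : ∀ x, c (bar x) = (c x)⁻¹
  P_sub : ∀ x, P x ⊆ F
  F'_sub : F' ⊆ F
  isOpen : IsOpen F'
  nonempty : F'.Nonempty
  cone : IsCone F'
  P_Q : ∀ x y, ∀ h ∈ H, (h = 1 → y ≠ bar x) → ∀ u ∈ P y, av h u ∈ Q x
  F'_Q : ∀ x, ∀ h ∈ H, ∀ u ∈ F', av h u ∈ Q x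
  disj : ∀ x, ∀ u ∈ P x, u ∉ F'
  Q_P : ∀ x, ∀ u ∈ Q x, u ≠ 0 → av (c x) u ∈ P x
  contr : ∀ x, LipOn (c x) (Q x) ε
  hyp : ∀ x, ∀ W : Submodule ℝ (Fin n → ℝ), Module.finrank ℝ W = n - 1 →
    (∀ w ∈ W, w ≠ 0 → w ∉ Q (bar x)) → ∃ w ∈ W, w ∈ P x

variable {B₁ B₂ : Set (Submodule ℝ (Fin n → ℝ))} {S : Set (SLZ n)} {F F' : Set (Fin n → ℝ)}
  {X : Type} {bar : X → X} {c : X → SLZ n} {P Q : X → Set (Fin n → ℝ)} {ε : ℝ}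

lemma IsPingPong.red_mem (hst : IsState B₁ B₂ S F)
    (hp : IsPingPong (Subgroup.closure S) F F' bar c P Q ε) {x : X} {v : SLZ n}
    (hv : Red (Subgroup.closure S) bar c x v) {u : Fin n → ℝ} (hu : u ∈ F') : av v u ∈ P x := by
  induction hv with
  | last x h hh =>
    rw [av_mul]
    exact hp.Q_P x _ (hp.F'_Q x h hh u hu) (av_ne_zero (hst.ne_zero u (hp.F'_sub hu)))
  | cons x y h v hh _ hr ih =>
    rw [av_mul, av_mul]
    exact hp.Q_P x _ (hp.P_Q x y h hh hr _ ih) (av_ne_zero (hst.ne_zero _ (hp.P_sub y ih)))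

lemma IsPingPong.red_move (hst : IsState B₁ B₂ S F)
    (hp : IsPingPong (Subgroup.closure S) F F' bar c P Q ε) {x : X} {h v : SLZ n}
    (hh : h ∈ Subgroup.closure S)
    (hv : Red (Subgroup.closure S) bar c x v) {u : Fin n → ℝ} (hu : u ∈ F') :
    av (h * v) u ∉ F' := by
  have h1 := hp.red_mem hst hv hu
  rw [av_mul]
  by_cases h0 : h = 1
  · subst h0; rw [av_one]; exact hp.disj x _ h1
  · exact fun h2 => hst.move h hh h0 _ (hp.P_sub x h1) (hp.F'_sub h2)

lemma IsPingPong.red_ne_one (hst : IsState B₁ B₂ S F)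
    (hp : IsPingPong (Subgroup.closure S) F F' bar c P Q ε) {x : X} {h v : SLZ n}
    (hh : h ∈ Subgroup.closure S)
    (hv : Red (Subgroup.closure S) bar c x v) : h * v ≠ 1 := fun h1 => by
  obtain ⟨u, hu⟩ := hp.nonempty
  exact hp.red_move hst hh hv hu (by rwa [h1, av_one])

lemma IsPingPong.red_hyp (hst : IsState B₁ B₂ S F)
    (hp : IsPingPong (Subgroup.closure S) F F' bar c P Q ε) {x : X} {v : SLZ n}
    (hv : Red (Subgroup.closure S) bar c x v) {W : Submodule ℝ (Fin n → ℝ)} (hW : W ∈ B₂)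
    {w : Fin n → ℝ} (hw : w ∈ W) (hw0 : w ≠ 0) : av v w ∉ Q (bar x) := by
  induction hv with
  | last x h hh =>
    intro h1
    have h2 := hp.Q_P _ _ h1 (av_ne_zero hw0)
    rw [hp.inv, av_mul, av_inv_av] at h2
    exact hst.miss W (Or.inr hW) h hh w hw (hp.P_sub _ h2)
  | cons x y h v hh _ hr ih =>
    intro h1
    have h2 := hp.Q_P _ _ h1 (av_ne_zero hw0)
    rw [hp.inv, av_mul, av_inv_av] at h2
    apply ih
    have h3 := hp.P_Q (bar y) (bar x) h⁻¹ (inv_mem hh) (fun h4 h5 => hr (by simpa using h4) (by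
      rw [hp.bar_bar] at h5; exact h5.symm)) _ h2
    rwa [av_mul, av_inv_av] at h3

end State

section Tail

variable {n : ℕ} {B₁ B₂ : Set (Submodule ℝ (Fin n → ℝ))} {S : Set (SLZ n)}
  {F F' : Set (Fin n → ℝ)}
  {X : Type} {bar : X → X} {c : X → SLZ n} {P Q : X → Set (Fin n → ℝ)} {ε : ℝ}

/-- The images of `F'` under reduced words not in `J`. -/
def redSweep (S : Set (SLZ n)) (bar : X → X) (c : X → SLZ n) (J : Finset (X × SLZ n))
    (F' : Set (Fin n → ℝ)) : Set (Fin n → ℝ) :=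
  {z | ∃ y v, Red (Subgroup.closure S) bar c y v ∧ (y, v) ∉ J ∧ ∃ u ∈ F', z = av v u}

/-- A finite set of reduced words of total Lipschitz weight at most one, such that the remaining
reduced words sweep out a set of content at most `η`. -/
def RedCov (S : Set (SLZ n)) (bar : X → X) (c : X → SLZ n) (F' : Set (Fin n → ℝ)) (η : ℝ) : Prop :=
  ∃ J : Finset (X × SLZ n), (∀ p ∈ J, Red (Subgroup.closure S) bar c p.1 p.2) ∧
    ∑ p ∈ J, lip F' p.2 ≤ 1 ∧ Cov (redSweep S bar c J F') η

lemma IsPingPong.redCov_base [Fintype X] (hst : IsState B₁ B₂ S F)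
    (hp : IsPingPong (Subgroup.closure S) F F' bar c P Q ε) :
    RedCov S bar c F' (Fintype.card X * 2) := by
  refine ⟨∅, by simp, by simp, ?_⟩
  have h1 : Cov (⋃ x ∈ (Finset.univ : Finset X), P x) (∑ x ∈ (Finset.univ : Finset X), 2) :=
    cov_biUnion _ _ _ fun i _ => Cov.single _ _ (by norm_num) fun x _ y _ => dl_le_two x y
  refine Cov.mono _ _ _ _ h1 ?_ (by simp)
  rintro _ ⟨y, v, hv, -, u, hu, rfl⟩
  simp only [Finset.mem_univ, Set.iUnion_true, Set.mem_iUnion]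
  exact ⟨y, hp.red_mem hst hv hu⟩

lemma IsPingPong.redCov_half [Fintype X] (hst : IsState B₁ B₂ S F)
    (hp : IsPingPong (Subgroup.closure S) F F' bar c P Q ε) {C : ℝ} (hC : ∀ ε > 0,
      ∃ T : Finset (SLZ n), (∀ h ∈ T, h ∈ Subgroup.closure S) ∧
      ∑ h ∈ T, lip F h ≤ C ∧ Cov (sweep (Subgroup.closure S) T F) ε)
    (hε0 : 0 ≤ ε) (hε : Fintype.card X * (ε * C) ≤ 1 / 2) {η δ : ℝ} (hη : 0 ≤ η) (hδ : 0 < δ)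
    (h : RedCov S bar c F' η) : RedCov S bar c F' (η / 2 + δ) := by
  classical
  obtain ⟨J, hJ, hJ1, hJc⟩ := h
  obtain ⟨T, hT, hT1, hTc⟩ := hC (δ / (Fintype.card X * ε + 1)) (by positivity)
  have hC0 : 0 ≤ C := (Finset.sum_nonneg fun _ _ => lip_nonneg _ _).trans hT1
  let al : X → SLZ n → X → Prop := fun x f y => f = 1 → y ≠ bar x
  let J1 : Finset (X × SLZ n) := (Finset.univ ×ˢ T).image fun p => (p.1, c p.1 * p.2)
  let K2 : Finset (X × SLZ n × X × SLZ n) :=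
    (Finset.univ ×ˢ T ×ˢ J).filter fun p => al p.1 p.2.1 p.2.2.1
  let J2 : Finset (X × SLZ n) := K2.image fun p => (p.1, c p.1 * (p.2.1 * p.2.2.2))
  have hLT {x : X} {f : SLZ n} (hf : f ∈ T) : LipOn (c x * f) F' (ε * lip F f) :=
    (hp.contr x).mul ((lipOn_lip F f).mono hp.F'_sub le_rfl) fun u hu => hp.F'_Q x f (hT f hf) u hu
  have hLJ {x y : X} {f v : SLZ n} (hf : f ∈ T) (hv : (y, v) ∈ J) (ha : al x f y) :
      LipOn (c x * (f * v)) F' (ε * (lip F f * lip F' v)) := by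
    have h1 : LipOn (f * v) F' (lip F f * lip F' v) :=
      (lipOn_lip F f).mul (lipOn_lip F' v) fun u hu => hp.P_sub y (hp.red_mem hst (hJ _ hv) hu)
    refine (hp.contr x).mul h1 fun u hu => ?_
    rw [av_mul]
    exact hp.P_Q x y f (hT f hf) ha _ (hp.red_mem hst (hJ _ hv) hu)
  have hS1 : ∑ p ∈ J1, lip F' p.2 ≤ 1 / 2 := by
    calc ∑ p ∈ J1, lip F' p.2 ≤ ∑ p ∈ (Finset.univ : Finset X) ×ˢ T, lip F' (c p.1 * p.2) :=
          Finset.sum_image_le_of_nonneg (fun _ _ => lip_nonneg _ _)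
      _ ≤ ∑ p ∈ (Finset.univ : Finset X) ×ˢ T, ε * lip F p.2 :=
          Finset.sum_le_sum fun p hp' => lip_le (hLT (Finset.mem_product.1 hp').2)
      _ = Fintype.card X * (ε * ∑ f ∈ T, lip F f) := by
          rw [Finset.sum_product]; simp [← Finset.mul_sum]
      _ ≤ Fintype.card X * (ε * C) := by gcongr
      _ ≤ 1 / 2 := hε
  have hS2 : ∑ p ∈ J2, lip F' p.2 ≤ 1 / 2 := by
    calc ∑ p ∈ J2, lip F' p.2 ≤ ∑ p ∈ K2, lip F' (c p.1 * (p.2.1 * p.2.2.2)) :=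
          Finset.sum_image_le_of_nonneg (fun _ _ => lip_nonneg _ _)
      _ ≤ ∑ p ∈ K2, ε * (lip F p.2.1 * lip F' p.2.2.2) := by
          refine Finset.sum_le_sum fun p hp' => ?_
          simp only [K2, Finset.mem_filter, Finset.mem_product] at hp'
          exact lip_le (hLJ hp'.1.2.1 hp'.1.2.2 hp'.2)
      _ ≤ ∑ p ∈ (Finset.univ : Finset X) ×ˢ T ×ˢ J, ε * (lip F p.2.1 * lip F' p.2.2.2) := by
          refine Finset.sum_le_sum_of_subset_of_nonneg (Finset.filter_subset _ _) fun p _ _ => ?_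
          have := lip_nonneg F p.2.1
          have := lip_nonneg F' p.2.2.2
          positivity
      _ = Fintype.card X * (ε * ((∑ f ∈ T, lip F f) * ∑ p ∈ J, lip F' p.2)) := by
          rw [Finset.sum_product, Finset.sum_mul_sum]
          simp only [Finset.sum_product, ← Finset.mul_sum]
          simp; ring
      _ ≤ Fintype.card X * (ε * (C * 1)) := by
          have : 0 ≤ ∑ p ∈ J, lip F' p.2 := Finset.sum_nonneg fun _ _ => lip_nonneg _ _
          gcongr
      _ ≤ 1 / 2 := by simpa using hε
  refine ⟨J1 ∪ J2, fun p hp' => ?_, ?_, ?_⟩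
  · rcases Finset.mem_union.1 hp' with h1 | h1
    · simp only [J1, Finset.mem_image, Finset.mem_product] at h1
      obtain ⟨q, hq, rfl⟩ := h1
      exact Red.last _ _ (hT _ hq.2)
    · simp only [J2, K2, Finset.mem_image, Finset.mem_product, Finset.mem_filter] at h1
      obtain ⟨q, hq, rfl⟩ := h1
      exact Red.cons _ _ _ _ (hT _ hq.1.2.1) (hJ _ hq.1.2.2) hq.2
  · have h1 := Finset.sum_union_inter (s₁ := J1) (s₂ := J2) (f := fun p => lip F' p.2)
    have h2 : 0 ≤ ∑ p ∈ J1 ∩ J2, lip F' p.2 := Finset.sum_nonneg fun _ _ => lip_nonneg _ _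
    linarith
  · have c1 : Cov (⋃ x ∈ (Finset.univ : Finset X),
        av (c x) '' (sweep (Subgroup.closure S) T F ∩ Q x))
        (∑ x ∈ (Finset.univ : Finset X), ε * (δ / (Fintype.card X * ε + 1))) :=
      cov_biUnion _ _ _ fun x _ => hTc.image (hp.contr x)
    have c2 : Cov (⋃ p ∈ (Finset.univ : Finset X) ×ˢ T,
        av (c p.1) '' ((av p.2 '' (redSweep S bar c J F' ∩ F)) ∩ Q p.1))
        (∑ p ∈ (Finset.univ : Finset X) ×ˢ T, ε * (lip F p.2 * η)) :=
      cov_biUnion _ _ _ fun p _ => (hJc.image (lipOn_lip F p.2)).image (hp.contr p.1)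
    refine Cov.mono _ _ _ _ (c1.union _ _ _ _ c2) ?_ ?_
    · rintro _ ⟨y, v, hv, hvJ, u, hu, rfl⟩
      simp only [Set.mem_union, Set.mem_iUnion]
      cases hv with
      | last _ h hh =>
        left
        refine ⟨y, Finset.mem_univ _, av h u, ⟨⟨h, hh, fun hT' => hvJ ?_, u, hp.F'_sub hu, rfl⟩,
          hp.F'_Q y h hh u hu⟩, by rw [av_mul]⟩
        simp only [J1, Finset.mem_union, Finset.mem_image, Finset.mem_product]
        exact Or.inl ⟨(y, h), ⟨Finset.mem_univ _, hT'⟩, rfl⟩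
      | cons _ y' h v' hh hv' hr =>
        have hu' := hp.red_mem hst hv' hu
        have hQ := hp.P_Q y y' h hh hr _ hu'
        by_cases hT' : h ∈ T
        · right
          refine ⟨(y, h), by simp [hT'], av h (av v' u), ⟨⟨av v' u, ⟨⟨y', v', hv', fun hv'J =>
            hvJ ?_, u, hu, rfl⟩, hp.P_sub _ hu'⟩, rfl⟩, hQ⟩, by rw [av_mul, av_mul]⟩
          simp only [J2, K2, Finset.mem_union, Finset.mem_image, Finset.mem_product,
            Finset.mem_filter]
          exact Or.inr ⟨(y, h, y', v'), ⟨⟨Finset.mem_univ _, hT', hv'J⟩, hr⟩, rfl⟩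
        · left
          exact ⟨y, Finset.mem_univ _, av h (av v' u), ⟨⟨h, hh, hT', _, hp.P_sub _ hu', rfl⟩, hQ⟩,
            by rw [av_mul, av_mul]⟩
    · have e1 : ∑ x ∈ (Finset.univ : Finset X), ε * (δ / (Fintype.card X * ε + 1)) ≤ δ := by
        simp only [Finset.sum_const, Finset.card_univ, nsmul_eq_mul]
        rw [← mul_assoc, mul_div_assoc', div_le_iff₀ (by positivity)]
        nlinarith
      have e2 : ∑ p ∈ (Finset.univ : Finset X) ×ˢ T, ε * (lip F p.2 * η) ≤ η / 2 := by
        calc _ = Fintype.card X * (ε * ((∑ f ∈ T, lip F f) * η)) := by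
              rw [Finset.sum_product]; simp [← Finset.mul_sum, ← Finset.sum_mul]
          _ ≤ Fintype.card X * (ε * (C * η)) := by gcongr
          _ = (Fintype.card X * (ε * C)) * η := by ring
          _ ≤ 1 / 2 * η := by gcongr
          _ = η / 2 := by ring
      linarith

lemma IsPingPong.redCov [Fintype X] (hst : IsState B₁ B₂ S F)
    (hp : IsPingPong (Subgroup.closure S) F F' bar c P Q ε) {C : ℝ} (hC : ∀ ε > 0,
      ∃ T : Finset (SLZ n), (∀ h ∈ T, h ∈ Subgroup.closure S) ∧
      ∑ h ∈ T, lip F h ≤ C ∧ Cov (sweep (Subgroup.closure S) T F) ε)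
    (hε0 : 0 ≤ ε) (hε : Fintype.card X * (ε * C) ≤ 1 / 2) {η : ℝ} (hη : 0 < η) :
    RedCov S bar c F' η := by
  have key (r : ℕ) : RedCov S bar c F' (Fintype.card X * 2 * (1 / 2) ^ r + η / 2) := by
    induction r with
    | zero =>
      obtain ⟨J, h1, h2, h3⟩ := hp.redCov_base hst
      exact ⟨J, h1, h2, Cov.mono _ _ _ _ h3 subset_rfl (by simp; positivity)⟩
    | succ r ih =>
      have := hp.redCov_half hst hC hε0 hε (δ := η / 4) (by positivity) (by positivity) ih
      convert this using 1
      rw [pow_succ]; ring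
  have ht : Tendsto (fun r : ℕ => (Fintype.card X : ℝ) * 2 * (1 / 2) ^ r) atTop (𝓝 0) := by
    simpa using (tendsto_pow_atTop_nhds_zero_of_lt_one (r := (1 / 2 : ℝ)) (by norm_num)
      (by norm_num)).const_mul ((Fintype.card X : ℝ) * 2)
  obtain ⟨r, hr⟩ := (ht.eventually (gt_mem_nhds (show 0 < η / 2 by positivity))).exists
  obtain ⟨J, h1, h2, h3⟩ := key r
  exact ⟨J, h1, h2, Cov.mono _ _ _ _ h3 subset_rfl (by linarith)⟩

end Tail

section Extend

variable {n : ℕ} {B₁ B₂ : Set (Submodule ℝ (Fin n → ℝ))} {S : Set (SLZ n)}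
  {F F' : Set (Fin n → ℝ)}
  {I : Type} {c : I × Bool → SLZ n} {P Q : I × Bool → Set (Fin n → ℝ)} {ε : ℝ}

/-- The involution exchanging a letter and its inverse. -/
def flip2 (x : I × Bool) : I × Bool := (x.1, !x.2)

lemma closure_union_letters {G : Type*} [Group G] (S : Set G) {c : I × Bool → G}
    (hinv : ∀ x, c (flip2 x) = (c x)⁻¹) :
    Subgroup.closure (S ∪ Set.range fun i => c (i, true)) =
      Subgroup.closure ((Subgroup.closure S : Set G) ∪ Set.range c) := by
  apply le_antisymm
  · rw [Subgroup.closure_le]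
    rintro g (hg | ⟨i, rfl⟩)
    · exact Subgroup.subset_closure (Or.inl (Subgroup.subset_closure hg))
    · exact Subgroup.subset_closure (Or.inr ⟨_, rfl⟩)
  · rw [Subgroup.closure_le]
    rintro g (hg | ⟨⟨i, b⟩, rfl⟩)
    · exact Subgroup.closure_mono Set.subset_union_left hg
    · cases b
      · have := hinv (i, true)
        simp only [flip2, Bool.not_true] at this
        rw [this]
        exact inv_mem (Subgroup.subset_closure (Or.inr ⟨i, rfl⟩))
      · exact Subgroup.subset_closure (Or.inr ⟨i, rfl⟩)

lemma IsPingPong.free (hst : IsState B₁ B₂ S F)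
    (hp : IsPingPong (Subgroup.closure S) F F' flip2 c P Q ε) :
    Function.Injective (FreeGroup.lift
      ((↑) : (S ∪ Set.range fun i => c (i, true) : Set (SLZ n)) → SLZ n)) := by
  set S' : Set (SLZ n) := S ∪ Set.range fun i => c (i, true) with hS'
  set f := FreeGroup.lift ((↑) : S' → SLZ n) with hf
  let j : S → S' := fun s => ⟨s, Or.inl s.2⟩
  let A : Subgroup (FreeGroup S') := (FreeGroup.map j).range
  have hfj (w : FreeGroup S) : f (FreeGroup.map j w) = FreeGroup.lift ((↑) : S → SLZ n) w := by
    have : f.comp (FreeGroup.map j) = FreeGroup.lift ((↑) : S → SLZ n) := by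
      ext s; simp [hf, j]
    exact DFunLike.congr_fun this w
  let a : I → FreeGroup S' := fun i => FreeGroup.of ⟨c (i, true), Or.inr ⟨i, rfl⟩⟩
  let cf : I × Bool → FreeGroup S' := fun x => if x.2 then a x.1 else (a x.1)⁻¹
  have hcf (x : I × Bool) : cf (flip2 x) = (cf x)⁻¹ := by
    rcases x with ⟨i, _ | _⟩ <;> simp [cf, flip2]
  have hcff (x : I × Bool) : f (cf x) = c x := by
    rcases x with ⟨i, _ | _⟩
    · have := hp.inv (i, true)
      simp only [flip2, Bool.not_true] at this
      simp [cf, a, hf, this]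
    · simp [cf, a, hf]
  have hAm : ∀ w ∈ A, f w ∈ Subgroup.closure S := by
    rintro _ ⟨w, rfl⟩
    rw [hfj]
    have : (FreeGroup.lift ((↑) : S → SLZ n)).range ≤ Subgroup.closure S := by
      rw [FreeGroup.range_lift_eq_closure]; simp
    exact this ⟨w, rfl⟩
  have hA1 : ∀ w ∈ A, f w = 1 → w = 1 := by
    rintro _ ⟨w, rfl⟩ h1
    rw [hfj] at h1
    rw [(map_eq_one_iff _ hst.free).1 h1, map_one]
  have htop : ∀ w : FreeGroup S',
      w ∈ Subgroup.closure ((A : Set (FreeGroup S')) ∪ Set.range cf) := by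
    intro w
    have h1 : Subgroup.closure (Set.range (FreeGroup.of : S' → FreeGroup S')) = ⊤ :=
      FreeGroup.closure_range_of _
    have h2 : Subgroup.closure (Set.range (FreeGroup.of : S' → FreeGroup S')) ≤
        Subgroup.closure ((A : Set (FreeGroup S')) ∪ Set.range cf) := by
      rw [Subgroup.closure_le]
      rintro _ ⟨⟨s, hs⟩, rfl⟩
      apply Subgroup.subset_closure
      rcases hs with hs | ⟨i, rfl⟩
      · exact Or.inl ⟨FreeGroup.of ⟨s, hs⟩, by simp [j]⟩
      · exact Or.inr ⟨(i, true), by simp [cf, a]⟩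
    rw [h1] at h2
    exact h2 trivial
  refine (injective_iff_map_eq_one f).2 fun w hw => ?_
  rcases Red.decomp hcf (htop w) with h1 | ⟨h, hh, y, v, hv, rfl⟩
  · exact hA1 w h1 hw
  · have hv' := hv.map f hAm hA1
    simp only [hcff] at hv'
    rw [map_mul] at hw
    exact absurd hw (hp.red_ne_one hst (hAm h hh) hv')

/-- Ping-pong data extends a state. -/
lemma IsPingPong.isState [Fintype I] (hB : ∀ W ∈ B₁ ∪ B₂, Module.finrank ℝ W = n - 1)
    (hst : IsState B₁ B₂ S F)
    (hp : IsPingPong (Subgroup.closure S) F F' flip2 c P Q ε) {C : ℝ} (hC : ∀ ε > 0,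
      ∃ T : Finset (SLZ n), (∀ h ∈ T, h ∈ Subgroup.closure S) ∧
      ∑ h ∈ T, lip F h ≤ C ∧ Cov (sweep (Subgroup.closure S) T F) ε)
    (hε0 : 0 ≤ ε) (hε : Fintype.card (I × Bool) * (ε * C) ≤ 1 / 2) :
    IsState B₁ B₂ (S ∪ Set.range fun i => c (i, true)) F' := by
  classical
  have hcl := closure_union_letters S hp.inv
  have dec {g : SLZ n} (hg : g ∈ Subgroup.closure (S ∪ Set.range fun i => c (i, true))) :
      g ∈ Subgroup.closure S ∨ ∃ h ∈ Subgroup.closure S, ∃ y v,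
        Red (Subgroup.closure S) flip2 c y v ∧ g = h * v := by
    rw [hcl] at hg
    exact Red.decomp hp.inv hg
  refine ⟨hp.isOpen, hp.nonempty, hp.cone, fun x hx => hst.ne_zero x (hp.F'_sub hx), hp.free hst,
    ?_, ⟨2 * C, fun η hη => ?_⟩, ?_, ?_⟩
  · intro g hg hg1 u hu
    rcases dec hg with h1 | ⟨h, hh, y, v, hv, rfl⟩
    · exact fun h2 => hst.move g h1 hg1 u (hp.F'_sub hu) (hp.F'_sub h2)
    · exact hp.red_move hst hh hv hu
  · obtain ⟨T, hT, hT1, hTc⟩ := hC (η / 2) (by positivity)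
    have hC0 : 0 ≤ C := (Finset.sum_nonneg fun _ _ => lip_nonneg _ _).trans hT1
    obtain ⟨J, hJ, hJ1, hJc⟩ := hp.redCov hst hC hε0 hε (η := η / (2 * (C + 1))) (by positivity)
    let T2 : Finset (SLZ n) := (T ×ˢ J).image fun p => p.1 * p.2.2
    refine ⟨T ∪ T2, fun g hg => ?_, ?_, ?_⟩
    · rw [hcl]
      rcases Finset.mem_union.1 hg with h1 | h1
      · exact Subgroup.subset_closure (Or.inl (hT _ h1))
      · simp only [T2, Finset.mem_image, Finset.mem_product] at h1
        obtain ⟨q, hq, rfl⟩ := h1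
        exact mul_mem (Subgroup.subset_closure (Or.inl (hT _ hq.1))) (hJ _ hq.2).mem
    · have e1 : ∑ h ∈ T, lip F' h ≤ C := (Finset.sum_le_sum fun h _ =>
        lip_le ((lipOn_lip F h).mono hp.F'_sub le_rfl)).trans hT1
      have e2 : ∑ h ∈ T2, lip F' h ≤ C := by
        calc ∑ h ∈ T2, lip F' h ≤ ∑ p ∈ T ×ˢ J, lip F' (p.1 * p.2.2) :=
              Finset.sum_image_le_of_nonneg (fun _ _ => lip_nonneg _ _)
          _ ≤ ∑ p ∈ T ×ˢ J, lip F p.1 * lip F' p.2.2 := by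
              refine Finset.sum_le_sum fun p hp' => lip_le ?_
              exact (lipOn_lip F _).mul (lipOn_lip F' _) fun u hu =>
                hp.P_sub _ (hp.red_mem hst (hJ _ (Finset.mem_product.1 hp').2) hu)
          _ = (∑ f ∈ T, lip F f) * ∑ p ∈ J, lip F' p.2 := by
              rw [Finset.sum_product, Finset.sum_mul_sum]
          _ ≤ C * 1 := by
              have : 0 ≤ ∑ p ∈ J, lip F' p.2 := Finset.sum_nonneg fun _ _ => lip_nonneg _ _
              gcongr
          _ = C := mul_one C
      have h1 := Finset.sum_union_inter (s₁ := T) (s₂ := T2) (f := lip F')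
      have h2 : 0 ≤ ∑ p ∈ T ∩ T2, lip F' p := Finset.sum_nonneg fun _ _ => lip_nonneg _ _
      linarith
    · have c2 : Cov (⋃ f ∈ T, av f '' (redSweep S flip2 c J F' ∩ F))
          (∑ f ∈ T, lip F f * (η / (2 * (C + 1)))) :=
        cov_biUnion _ _ _ fun f _ => hJc.image (lipOn_lip F f)
      refine Cov.mono _ _ _ _ (hTc.union _ _ _ _ c2) ?_ ?_
      · rintro _ ⟨g, hg, hgT, u, hu, rfl⟩
        rw [Finset.notMem_union] at hgT
        rcases dec hg with h1 | ⟨h, hh, y, v, hv, rfl⟩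
        · exact Or.inl ⟨g, h1, hgT.1, u, hp.F'_sub hu, rfl⟩
        · have hu' := hp.red_mem hst hv hu
          rw [av_mul]
          by_cases hhT : h ∈ T
          · right
            simp only [Set.mem_iUnion]
            refine ⟨h, hhT, av v u, ⟨⟨y, v, hv, fun hvJ => hgT.2 ?_, u, hu, rfl⟩,
              hp.P_sub _ hu'⟩, rfl⟩
            simp only [T2, Finset.mem_image, Finset.mem_product]
            exact ⟨(h, (y, v)), ⟨hhT, hvJ⟩, rfl⟩
          · exact Or.inl ⟨h, hh, hhT, _, hp.P_sub _ hu', rfl⟩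
      · rw [← Finset.sum_mul]
        have : (∑ f ∈ T, lip F f) * (η / (2 * (C + 1))) ≤ η / 2 := by
          rw [mul_div_assoc', div_le_div_iff₀ (by positivity) (by positivity)]
          nlinarith
        linarith
  · intro W hW g hg w hw h1
    rcases dec (inv_mem hg) with h2 | ⟨h, hh, y, v, hv, he⟩
    · exact hst.miss W hW g (by simpa using h2) w hw (hp.F'_sub h1)
    · have h3 := hp.red_mem hst hv h1
      refine hst.miss W hW h⁻¹ (inv_mem hh) w hw (hp.P_sub y ?_)
      have h4 : v = h⁻¹ * g⁻¹ := by rw [he]; group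
      have h5 : h⁻¹ = v * g := by rw [h4]; group
      rwa [h5, av_mul]
  · intro W hW g hg h1
    rcases dec hg with h2 | ⟨h, hh, y, v, hv, rfl⟩
    · exact hst.sep W hW g h2 h1
    · obtain ⟨w, hw, hwP⟩ := hp.hyp y (W.map (av v)) (by
        rw [← (Submodule.equivMapOfInjective _ (av_injective v) W).finrank_eq]
        exact hB W (Or.inr hW)) (by
        rintro _ ⟨w, hw, rfl⟩ hw0
        exact hp.red_hyp hst hv hW hw (by rintro rfl; simp at hw0))
      obtain ⟨w, hw, rfl⟩ := hw
      refine hst.miss _ (Or.inl h1) h⁻¹ (inv_mem hh) (av (h * v) w) ⟨w, hw, rfl⟩ ?_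
      rw [av_mul, av_inv_av]
      exact hp.P_sub y hwP

end Extend

section Poly

variable {n : ℕ}

/-- Polynomial functions on `ℝⁿ`. -/
def IsPolyFun (f : (Fin n → ℝ) → ℝ) : Prop :=
  ∃ P : MvPolynomial (Fin n) ℝ, ∀ x, f x = MvPolynomial.eval x P

lemma isPolyFun_const (a : ℝ) : IsPolyFun fun _ : Fin n → ℝ => a :=
  ⟨MvPolynomial.C a, fun x => by simp⟩

lemma isPolyFun_coord (i : Fin n) : IsPolyFun fun x : Fin n → ℝ => x i :=
  ⟨MvPolynomial.X i, fun x => by simp⟩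

lemma IsPolyFun.mul {f g : (Fin n → ℝ) → ℝ} (hf : IsPolyFun f) (hg : IsPolyFun g) :
    IsPolyFun fun x => f x * g x := by
  obtain ⟨P, hP⟩ := hf
  obtain ⟨Q, hQ⟩ := hg
  exact ⟨P * Q, fun x => by simp [hP, hQ]⟩

lemma IsPolyFun.sub {f g : (Fin n → ℝ) → ℝ} (hf : IsPolyFun f) (hg : IsPolyFun g) :
    IsPolyFun fun x => f x - g x := by
  obtain ⟨P, hP⟩ := hf
  obtain ⟨Q, hQ⟩ := hg
  exact ⟨P - Q, fun x => by simp [hP, hQ]⟩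

lemma isPolyFun_sum {ι : Type*} (s : Finset ι) {f : ι → (Fin n → ℝ) → ℝ}
    (hf : ∀ i, IsPolyFun (f i)) :
    IsPolyFun fun x => ∑ i ∈ s, f i x := by
  choose P hP using hf
  exact ⟨∑ i ∈ s, P i, fun x => by simp [hP]⟩

lemma isPolyFun_dot (f : Fin n → ℝ) : IsPolyFun fun x => f ⬝ᵥ x :=
  isPolyFun_sum _ fun i => (isPolyFun_const (f i)).mul (isPolyFun_coord i)

lemma IsPolyFun.continuous {f : (Fin n → ℝ) → ℝ} (hf : IsPolyFun f) : Continuous f := by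
  obtain ⟨P, hP⟩ := hf
  rw [show f = fun x => MvPolynomial.eval x P from funext hP]
  exact MvPolynomial.continuous_eval P

lemma IsPolyFun.dense {f : (Fin n → ℝ) → ℝ} (hf : IsPolyFun f) {x₀ : Fin n → ℝ} (h₀ : f x₀ ≠ 0) :
    Dense {x | f x ≠ 0} := by
  obtain ⟨P, hP⟩ := hf
  rw [dense_iff_inter_open]
  rintro O hO ⟨y, hy⟩
  by_contra hne
  rw [Set.not_nonempty_iff_eq_empty, Set.eq_empty_iff_forall_notMem] at hne
  obtain ⟨r, hr, hrO⟩ := Metric.isOpen_iff.1 hO y hy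
  have hP0 : P = 0 := by
    refine MvPolynomial.funext_set (fun i => Metric.ball (y i) r) (fun i => ?_) fun x hx => ?_
    · rw [Real.ball_eq_Ioo]; exact Set.Ioo_infinite (by linarith)
    · have : x ∈ O := hrO (by
        rw [ball_pi _ hr]; exact hx)
      by_contra h
      exact hne x ⟨this, by
        show f x ≠ 0
        rw [hP]; simpa using h⟩
  rw [hP, hP0] at h₀
  simp at h₀

lemma dense_iInter_finset {α : Type*} [TopologicalSpace α] [BaireSpace α] {ι : Type*} (J : Finset ι)
    {f : ι → Set α} (ho : ∀ i ∈ J, IsOpen (f i)) (hd : ∀ i ∈ J, Dense (f i)) :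
    Dense (⋂ i ∈ J, f i) :=
  dense_biInter_of_isOpen (S := (J : Set ι)) ho J.countable_toSet hd

/-- Finitely many polynomials that are not identically zero have a common nonzero in every
nonempty open set. -/
lemma exists_poly_ne_zero {ι : Type*} (J : Finset ι) {f : ι → (Fin n → ℝ) → ℝ}
    (hf : ∀ i ∈ J, IsPolyFun (f i)) (h₀ : ∀ i ∈ J, ∃ x, f i x ≠ 0) {O : Set (Fin n → ℝ)}
    (hO : IsOpen O) (hne : O.Nonempty) : ∃ x ∈ O, ∀ i ∈ J, f i x ≠ 0 := by
  have hd : Dense (⋂ i ∈ J, {x | f i x ≠ 0}) :=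
    dense_iInter_finset J (fun i hi => isOpen_ne_fun (hf i hi).continuous continuous_const)
      fun i hi => by
        obtain ⟨x, hx⟩ := h₀ i hi
        exact (hf i hi).dense hx
  obtain ⟨x, hx, hx'⟩ := hd.inter_open_nonempty O hO hne
  exact ⟨x, hx, fun i hi => by simpa using Set.mem_iInter₂.1 hx' i hi⟩

end Poly

section Player

variable {n : ℕ} {B₁ B₂ : Set (Submodule ℝ (Fin n → ℝ))} {S : Set (SLZ n)}
  {F : Set (Fin n → ℝ)} {I : Type}

lemma exists_form {W : Submodule ℝ (Fin n → ℝ)} (hn : 1 ≤ n) (hW : Module.finrank ℝ W = n - 1) :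
    ∃ f : Fin n → ℝ, f ≠ 0 ∧ ∀ w, w ∈ W ↔ f ⬝ᵥ w = 0 := by
  have hlt : W < ⊤ := by
    apply Submodule.lt_top_of_finrank_lt_finrank
    rw [hW, Module.finrank_fin_fun]; omega
  obtain ⟨L, hL0, hL⟩ := Submodule.exists_le_ker_of_lt_top W hlt
  have hk : W = LinearMap.ker L := by
    refine Submodule.eq_of_le_of_finrank_eq hL ?_
    have h1 := LinearMap.finrank_range_add_finrank_ker L
    have h2 : LinearMap.range L = ⊤ := LinearMap.range_eq_top.2 (LinearMap.surjective hL0)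
    rw [h2, finrank_top, Module.finrank_self, Module.finrank_fin_fun] at h1
    omega
  have hd (w : Fin n → ℝ) : (fun i => L (Pi.single i 1)) ⬝ᵥ w = L w := by
    rw [LinearMap.pi_apply_eq_sum_univ L w, dotProduct]
    refine Finset.sum_congr rfl fun i _ => ?_
    rw [smul_eq_mul, mul_comm]
    congr 2
    ext j; simp [Pi.single_apply, eq_comm]
  refine ⟨fun i => L (Pi.single i 1), fun h => hL0 ?_, fun w => ?_⟩
  · ext w; simpa using congrFun h w
  · rw [hd, hk, LinearMap.mem_ker]

/-- A hyperplane very close to `ker φ ∋ p` meets every given neighbourhood of `p`. -/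
lemma hyperplane_meets (hn : 1 ≤ n) {φ p e : Fin n → ℝ} (hφp : φ ⬝ᵥ p = 0) (hφe : φ ⬝ᵥ e ≠ 0)
    (hp : p ≠ 0) {κ η : ℝ} (hη : 0 < η) (hκ : κ * wd e p < η * |φ ⬝ᵥ e|)
    {W : Submodule ℝ (Fin n → ℝ)} (hW : Module.finrank ℝ W = n - 1)
    (h : ∀ w ∈ W, w ≠ 0 → |φ ⬝ᵥ w| < κ * ‖w‖) : ∃ w ∈ W, w ∈ U p η := by
  obtain ⟨f, -, hf⟩ := exists_form hn hW
  by_cases hfp : f ⬝ᵥ p = 0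
  · exact ⟨p, (hf p).2 hfp, self_mem_U hp hη⟩
  set w : Fin n → ℝ := (f ⬝ᵥ e) • p - (f ⬝ᵥ p) • e with hw
  have hφw : φ ⬝ᵥ w = - ((f ⬝ᵥ p) * (φ ⬝ᵥ e)) := by
    rw [hw, dotProduct_sub, dotProduct_smul, dotProduct_smul, hφp]; simp
  have hw0 : w ≠ 0 := by
    intro h0
    rw [h0, dotProduct_zero] at hφw
    have : (f ⬝ᵥ p) * (φ ⬝ᵥ e) = 0 := by linarith
    exact (mul_ne_zero hfp hφe) this
  have hwW : w ∈ W := (hf w).2 (by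
    rw [hw, dotProduct_sub, dotProduct_smul, dotProduct_smul]; simp [mul_comm])
  refine ⟨w, hwW, ?_⟩
  have h1 := h w hwW hw0
  rw [hφw, abs_neg, abs_mul] at h1
  have h2 : wd w p = |f ⬝ᵥ p| * wd e p := by
    have : w = (-(f ⬝ᵥ p)) • e - (-(f ⬝ᵥ e)) • p := by rw [hw]; module
    rw [this, wd_sub_smul, wd_smul_left, abs_neg]
  show wd w p < η * ‖w‖
  have h3 := abs_pos.2 hφe
  have h4 := norm_pos_iff.2 hw0
  have h5 := wd_nonneg e p
  rw [h2]
  refine lt_of_mul_lt_mul_right ?_ h3.le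
  calc |f ⬝ᵥ p| * wd e p * |φ ⬝ᵥ e| = (|f ⬝ᵥ p| * |φ ⬝ᵥ e|) * wd e p := by ring
    _ ≤ κ * ‖w‖ * wd e p := by gcongr
    _ = (κ * wd e p) * ‖w‖ := by ring
    _ < (η * |φ ⬝ᵥ e|) * ‖w‖ := by gcongr
    _ = _ := by ring

lemma flip2_flip2 (x : I × Bool) : flip2 (flip2 x) = x := by simp [flip2]

lemma flip2_ne (x : I × Bool) : flip2 x ≠ x := by
  rcases x with ⟨i, _ | _⟩ <;> simp [flip2]

lemma tendsto_mul_right_zero (b : ℝ) : Tendsto (fun κ : ℝ => κ * b) (𝓝[>] 0) (𝓝 0) := by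
  have h : Tendsto (fun κ : ℝ => κ * b) (𝓝 0) (𝓝 (0 * b)) := tendsto_id.mul_const b
  rw [zero_mul] at h
  exact h.mono_left nhdsWithin_le_nhds

lemma eventually_gt_dot {φ p : Fin n → ℝ} (h : SLZ n) (hp : φ ⬝ᵥ av h p ≠ 0) :
    ∀ᶠ κ in 𝓝[>] (0 : ℝ), κ * ‖av h p‖ < |φ ⬝ᵥ av h p| := by
  exact (tendsto_mul_right_zero _).eventually (gt_mem_nhds (abs_pos.2 hp))

lemma continuous_dot (φ : Fin n → ℝ) : Continuous fun x : Fin n → ℝ => φ ⬝ᵥ x := by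
  unfold dotProduct; fun_prop

lemma isOpen_gt_dot (φ : Fin n → ℝ) (h : SLZ n) (κ : ℝ) :
    IsOpen {u | κ * ‖av h u‖ < |φ ⬝ᵥ av h u|} :=
  isOpen_lt (continuous_const.mul (continuous_av h).norm)
    ((continuous_dot φ).comp (continuous_av h)).abs

lemma eventually_U_gt_dot {φ p : Fin n → ℝ} (h : SLZ n) {κ : ℝ} (hp0 : p ≠ 0)
    (hp : κ * ‖av h p‖ < |φ ⬝ᵥ av h p|) :
    ∀ᶠ η in 𝓝[>] (0 : ℝ), ∀ u ∈ U p η, κ * ‖av h u‖ < |φ ⬝ᵥ av h u| := by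
  refine eventually_U_subset ((isOpen_gt_dot φ h κ).mem_nhds hp) hp0 ?_
  intro x hx c hc
  have := abs_pos.2 hc
  have hx' : κ * ‖av h x‖ < |φ ⬝ᵥ av h x| := hx
  show κ * ‖av h (c • x)‖ < |φ ⬝ᵥ av h (c • x)|
  rw [map_smul, norm_smul, dotProduct_smul, smul_eq_mul, abs_mul, Real.norm_eq_abs]
  nlinarith

lemma eventually_U_lt_dot {φ p : Fin n → ℝ} {κ : ℝ} (hκ : 0 < κ) (hp0 : p ≠ 0)
    (hp : φ ⬝ᵥ p = 0) :
    ∀ᶠ η in 𝓝[>] (0 : ℝ), ∀ u ∈ U p η, |φ ⬝ᵥ u| < κ * ‖u‖ := by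
  have ho : IsOpen {u : Fin n → ℝ | |φ ⬝ᵥ u| < κ * ‖u‖} :=
    isOpen_lt (continuous_dot φ).abs (continuous_const.mul continuous_norm)
  refine eventually_U_subset (ho.mem_nhds ?_) hp0 ?_
  · have := norm_pos_iff.2 hp0
    show |φ ⬝ᵥ p| < κ * ‖p‖
    rw [hp, abs_zero]; positivity
  intro x hx c hc
  have := abs_pos.2 hc
  have hx' : |φ ⬝ᵥ x| < κ * ‖x‖ := hx
  show |φ ⬝ᵥ (c • x)| < κ * ‖c • x‖
  rw [norm_smul, dotProduct_smul, smul_eq_mul, abs_mul, Real.norm_eq_abs]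
  nlinarith

/-- The form `φ` is uniformly bounded away from zero on almost all translates of `F`. -/
def Away (H : Subgroup (SLZ n)) (F : Set (Fin n → ℝ)) (φ : Fin n → ℝ) : Prop :=
  ∃ κ > 0, ∃ T : Finset (SLZ n), ∀ h ∈ H, h ∉ T → ∀ y ∈ F, κ * ‖av h y‖ ≤ |φ ⬝ᵥ av h y|

/-- A state can be extended by sufficiently contracting letters in general position. -/
theorem IsState.extend [Fintype I] (hn : 1 ≤ n)
    (hB : ∀ W ∈ B₁ ∪ B₂, Module.finrank ℝ W = n - 1)
    (hst : IsState B₁ B₂ S F) {A : ℕ → I × Bool → SLZ n}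
    (hinv : ∀ N x, A N (flip2 x) = (A N x)⁻¹) {p φ : I × Bool → Fin n → ℝ} (hpF : ∀ x, p x ∈ F)
    {a : I × Bool → ℕ → ℝ}
    (hlim : ∀ x, Tendsto (fun N => a x N • matR (A N x)) atTop (𝓝 (vecMulVec (p x) (φ x))))
    (hzero : ∀ x, φ (flip2 x) ⬝ᵥ p x = 0)
    (haway : ∀ x, Away (Subgroup.closure S) F (φ x))
    (hnv : ∀ x y, ∀ h ∈ Subgroup.closure S, (h = 1 → y ≠ flip2 x) → φ x ⬝ᵥ av h (p y) ≠ 0) :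
    ∀ᶠ N in atTop, ∃ F', IsState B₁ B₂ (S ∪ Set.range fun i => A N (i, true)) F' := by
  classical
  have hp0 (x) : p x ≠ 0 := hst.ne_zero _ (hpF x)
  have hφ0 (x) : φ x ≠ 0 := fun h => hnv x x 1 (one_mem _) (fun _ h' => flip2_ne x h'.symm) (by
    rw [h, zero_dotProduct])
  choose κ₀ hκ₀ T₀ hT₀ using haway
  obtain ⟨C, hC⟩ := hst.tail
  let T : Finset (SLZ n) := insert 1 (Finset.univ.biUnion T₀)
  have hT {x h} (hh : h ∉ T) : h ∉ T₀ x := fun h' => hh (by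
    simp only [T, Finset.mem_insert, Finset.mem_biUnion]; exact Or.inr ⟨x, Finset.mem_univ _, h'⟩)
  -- the auxiliary point
  obtain ⟨q, hqF, hq⟩ : ∃ q ∈ F, ∀ z ∈ (Finset.univ : Finset (I × Bool)) ×ˢ T,
      φ z.1 ⬝ᵥ av z.2 q ≠ 0 := by
    refine exists_poly_ne_zero _ (fun z _ => ?_) (fun z _ => ?_) hst.isOpen hst.nonempty
    · simp only [dot_av]; exact isPolyFun_dot _
    · refine ⟨av z.2⁻¹ (φ z.1), ?_⟩
      rw [av_av_inv]
      exact fun h => hφ0 _ (dotProduct_self_eq_zero.1 h)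
  have hq0 := hst.ne_zero _ hqF
  -- choice of the constants
  have eκ : ∀ᶠ κ in 𝓝[>] (0 : ℝ), 0 < κ ∧ (∀ x, κ < κ₀ x) ∧
      (∀ x y, ∀ h ∈ T, h ∈ Subgroup.closure S → (h = 1 → y ≠ flip2 x) →
        κ * ‖av h (p y)‖ < |φ x ⬝ᵥ av h (p y)|) ∧
      (∀ x, ∀ h ∈ T, κ * ‖av h q‖ < |φ x ⬝ᵥ av h q|) := by
    refine (eventually_mem_nhdsWithin).and (.and ?_ (.and ?_ ?_))
    · exact eventually_all.2 fun x => eventually_nhdsWithin_of_eventually_nhds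
        (gt_mem_nhds (hκ₀ x))
    · refine eventually_all.2 fun x => eventually_all.2 fun y =>
        (Finset.eventually_all T).2 fun h _ => ?_
      by_cases h1 : h ∈ Subgroup.closure S ∧ (h = 1 → y ≠ flip2 x)
      · filter_upwards [eventually_gt_dot h (hnv x y h h1.1 h1.2)] with κ hκ _ _ using hκ
      · exact Eventually.of_forall fun κ h2 h3 => absurd ⟨h2, h3⟩ h1
    · refine eventually_all.2 fun x => (Finset.eventually_all T).2 fun h hh => ?_
      exact eventually_gt_dot h (hq (x, h) (by simp [hh]))
  obtain ⟨κ₁, hκ₁, hκ₁0, hκ₁p, hκ₁q⟩ := eκ.exists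
  have eη : ∀ᶠ η in 𝓝[>] (0 : ℝ), 0 < η ∧ (∀ x, U (p x) η ⊆ F) ∧ U q η ⊆ F ∧
      (∀ x y, ∀ h ∈ T, h ∈ Subgroup.closure S → (h = 1 → y ≠ flip2 x) →
        ∀ u ∈ U (p y) η, κ₁ * ‖av h u‖ < |φ x ⬝ᵥ av h u|) ∧
      (∀ x, ∀ h ∈ T, ∀ u ∈ U q η, κ₁ * ‖av h u‖ < |φ x ⬝ᵥ av h u|) ∧
      (∀ x, ∀ u ∈ U (p x) η, |φ (flip2 x) ⬝ᵥ u| < κ₁ * ‖u‖) := by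
    refine (eventually_mem_nhdsWithin).and (.and ?_ (.and ?_ (.and ?_ (.and ?_ ?_))))
    · exact eventually_all.2 fun x => eventually_U_subset (hst.isOpen.mem_nhds (hpF x)) (hp0 x)
        hst.cone
    · exact eventually_U_subset (hst.isOpen.mem_nhds hqF) hq0 hst.cone
    · refine eventually_all.2 fun x => eventually_all.2 fun y =>
        (Finset.eventually_all T).2 fun h hh => ?_
      by_cases h1 : h ∈ Subgroup.closure S ∧ (h = 1 → y ≠ flip2 x)
      · filter_upwards [eventually_U_gt_dot h (hp0 y) (hκ₁p x y h hh h1.1 h1.2)] with η hη _ _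
          using hη
      · exact Eventually.of_forall fun κ h2 h3 => absurd ⟨h2, h3⟩ h1
    · exact eventually_all.2 fun x => (Finset.eventually_all T).2 fun h hh =>
        eventually_U_gt_dot h hq0 (hκ₁q x h hh)
    · exact eventually_all.2 fun x => eventually_U_lt_dot hκ₁ (hp0 x) (hzero x)
  obtain ⟨η, hη, hηp, hηq, hηpp, hηqq, hηz⟩ := eη.exists
  have eκ' : ∀ᶠ κ in 𝓝[>] (0 : ℝ), 0 < κ ∧ κ < κ₁ ∧
      ∀ x, κ * wd (p (flip2 x)) (p x) < η * |φ (flip2 x) ⬝ᵥ p (flip2 x)| := by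
    refine (eventually_mem_nhdsWithin).and (.and (eventually_nhdsWithin_of_eventually_nhds
        (gt_mem_nhds hκ₁)) (eventually_all.2 fun x => ?_))
    have h1 : φ (flip2 x) ⬝ᵥ p (flip2 x) ≠ 0 := by
      have := hnv (flip2 x) (flip2 x) 1 (one_mem _) fun _ h => flip2_ne (flip2 x) h.symm
      rwa [av_one] at this
    exact (tendsto_mul_right_zero _).eventually (gt_mem_nhds (mul_pos hη (abs_pos.2 h1)))
  obtain ⟨κ, hκ, hκκ₁, hκh⟩ := eκ'.exists
  set ε : ℝ := 1 / (2 * ((Fintype.card (I × Bool) : ℝ) + 1) * (|C| + 1)) with hεdef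
  have hε : 0 < ε := by positivity
  have hεC : Fintype.card (I × Bool) * (ε * C) ≤ 1 / 2 := by
    have h1 : (Fintype.card (I × Bool) : ℝ) * (ε * C) ≤
        ((Fintype.card (I × Bool) : ℝ) + 1) * (ε * (|C| + 1)) := by
      have := le_abs_self C
      have h2 : ε * C ≤ ε * (|C| + 1) := by gcongr; linarith
      refine (mul_le_mul_of_nonneg_left h2 (by positivity)).trans ?_
      gcongr; linarith
    refine h1.trans (le_of_eq ?_)
    rw [hεdef]; field_simp
  have eN := eventually_all.2 fun x => eventually_contract (hlim x) (hp0 x) hκ hη hε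
  filter_upwards [eN] with N hN
  refine ⟨U q η, IsPingPong.isState (c := A N) (P := fun x => U (p x) η)
    (Q := fun x => {y | κ * ‖y‖ ≤ |φ x ⬝ᵥ y|}) (ε := ε) hB hst ?_ hC hε.le hεC⟩
  refine ⟨flip2_flip2, hinv N, hηp, hηq, isOpen_U _ _, ⟨q, self_mem_U hq0 hη⟩, isCone_U _ _,
    fun x y h hh hr u hu => ?_, fun x h hh u hu => ?_, fun x u hu hu' => ?_, fun x u hu hu0 => ?_,
    fun x => (hN x).2, fun x W hW h => ?_⟩
  · show κ * _ ≤ _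
    by_cases hhT : h ∈ T
    · refine le_trans ?_ (hηpp x y h hhT hh hr u hu).le
      gcongr
    · refine le_trans ?_ (hT₀ x h hh (hT hhT) u (hηp y hu))
      have := hκ₁0 x
      gcongr; linarith
  · show κ * _ ≤ _
    by_cases hhT : h ∈ T
    · refine le_trans ?_ (hηqq x h hhT u hu).le
      gcongr
    · refine le_trans ?_ (hT₀ x h hh (hT hhT) u (hηq hu))
      have := hκ₁0 x
      gcongr; linarith
  · have h1 := hηz x u hu
    have h2 := hηqq (flip2 x) 1 (by simp [T]) u hu'
    rw [av_one] at h2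
    linarith
  · exact (hN x).1 u hu0 hu
  · refine hyperplane_meets hn (hzero x) ?_ (hp0 x) hη (hκh x) hW
      fun w hw hw0 => not_le.1 (h w hw hw0)
    have := hnv (flip2 x) (flip2 x) 1 (one_mem _) fun _ h => flip2_ne (flip2 x) h.symm
    rwa [av_one] at this

end Player

section Measure

open MeasureTheory

variable {n : ℕ} {B₁ B₂ : Set (Submodule ℝ (Fin n → ℝ))} {S : Set (SLZ n)}
  {F : Set (Fin n → ℝ)}

lemma volume_strip_le {x : Fin n → ℝ} (hx : x ≠ 0) {r : ℝ} (hr : 0 ≤ r) :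
    volume {φ : Fin n → ℝ | ‖φ‖ ≤ 1 ∧ |φ ⬝ᵥ x| ≤ r * ‖x‖} ≤ ENNReal.ofReal (2 ^ n * r) := by
  classical
  have : Nonempty (Fin n) := by
    by_contra h; rw [not_nonempty_iff] at h; exact hx (Subsingleton.elim _ _)
  obtain ⟨i, hi⟩ := Finite.exists_max fun i => |x i|
  have hnx : ‖x‖ = |x i| := le_antisymm ((pi_norm_le_iff_of_nonneg (abs_nonneg _)).2 hi)
    (norm_le_pi_norm x i)
  have hxi : x i ≠ 0 := by
    rw [← abs_pos, ← hnx]; exact norm_pos_iff.2 hx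
  set b : Fin n → ℝ := (x i)⁻¹ • x with hb
  set M : Matrix (Fin n) (Fin n) ℝ := ((1 : Matrix (Fin n) (Fin n) ℝ).updateCol i b)ᵀ with hM
  have hdet : LinearMap.det (Matrix.toLin' M) = 1 := by
    rw [LinearMap.det_toLin', hM, det_transpose, ← cramer_apply, cramer_one]
    simp [hb, hxi]
  have hMi (φ : Fin n → ℝ) : Matrix.toLin' M φ i = (φ ⬝ᵥ x) / x i := by
    rw [toLin'_apply, hM, mulVec_transpose, vecMul, dotProduct, dotProduct]
    simp only [updateCol_self, hb, Pi.smul_apply, smul_eq_mul]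
    rw [Finset.sum_div]
    exact Finset.sum_congr rfl fun j _ => by ring
  have hMj (φ : Fin n → ℝ) {j} (hj : j ≠ i) : Matrix.toLin' M φ j = φ j := by
    rw [toLin'_apply, hM, mulVec_transpose, vecMul, dotProduct]
    simp [hj, one_apply]
  have hsub : {φ : Fin n → ℝ | ‖φ‖ ≤ 1 ∧ |φ ⬝ᵥ x| ≤ r * ‖x‖} ⊆ Matrix.toLin' M ⁻¹'
      Set.Icc (fun j => if j = i then -r else -1) (fun j => if j = i then r else 1) := by
    rintro φ ⟨h1, h2⟩
    have h3 (j) : |Matrix.toLin' M φ j| ≤ if j = i then r else 1 := by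
      by_cases hj : j = i
      · subst hj
        rw [hMi, if_pos rfl, abs_div, div_le_iff₀ (abs_pos.2 hxi), ← hnx]
        exact h2
      · rw [hMj φ hj, if_neg hj]
        exact (norm_le_pi_norm φ j).trans h1
    constructor
    · intro j
      have := (abs_le.1 (h3 j)).1
      show (if j = i then -r else -1) ≤ _
      split_ifs at this ⊢ <;> exact this
    · intro j
      exact (abs_le.1 (h3 j)).2
  refine (measure_mono hsub).trans ?_
  rw [Measure.addHaar_preimage_linearMap _ (by rw [hdet]; norm_num), hdet, Real.volume_Icc_pi]
  simp only [inv_one, abs_one, ENNReal.ofReal_one, one_mul]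
  rw [← ENNReal.ofReal_prod_of_nonneg]
  · refine ENNReal.ofReal_le_ofReal (le_of_eq ?_)
    have h4 (j) : ((if j = i then r else (1 : ℝ)) - if j = i then -r else -1) =
        2 * if j = i then r else 1 := by
      split_ifs <;> ring
    simp only [h4, Finset.prod_mul_distrib]
    simp
  · intro j _
    split_ifs <;> linarith

/-- The bounded forms which are `κ`-small on some vector of `S`. -/
def smallForms (S : Set (Fin n → ℝ)) (κ : ℝ) : Set (Fin n → ℝ) :=
  {φ | ‖φ‖ ≤ 1 ∧ ∃ x ∈ S, |φ ⬝ᵥ x| < κ * ‖x‖}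

lemma abs_dot_le_of_norm_le {φ : Fin n → ℝ} {r : ℝ} (h : ‖φ‖ ≤ r) (y : Fin n → ℝ) :
    |φ ⬝ᵥ y| ≤ n * r * ‖y‖ := by
  refine (abs_dot_le φ y).trans ?_
  gcongr
  calc ∑ i, |φ i| ≤ ∑ _i : Fin n, r := Finset.sum_le_sum fun i _ => (norm_le_pi_norm φ i).trans h
    _ = n * r := by simp

lemma Cov.volume_smallForms_le {S : Set (Fin n → ℝ)} {a : ℝ} (h : Cov S a) :
    0 ≤ a ∧ ∃ K ≥ 0, ∀ κ ≥ 0,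
      volume (smallForms S κ) ≤ ENNReal.ofReal (2 ^ n * (n * a + K * κ)) := by
  induction h with
  | single S a ha h =>
    refine ⟨ha, 1 + a, by linarith, fun κ hκ => ?_⟩
    by_cases h0 : ∃ x ∈ S, x ≠ 0
    · obtain ⟨x₀, hx₀, hx₀0⟩ := h0
      refine le_trans (measure_mono ?_) (volume_strip_le hx₀0 (by positivity))
      rintro φ ⟨hφ, x, hx, hs⟩
      refine ⟨hφ, ?_⟩
      have hx0 : x ≠ 0 := by
        rintro rfl
        simp at hs
      have hpx := norm_pos_iff.2 hx0
      have hpx₀ := norm_pos_iff.2 hx₀0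
      obtain ⟨c, hc⟩ := exists_smul_close hx0 x₀
      have h1 : wd x x₀ ≤ a * (‖x‖ * ‖x₀‖) := by
        have := h x hx x₀ hx₀
        rwa [dl, div_le_iff₀ (by positivity)] at this
      have h2 : ‖c • x - x₀‖ ≤ a * ‖x₀‖ := by
        refine le_of_mul_le_mul_right ?_ hpx
        linarith
      have h3 : |φ ⬝ᵥ (c • x)| ≤ κ * ‖c • x‖ := by
        rw [dotProduct_smul, smul_eq_mul, abs_mul, norm_smul, Real.norm_eq_abs]
        nlinarith [abs_nonneg c]
      have h4 : ‖c • x‖ ≤ (1 + a) * ‖x₀‖ := by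
        have : ‖c • x‖ ≤ ‖c • x - x₀‖ + ‖x₀‖ := by simpa using norm_add_le (c • x - x₀) x₀
        linarith
      have h5 := abs_dot_le_of_norm_le hφ (c • x - x₀)
      have h6 : φ ⬝ᵥ x₀ = φ ⬝ᵥ (c • x) - φ ⬝ᵥ (c • x - x₀) := by
        rw [dotProduct_sub]; ring
      rw [h6]
      calc _ ≤ |φ ⬝ᵥ (c • x)| + |φ ⬝ᵥ (c • x - x₀)| := abs_sub _ _
        _ ≤ κ * ((1 + a) * ‖x₀‖) + n * 1 * (a * ‖x₀‖) := by
          refine add_le_add (h3.trans (by gcongr)) (h5.trans (by gcongr))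
        _ = _ := by ring
    · push Not at h0
      have : smallForms S κ = ∅ := by
        refine Set.eq_empty_of_forall_notMem ?_
        rintro φ ⟨_, x, hx, hs⟩
        rw [h0 x hx] at hs
        simp at hs
      rw [this]; simp
  | union S T a b _ _ h1 h2 =>
    obtain ⟨ha, K, hK, h1⟩ := h1
    obtain ⟨hb, L, hL, h2⟩ := h2
    refine ⟨by linarith, K + L, by linarith, fun κ hκ => ?_⟩
    have : smallForms (S ∪ T) κ ⊆ smallForms S κ ∪ smallForms T κ := by
      rintro φ ⟨hφ, x, hx | hx, hs⟩
      · exact Or.inl ⟨hφ, x, hx, hs⟩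
      · exact Or.inr ⟨hφ, x, hx, hs⟩
    refine (measure_mono this).trans ((measure_union_le _ _).trans
      ((add_le_add (h1 κ hκ) (h2 κ hκ)).trans (le_of_eq ?_)))
    rw [← ENNReal.ofReal_add (by positivity) (by positivity)]
    congr 1; ring
  | mono S T a b _ hTS hab h1 =>
    obtain ⟨ha, K, hK, h1⟩ := h1
    refine ⟨by linarith, K, hK, fun κ hκ => ?_⟩
    refine (measure_mono ?_).trans ((h1 κ hκ).trans (ENNReal.ofReal_le_ofReal (by gcongr)))
    rintro φ ⟨hφ, x, hx, hs⟩
    exact ⟨hφ, x, hTS hx, hs⟩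

/-- Quantitative non-vanishing of `φ` on the translates of `F` by the elements of `H ∖ Φ`. -/
def AwayOff (H : Subgroup (SLZ n)) (Φ : Finset (SLZ n)) (F : Set (Fin n → ℝ)) (φ : Fin n → ℝ) :
    Prop :=
  ∃ κ > 0, ∀ h ∈ H, h ∉ Φ → ∀ y ∈ F, κ * ‖av h y‖ ≤ |φ ⬝ᵥ av h y|

lemma AwayOff.away {H : Subgroup (SLZ n)} {Φ : Finset (SLZ n)} {φ : Fin n → ℝ}
    (h : AwayOff H Φ F φ) : Away H F φ := by
  obtain ⟨κ, hκ, h⟩ := h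
  exact ⟨κ, hκ, Φ, h⟩

lemma exists_norm_av_ge (τ : SLZ n) : ∃ c > 0, ∀ x, c * ‖x‖ ≤ ‖av τ x‖ := by
  set b : ℝ := (∑ i, ∑ j, |matR τ⁻¹ i j|) + 1 with hb
  have hb0 : 0 < b := by positivity
  refine ⟨b⁻¹, by positivity, fun x => ?_⟩
  have h := norm_mulVec_le (matR τ⁻¹) (av τ x)
  rw [← av_apply, av_inv_av] at h
  rw [inv_mul_le_iff₀ hb0, hb]
  nlinarith [norm_nonneg (av τ x)]

/-- Arbitrarily close to any form there is an open set of forms uniformly bounded away from zero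
on almost all translates of `F`. -/
theorem IsState.exists_away (hst : IsState B₁ B₂ S F) (T : Finset (SLZ n))
    {O : Set (Fin n → ℝ)} (hO : IsOpen O) (hne : O.Nonempty) :
    ∃ φ₁ ∈ O, ∃ δ > 0, ∃ Φ : Finset (SLZ n), ∀ φ, ‖φ - φ₁‖ < δ → ∀ τ ∈ T,
      AwayOff (Subgroup.closure S) Φ F (φ ᵥ* matR τ) := by
  obtain ⟨φ₀, hφ₀⟩ := hne
  set R : ℝ := ‖φ₀‖ + 1 with hR
  have hR0 : 0 < R := by positivity
  set O' : Set (Fin n → ℝ) := {φ | ‖φ‖ < 1 ∧ R • φ ∈ O} with hO'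
  have hO'o : IsOpen O' :=
    (isOpen_lt continuous_norm continuous_const).inter (hO.preimage (continuous_const_smul R))
  have hO'n : O'.Nonempty := by
    refine ⟨R⁻¹ • φ₀, ?_, ?_⟩
    · rw [norm_smul, Real.norm_eq_abs, abs_of_pos (by positivity), inv_mul_lt_iff₀ hR0]
      linarith
    · rwa [smul_smul, mul_inv_cancel₀ hR0.ne', one_smul]
  have hv : 0 < volume O' := hO'o.measure_pos volume hO'n
  obtain ⟨m, hm, hmv⟩ : ∃ m : ℝ, 0 < m ∧ ENNReal.ofReal m < volume O' := by
    obtain ⟨q, hq, hq'⟩ := ENNReal.lt_iff_exists_real_btwn.1 hv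
    exact ⟨q, ENNReal.ofReal_pos.1 hq'.1, hq'.2⟩
  choose s hs using fun τ : SLZ n => exists_lipOn τ
  obtain ⟨C, hC⟩ := hst.tail
  have hs0 : 0 ≤ ∑ τ ∈ T, s τ := Finset.sum_nonneg fun τ _ => (hs τ).1
  set A : ℝ := 2 ^ n * n * (∑ τ ∈ T, s τ) + 1 with hA
  have hA0 : 0 < A := by positivity
  obtain ⟨Φ, -, -, hcov⟩ := hC (m / 2 / A) (by positivity)
  have hcov' := cov_biUnion T (fun τ => av τ '' (sweep (Subgroup.closure S) Φ F ∩ Set.univ)) _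
    fun τ _ => hcov.image (hs τ)
  obtain ⟨-, K, hK, hvol⟩ := hcov'.volume_smallForms_le
  rw [← Finset.sum_mul] at hvol
  set κ : ℝ := m / 2 / (2 ^ n * K + 1) with hκ
  have hκ0 : 0 < κ := by positivity
  have hlt : volume (smallForms (⋃ τ ∈ T, av τ '' (sweep (Subgroup.closure S) Φ F ∩ Set.univ)) κ)
      < volume O' := by
    refine (hvol κ hκ0.le).trans_lt (lt_of_le_of_lt (ENNReal.ofReal_le_ofReal ?_) hmv)
    have h1 : (2 : ℝ) ^ n * n * (∑ τ ∈ T, s τ) * (m / 2 / A) ≤ m / 2 := by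
      rw [mul_div_assoc', div_le_iff₀ hA0, hA]; nlinarith
    have h2 : 2 ^ n * K * κ ≤ m / 2 := by
      rw [hκ, mul_div_assoc', div_le_iff₀ (by positivity)]; nlinarith
    nlinarith
  obtain ⟨φ₂, hφ₂, hφ₂'⟩ : ∃ φ₂ ∈ O', φ₂ ∉ smallForms
      (⋃ τ ∈ T, av τ '' (sweep (Subgroup.closure S) Φ F ∩ Set.univ)) κ := by
    by_contra! h
    exact absurd (measure_mono h) (not_le.2 hlt)
  have hbig : ∀ τ ∈ T, ∀ h ∈ Subgroup.closure S, h ∉ Φ → ∀ y ∈ F,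
      κ * ‖av τ (av h y)‖ ≤ |φ₂ ⬝ᵥ av τ (av h y)| := by
    intro τ hτ h hh hhΦ y hy
    by_contra! hlt
    refine hφ₂' ⟨hφ₂.1.le, av τ (av h y), ?_, hlt⟩
    exact Set.mem_biUnion hτ ⟨_, ⟨⟨h, hh, hhΦ, y, hy, rfl⟩, trivial⟩, rfl⟩
  refine ⟨R • φ₂, hφ₂.2, R * κ / (2 * (n + 1)), by positivity, Φ, fun φ hφ τ hτ => ?_⟩
  obtain ⟨c, hc, hcτ⟩ := exists_norm_av_ge τ
  refine ⟨R * κ / 2 * c, by positivity, fun h hh hhΦ y hy => ?_⟩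
  rw [← dot_av]
  set x := av τ (av h y) with hx
  have h1 := hbig τ hτ h hh hhΦ y hy
  have h2 := abs_dot_le_of_norm_le hφ.le x
  have h3 : |R * (φ₂ ⬝ᵥ x)| ≤ |φ ⬝ᵥ x| + |(φ - R • φ₂) ⬝ᵥ x| := by
    rw [sub_dotProduct, smul_dotProduct, smul_eq_mul]
    have := abs_sub (φ ⬝ᵥ x) (φ ⬝ᵥ x - R * (φ₂ ⬝ᵥ x))
    rwa [sub_sub_cancel] at this
  rw [abs_mul, abs_of_pos hR0] at h3
  have h4 : n * (R * κ / (2 * (n + 1))) * ‖x‖ ≤ R * κ / 2 * ‖x‖ := by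
    gcongr
    rw [mul_div_assoc', div_le_div_iff₀ (by positivity) (by positivity)]
    have : 0 < R * κ := by positivity
    nlinarith
  have h5 := hcτ (av h y)
  calc R * κ / 2 * c * ‖av h y‖ = R * κ / 2 * (c * ‖av h y‖) := by ring
    _ ≤ R * κ / 2 * ‖x‖ := by gcongr
    _ = R * (κ * ‖x‖) - R * κ / 2 * ‖x‖ := by ring
    _ ≤ R * |φ₂ ⬝ᵥ x| - R * κ / 2 * ‖x‖ := by gcongr
    _ ≤ _ := by linarith

end Measure

section Rational

variable {n : ℕ}

/-- Vectors with rational coordinates. -/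
def IsRat (x : Fin n → ℝ) : Prop := ∀ i, x i ∈ (Rat.castHom ℝ).fieldRange

lemma IsRat.sub {x y : Fin n → ℝ} (hx : IsRat x) (hy : IsRat y) : IsRat (x - y) :=
  fun i => sub_mem (hx i) (hy i)

lemma IsRat.smul {x : Fin n → ℝ} (hx : IsRat x) {c : ℝ} (hc : c ∈ (Rat.castHom ℝ).fieldRange) :
    IsRat (c • x) := fun i => mul_mem hc (hx i)

lemma IsRat.dot {x y : Fin n → ℝ} (hx : IsRat x) (hy : IsRat y) :
    x ⬝ᵥ y ∈ (Rat.castHom ℝ).fieldRange := sum_mem fun i _ => mul_mem (hx i) (hy i)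

lemma IsRat.av {x : Fin n → ℝ} (hx : IsRat x) (g : SLZ n) : IsRat (av g x) := fun i =>
  IsRat.dot (fun j => by rw [matR_apply]; exact intCast_mem _ _) hx

lemma isRat_zero : IsRat (0 : Fin n → ℝ) := fun _ => zero_mem _

lemma exists_isRat_mem {O : Set (Fin n → ℝ)} (hO : IsOpen O) (hne : O.Nonempty) :
    ∃ x ∈ O, IsRat x := by
  obtain ⟨y, hy⟩ := hne
  obtain ⟨r, hr, hrO⟩ := Metric.isOpen_iff.1 hO y hy
  choose q hq1 hq2 using fun i => exists_rat_btwn (show y i < y i + r by linarith)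
  refine ⟨fun i => (q i : ℝ), hrO ?_, fun i => ⟨q i, rfl⟩⟩
  rw [ball_pi _ hr]
  intro i _
  show (q i : ℝ) ∈ Metric.ball (y i) r
  rw [Real.ball_eq_Ioo]
  exact ⟨by linarith [hq1 i], hq2 i⟩

lemma IsRat.exists_int {x : Fin n → ℝ} (hx : IsRat x) :
    ∃ m : ℕ, 0 < m ∧ ∃ u : Fin n → ℤ, ∀ i, (m : ℝ) * x i = u i := by
  choose q hq using hx
  refine ⟨∏ i, (q i).den, Finset.prod_pos fun i _ => (q i).den_pos, ?_⟩
  choose c hc using fun i => Finset.dvd_prod_of_mem (fun i => (q i).den) (Finset.mem_univ i)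
  refine ⟨fun i => c i * (q i).num, fun i => ?_⟩
  have h1 : ((q i).den : ℝ) * q i = (q i).num := by exact_mod_cast Rat.den_mul_eq_num (q i)
  rw [hc i, ← hq i]
  push_cast
  rw [← h1]
  show _ * (q i : ℝ) = _
  ring

lemma matR_injective : Function.Injective (matR : SLZ n → Matrix (Fin n) (Fin n) ℝ) := by
  intro g h hgh
  ext i j
  have := congrFun (congrFun hgh i) j
  rw [matR_apply, matR_apply] at this
  exact_mod_cast this

/-- Rational rank-one nilpotents give one-parameter families of integral transvections. -/
lemma exists_trans {p φ : Fin n → ℝ} (hp : IsRat p) (hφ : IsRat φ) (h0 : φ ⬝ᵥ p = 0) :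
    ∃ D : ℝ, 0 < D ∧ ∃ A : ℤ → SLZ n, ∀ k, matR (A k) = 1 + ((k : ℝ) * D) • vecMulVec p φ := by
  obtain ⟨m, hm, u, hu⟩ := hp.exists_int
  obtain ⟨l, hl, f, hf⟩ := hφ.exists_int
  have hfu : f ⬝ᵥ u = 0 := by
    have : ((f ⬝ᵥ u : ℤ) : ℝ) = l * m * (φ ⬝ᵥ p) := by
      simp only [dotProduct, Int.cast_sum, Int.cast_mul, ← hu, ← hf, Finset.mul_sum]
      exact Finset.sum_congr rfl fun i _ => by ring
    rw [h0, mul_zero] at this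
    exact_mod_cast this
  have hdet (k : ℤ) : (1 + vecMulVec (k • u) f : Matrix (Fin n) (Fin n) ℤ).det = 1 := by
    rw [vecMulVec_eq (ι := Unit), det_one_add_replicateCol_mul_replicateRow, dotProduct_smul, hfu]
    simp
  let A : ℤ → SLZ n := fun k => ⟨1 + vecMulVec (k • u) f, hdet k⟩
  have hA (k : ℤ) (i j : Fin n) : A k i j = (1 : Matrix (Fin n) (Fin n) ℤ) i j + k * u i * f j :=
    rfl
  refine ⟨m * l, by positivity, A, fun k => ?_⟩
  ext i j
  rw [matR_apply, hA]
  simp only [Matrix.add_apply, Matrix.smul_apply, vecMulVec_apply, Int.cast_add, smul_eq_mul,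
    Int.cast_mul, ← hu, ← hf, one_apply]
  push_cast
  ring

lemma trans_inv {p φ : Fin n → ℝ} (h0 : φ ⬝ᵥ p = 0) {D : ℝ} {A : ℤ → SLZ n}
    (hA : ∀ k : ℤ, matR (A k) = 1 + ((k : ℝ) * D) • vecMulVec p φ) (k : ℤ) :
    (A k)⁻¹ = A (-k) := by
  rw [inv_eq_iff_mul_eq_one]
  apply matR_injective
  rw [matR_mul, hA, hA, matR_one]
  simp only [add_mul, mul_add, smul_mul_assoc, mul_smul_comm, vecMulVec_mul_vecMulVec, h0]
  push_cast
  simp only [zero_smul, vecMulVec_zero, one_mul, mul_one, smul_zero]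
  module

end Rational

section Projections

variable {n : ℕ}

/-- Orthogonal projection along `u`. -/
noncomputable def prj (u θ : Fin n → ℝ) : Fin n → ℝ := θ - ((θ ⬝ᵥ u) / (u ⬝ᵥ u)) • u

lemma prj_dot (u θ : Fin n → ℝ) : prj u θ ⬝ᵥ u = 0 := by
  by_cases hu : u ⬝ᵥ u = 0
  · rw [dotProduct_self_eq_zero.1 hu, dotProduct_zero]
  · rw [prj, sub_dotProduct, smul_dotProduct, smul_eq_mul, div_mul_cancel₀ _ hu, sub_self]

lemma prj_eq_self {u θ : Fin n → ℝ} (h : θ ⬝ᵥ u = 0) : prj u θ = θ := by simp [prj, h]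

lemma IsRat.prj {u θ : Fin n → ℝ} (hu : IsRat u) (hθ : IsRat θ) : IsRat (prj u θ) :=
  hθ.sub (hu.smul (div_mem (hθ.dot hu) (hu.dot hu)))

lemma dot_prj_of_dot_eq_zero {f u θ : Fin n → ℝ} (h : f ⬝ᵥ u = 0) : f ⬝ᵥ prj u θ = f ⬝ᵥ θ := by
  simp [_root_.prj, dotProduct_sub, h]

/-- Orthogonal projection along the span of `u` and `v`. -/
noncomputable def prj2 (u v θ : Fin n → ℝ) : Fin n → ℝ := prj (prj u v) (prj u θ)

lemma prj2_zero (u θ : Fin n → ℝ) : prj2 u 0 θ = prj u θ := by simp [prj2, prj]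

lemma prj2_dot_left (u v θ : Fin n → ℝ) : prj2 u v θ ⬝ᵥ u = 0 := by
  rw [prj2, dotProduct_comm]
  rw [dot_prj_of_dot_eq_zero (by rw [dotProduct_comm, prj_dot]), dotProduct_comm, prj_dot]

lemma prj2_dot_right (u v θ : Fin n → ℝ) : prj2 u v θ ⬝ᵥ v = 0 := by
  rw [← dot_prj_of_dot_eq_zero (prj2_dot_left u v θ), prj2, prj_dot]

lemma prj2_eq_self {u v θ : Fin n → ℝ} (hu : θ ⬝ᵥ u = 0) (hv : θ ⬝ᵥ v = 0) : prj2 u v θ = θ := by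
  have : θ ⬝ᵥ prj u v = 0 := by rw [dot_prj_of_dot_eq_zero hu, hv]
  rw [prj2, prj_eq_self hu, prj_eq_self this]

lemma IsRat.prj2 {u v θ : Fin n → ℝ} (hu : IsRat u) (hv : IsRat v) (hθ : IsRat θ) :
    IsRat (prj2 u v θ) := (hu.prj hv).prj (hu.prj hθ)

lemma prj_add (u θ θ' : Fin n → ℝ) : prj u (θ + θ') = prj u θ + prj u θ' := by
  simp only [prj, add_dotProduct, add_div]; module

lemma prj_smul (u θ : Fin n → ℝ) (c : ℝ) : prj u (c • θ) = c • prj u θ := by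
  simp only [prj, smul_dotProduct, smul_eq_mul, mul_div_assoc]; module

/-- Orthogonal projection along the span of `u` and `v`, as a linear map. -/
noncomputable def prjL (u v : Fin n → ℝ) : (Fin n → ℝ) →ₗ[ℝ] (Fin n → ℝ) where
  toFun := prj2 u v
  map_add' x y := by simp only [prj2, prj_add]
  map_smul' c x := by simp only [prj2, prj_smul]; rfl

lemma prjL_apply (u v θ : Fin n → ℝ) : prjL u v θ = prj2 u v θ := rfl

lemma tendsto_prj {α : Type*} {l : Filter α} {u θ : α → Fin n → ℝ} {u₀ θ₀ : Fin n → ℝ}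
    (hu₀ : u₀ ≠ 0)
    (hu : Tendsto u l (𝓝 u₀)) (hθ : Tendsto θ l (𝓝 θ₀)) :
    Tendsto (fun a => prj (u a) (θ a)) l (𝓝 (prj u₀ θ₀)) := by
  have hdot {x y : α → Fin n → ℝ} {x₀ y₀} (hx : Tendsto x l (𝓝 x₀)) (hy : Tendsto y l (𝓝 y₀)) :
      Tendsto (fun a => x a ⬝ᵥ y a) l (𝓝 (x₀ ⬝ᵥ y₀)) :=
    tendsto_finsetSum _ fun i _ => (tendsto_pi_nhds.1 hx i).mul (tendsto_pi_nhds.1 hy i)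
  exact hθ.sub (((hdot hθ hu).div (hdot hu hu)
    fun h => hu₀ (dotProduct_self_eq_zero.1 h)).smul hu)

/-- `y` is not in the span of `u` and `v`. -/
def Ind (y u v : Fin n → ℝ) : Prop := ∃ f : Fin n → ℝ, f ⬝ᵥ u = 0 ∧ f ⬝ᵥ v = 0 ∧ f ⬝ᵥ y ≠ 0

lemma exists_dot_eq_zero (hn : 3 ≤ n) (u v : Fin n → ℝ) :
    ∃ f : Fin n → ℝ, f ≠ 0 ∧ f ⬝ᵥ u = 0 ∧ f ⬝ᵥ v = 0 := by
  let L : (Fin n → ℝ) →ₗ[ℝ] (Fin 2 → ℝ) := Matrix.mulVecLin (Matrix.of ![u, v])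
  have hL : LinearMap.ker L ≠ ⊥ := by
    apply LinearMap.ker_ne_bot_of_finrank_lt
    rw [Module.finrank_fin_fun, Module.finrank_fin_fun]; omega
  obtain ⟨f, hf, hf0⟩ := Submodule.exists_mem_ne_zero_of_ne_bot hL
  have hf' : L f = 0 := hf
  refine ⟨f, hf0, ?_, ?_⟩
  · rw [dotProduct_comm]; exact congrFun hf' 0
  · rw [dotProduct_comm]; exact congrFun hf' 1

/-- A set containing the non-vanishing locus of a nonzero polynomial. -/
def Gen (A : Set (Fin n → ℝ)) : Prop :=
  ∃ f : (Fin n → ℝ) → ℝ, IsPolyFun f ∧ (∃ x, f x ≠ 0) ∧ ∀ x, f x ≠ 0 → x ∈ A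

lemma gen_true : Gen (Set.univ : Set (Fin n → ℝ)) :=
  ⟨_, isPolyFun_const 1, ⟨0, one_ne_zero⟩, fun _ _ => trivial⟩

lemma Gen.mono {A B : Set (Fin n → ℝ)} (h : Gen A) (hAB : A ⊆ B) : Gen B := by
  obtain ⟨f, hf, hx, hA⟩ := h
  exact ⟨f, hf, hx, fun x h => hAB (hA x h)⟩

lemma gen_forall {ι : Type*} (J : Finset ι) {A : ι → Set (Fin n → ℝ)} (h : ∀ i ∈ J, Gen (A i)) :
    Gen {x | ∀ i ∈ J, x ∈ A i} := by
  classical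
  induction J using Finset.induction_on with
  | empty => exact gen_true.mono fun x _ i hi => absurd hi (Finset.notMem_empty i)
  | insert i J hi ih =>
    obtain ⟨f, hf, ⟨x, hx⟩, hA⟩ := h i (by simp)
    obtain ⟨g, hg, ⟨y, hy⟩, hB⟩ := ih fun j hj => h j (by simp [hj])
    refine ⟨_, hf.mul hg, ?_, fun x hx => ?_⟩
    · obtain ⟨z, hz1, hz2⟩ := (hf.dense hx).inter_open_nonempty _
        (isOpen_ne_fun hg.continuous continuous_const) ⟨y, hy⟩
      exact ⟨z, mul_ne_zero hz2 hz1⟩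
    · intro j hj
      rcases Finset.mem_insert.1 hj with rfl | hj
      · exact hA x (left_ne_zero_of_mul hx)
      · exact hB x (right_ne_zero_of_mul hx) j hj

lemma Gen.and {A B : Set (Fin n → ℝ)} (hA : Gen A) (hB : Gen B) : Gen {x | x ∈ A ∧ x ∈ B} := by
  have := gen_forall (A := fun b => cond b A B) Finset.univ fun b _ => by cases b <;> assumption
  exact this.mono fun x hx => ⟨hx true (by simp), hx false (by simp)⟩

lemma Gen.exists_isRat {A : Set (Fin n → ℝ)} (hA : Gen A) {O : Set (Fin n → ℝ)} (hO : IsOpen O)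
    (hne : O.Nonempty) : ∃ x ∈ O, IsRat x ∧ x ∈ A := by
  obtain ⟨f, hf, ⟨x, hx⟩, hA⟩ := hA
  obtain ⟨y, ⟨hyO, hy⟩, hyr⟩ := exists_isRat_mem
    (hO.inter (isOpen_ne_fun hf.continuous (continuous_const (y := (0 : ℝ)))))
    ((hf.dense hx).inter_open_nonempty _ hO hne)
  exact ⟨y, hyO, hyr, hA y hy⟩

lemma gen_dot {f : Fin n → ℝ} (hf : f ≠ 0) : Gen {x | f ⬝ᵥ x ≠ 0} :=
  ⟨_, isPolyFun_dot f, ⟨f, fun h => hf (dotProduct_self_eq_zero.1 h)⟩, fun _ h => h⟩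

lemma vecMul_matR_ne_zero {f : Fin n → ℝ} (hf : f ≠ 0) (g : SLZ n) : f ᵥ* matR g ≠ 0 := by
  intro h
  apply hf
  have h2 := dot_av f g (av g⁻¹ f)
  rw [av_av_inv, h, zero_dotProduct] at h2
  exact dotProduct_self_eq_zero.1 h2

lemma gen_ind_av (hn : 3 ≤ n) (g : SLZ n) (u v : Fin n → ℝ) : Gen {x | Ind (av g x) u v} := by
  obtain ⟨f, hf0, hu, hv⟩ := exists_dot_eq_zero hn u v
  exact (gen_dot (vecMul_matR_ne_zero hf0 g)).mono fun x hx => ⟨f, hu, hv, by rwa [dot_av]⟩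

lemma gen_ind_left (hn : 3 ≤ n) (g : SLZ n) {y z : Fin n → ℝ} (h : Ind y z 0) :
    Gen {x | Ind y (av g x) z} := by
  obtain ⟨f₁, h1z, -, h1y⟩ := h
  obtain ⟨f₂, hf0, h2z, h2y⟩ := exists_dot_eq_zero hn z y
  refine (gen_dot (vecMul_matR_ne_zero hf0 g)).mono fun x hx => ?_
  have hx' : f₂ ⬝ᵥ av g x ≠ 0 := by rwa [dot_av]
  refine ⟨f₁ - ((f₁ ⬝ᵥ av g x) / (f₂ ⬝ᵥ av g x)) • f₂, ?_, ?_, ?_⟩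
  · rw [sub_dotProduct, smul_dotProduct, smul_eq_mul, div_mul_cancel₀ _ hx', sub_self]
  · rw [sub_dotProduct, smul_dotProduct, h1z, h2z]; simp
  · rw [sub_dotProduct, smul_dotProduct, h2y]; simpa using h1y

lemma gen_ind_self_of_witness (g : SLZ n) {z f₁ f₂ x₀ : Fin n → ℝ} (h1 : f₁ ⬝ᵥ z = 0)
    (h2 : f₂ ⬝ᵥ z = 0) (h : (f₂ ⬝ᵥ x₀) * (f₁ ⬝ᵥ av g x₀) - (f₁ ⬝ᵥ x₀) * (f₂ ⬝ᵥ av g x₀) ≠ 0) :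
    Gen {x | Ind (av g x) x z} := by
  refine ⟨fun x => (f₂ ⬝ᵥ x) * (f₁ ⬝ᵥ av g x) - (f₁ ⬝ᵥ x) * (f₂ ⬝ᵥ av g x), ?_, ⟨x₀, h⟩,
    fun x hx => ⟨(f₂ ⬝ᵥ x) • f₁ - (f₁ ⬝ᵥ x) • f₂, ?_, ?_, ?_⟩⟩
  · simp only [dot_av]
    exact ((isPolyFun_dot _).mul (isPolyFun_dot _)).sub ((isPolyFun_dot _).mul (isPolyFun_dot _))
  · simp only [sub_dotProduct, smul_dotProduct, smul_eq_mul]; ring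
  · simp only [sub_dotProduct, smul_dotProduct, h1, h2]; simp
  · simpa only [sub_dotProduct, smul_dotProduct, smul_eq_mul] using hx

lemma gen_ind_self (hn : 3 ≤ n) (g : SLZ n) {z : Fin n → ℝ} (h : Ind (av g z) z 0) :
    Gen {x | Ind (av g x) x z} := by
  obtain ⟨f₁, h1, -, h1g⟩ := h
  obtain ⟨f₂, hf0, h2, h2g⟩ := exists_dot_eq_zero hn z (av g z)
  have hff : f₂ ⬝ᵥ f₂ ≠ 0 := fun h => hf0 (dotProduct_self_eq_zero.1 h)
  by_cases h0 : (f₂ ⬝ᵥ f₂) * (f₁ ⬝ᵥ av g f₂) - (f₁ ⬝ᵥ f₂) * (f₂ ⬝ᵥ av g f₂) = 0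
  · refine gen_ind_self_of_witness g (x₀ := f₂ + z) h1 h2 ?_
    simp only [map_add, dotProduct_add, h1, h2, h2g, add_zero, mul_add]
    intro h
    have : (f₂ ⬝ᵥ f₂) * (f₁ ⬝ᵥ av g z) = 0 := by linarith
    exact mul_ne_zero hff h1g this
  · exact gen_ind_self_of_witness g h1 h2 h0

lemma mem_center_of_matR {g : SLZ n} {r : ℝ} (h : matR g = r • (1 : Matrix (Fin n) (Fin n) ℝ)) :
    g ∈ Subgroup.center (SLZ n) := by
  rw [Subgroup.mem_center_iff]
  intro k
  apply matR_injective
  rw [matR_mul, matR_mul, h]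
  simp

lemma exists_scalar_of_mem_center {g : SLZ n} (h : g ∈ Subgroup.center (SLZ n)) :
    ∃ r : ℝ, r ≠ 0 ∧ ∀ x, av g x = r • x := by
  obtain ⟨r, hr, hA⟩ := Matrix.SpecialLinearGroup.mem_center_iff.1 h
  have h1 (x : Fin n → ℝ) : av g x = (r : ℝ) • x := by
    rw [av_apply, show matR g = (r : ℝ) • (1 : Matrix (Fin n) (Fin n) ℝ) from ?_, smul_mulVec,
      one_mulVec]
    ext i j
    have h2 : (g : Matrix (Fin n) (Fin n) ℤ) i j = if i = j then r else 0 := by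
      rw [← hA]; exact diagonal_apply ..
    rw [matR_apply, h2]
    by_cases hij : i = j <;> simp [hij, one_apply]
  rcases Nat.eq_zero_or_pos n with rfl | hn
  · exact ⟨1, one_ne_zero, fun x => Subsingleton.elim _ _⟩
  · refine ⟨r, fun h0 => ?_, h1⟩
    rw [Int.cast_eq_zero] at h0
    rw [h0, Fintype.card_fin, zero_pow hn.ne'] at hr
    exact zero_ne_one hr

/-- A non-central element moves a generic line. -/
lemma gen_ind_of_not_mem_center {g : SLZ n} (hg : g ∉ Subgroup.center (SLZ n)) :
    Gen {x | Ind (av g x) x 0} := by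
  by_contra hG
  have key (i j : Fin n) (x : Fin n → ℝ) : x j * av g x i = x i * av g x j := by
    by_contra h
    refine hG (gen_ind_self_of_witness g (f₁ := Pi.single i 1) (f₂ := Pi.single j 1) (x₀ := x)
      (by simp) (by simp) ?_)
    simpa [sub_eq_zero] using h
  have he (i j : Fin n) : av g (Pi.single j 1) i = matR g i j := by
    rw [av_apply, mulVec_single_one]; rfl
  have hoff (i j : Fin n) (hij : i ≠ j) : matR g i j = 0 := by
    have := key i j (Pi.single j 1)
    rwa [he, he, Pi.single_eq_same, Pi.single_eq_of_ne hij, one_mul, zero_mul] at this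
  have hdiag (i j : Fin n) : matR g i i = matR g j j := by
    by_cases hij : i = j
    · rw [hij]
    have := key i j (Pi.single i 1 + Pi.single j 1)
    simp only [map_add, Pi.add_apply, he, hoff i j hij, hoff j i (Ne.symm hij), Pi.single_eq_same,
      Pi.single_eq_of_ne hij, Pi.single_eq_of_ne (Ne.symm hij)] at this
    linarith
  rcases isEmpty_or_nonempty (Fin n) with h | ⟨⟨i₀⟩⟩
  · exact hg (mem_center_of_matR (r := 1) (Subsingleton.elim _ _))
  · refine hg (mem_center_of_matR (r := matR g i₀ i₀) ?_)
    ext i j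
    by_cases hij : i = j
    · subst hij; simp [hdiag i i₀]
    · simp [hoff i j hij, hij]

end Projections

section Center

variable {n : ℕ} {B₁ B₂ : Set (Submodule ℝ (Fin n → ℝ))} {S : Set (SLZ n)} {F : Set (Fin n → ℝ)}

/-- The subgroup generated by `S` and the center. -/
def cl (S : Set (SLZ n)) : Subgroup (SLZ n) := Subgroup.closure S ⊔ Subgroup.center (SLZ n)

lemma closure_le_cl {h : SLZ n} (hh : h ∈ Subgroup.closure S) : h ∈ cl S := Subgroup.mem_sup_left hh

lemma center_le_cl {h : SLZ n} (hh : h ∈ Subgroup.center (SLZ n)) : h ∈ cl S :=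
  Subgroup.mem_sup_right hh

lemma mul_comm_mem_center {G : Type*} [Group G] {a b : G} (h : a * b ∈ Subgroup.center G) :
    b * a ∈ Subgroup.center G := by
  have := (inferInstance : (Subgroup.center G).Normal).conj_mem _ h a⁻¹
  simpa [mul_assoc] using this

lemma mul_mem_cl_of_mem_center {a b h : SLZ n} (hh : h ∈ Subgroup.closure S)
    (hc : a * h * b ∈ Subgroup.center (SLZ n)) : b * a ∈ cl S := by
  have h1 : h * (b * a) ∈ Subgroup.center (SLZ n) := by
    have := mul_comm_mem_center (a := a) (b := h * b) (by rwa [← mul_assoc])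
    rwa [mul_assoc] at this
  exact (Subgroup.mul_mem_cancel_left _ (closure_le_cl hh)).1 (center_le_cl h1)

lemma IsState.eq_one_of_fix (hst : IsState B₁ B₂ S F) {h : SLZ n} (hh : h ∈ Subgroup.closure S)
    {x : Fin n → ℝ} (hx : x ∈ F) {c : ℝ} (hc : c ≠ 0) (hfix : av h x = c • x) : h = 1 := by
  by_contra h1
  exact hst.move h hh h1 x hx (hfix ▸ hst.cone x hx c hc)

lemma IsState.eq_one_of_mem_center (hst : IsState B₁ B₂ S F) {h : SLZ n}
    (hh : h ∈ Subgroup.closure S) (hc : h ∈ Subgroup.center (SLZ n)) : h = 1 := by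
  obtain ⟨x, hx⟩ := hst.nonempty
  obtain ⟨r, hr, hav⟩ := exists_scalar_of_mem_center hc
  exact hst.eq_one_of_fix hh hx hr (hav x)

lemma IsState.mem_center_of_fix (hst : IsState B₁ B₂ S F) {h : SLZ n} (hh : h ∈ cl S)
    {x : Fin n → ℝ} (hx : x ∈ F) (hfix : av h x = x) : h ∈ Subgroup.center (SLZ n) := by
  obtain ⟨k, hk, z, hz, rfl⟩ := Subgroup.mem_sup_of_normal_right.1 hh
  obtain ⟨r, hr, hav⟩ := exists_scalar_of_mem_center hz
  rw [av_mul, hav, map_smul] at hfix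
  have hk1 : k = 1 := hst.eq_one_of_fix hk hx (inv_ne_zero hr) (by
    rw [← hfix, smul_smul, inv_mul_cancel₀ hr, one_smul, hfix])
  rwa [hk1, one_mul]

/-- In a family of elements fixing `q`, distinct modulo the center, few translates lie in
`cl S`. -/
lemma IsState.exists_not_mem_cl (hst : IsState B₁ B₂ S F) {q ψ : Fin n → ℝ} (hq : q ∈ F)
    (hψ : ψ ≠ 0) (h0 : ψ ⬝ᵥ q = 0) {D : ℝ} (hD : 0 < D) {B : ℤ → SLZ n}
    (hB : ∀ k : ℤ, matR (B k) = 1 + ((k : ℝ) * D) • vecMulVec q ψ) (J : Finset (SLZ n)) :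
    ∃ k : ℤ, ∀ u ∈ J, u * B k ∉ cl S ∧ u * (B k)⁻¹ ∉ cl S := by
  have hav (k : ℤ) (x : Fin n → ℝ) : av (B k) x = x + (k * D * (ψ ⬝ᵥ x)) • q := by
    rw [av_apply, hB, add_mulVec, one_mulVec, smul_mulVec, vecMulVec_mulVec, op_smul_eq_smul,
      smul_smul]
  have hq0 := hst.ne_zero q hq
  have hinj (u : SLZ n) : {k : ℤ | u * B k ∈ cl S}.Subsingleton := by
    intro k hk l hl
    have hm : (B k)⁻¹ * B l ∈ cl S := by
      have := mul_mem (inv_mem (show u * B k ∈ cl S from hk)) (show u * B l ∈ cl S from hl)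
      simpa [mul_assoc] using this
    have hfix : av ((B k)⁻¹ * B l) q = q := by
      have h1 (m : ℤ) : av (B m) q = q := by rw [hav, h0]; simp
      rw [av_mul, h1, ← h1 k, av_inv_av, h1]
    obtain ⟨r, hr, hz⟩ := exists_scalar_of_mem_center (hst.mem_center_of_fix hm hq hfix)
    have hr1 : r = 1 := by
      have : r • q = (1 : ℝ) • q := by rw [← hz, hfix, one_smul]
      exact smul_left_injective ℝ hq0 this
    have h2 : av (B l) ψ = av (B k) ψ := by
      have := congrArg (av (B k)) (hz ψ)
      rwa [← av_mul, mul_inv_cancel_left, hr1, one_smul] at this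
    rw [hav, hav] at h2
    have h3 := smul_left_injective ℝ hq0 (add_left_cancel h2)
    have h4 : ψ ⬝ᵥ ψ ≠ 0 := fun h => hψ (dotProduct_self_eq_zero.1 h)
    have h5 := mul_right_cancel₀ hD.ne' (mul_right_cancel₀ h4 h3)
    exact_mod_cast h5.symm
  have hinv (k : ℤ) : (B k)⁻¹ = B (-k) := trans_inv h0 hB k
  have hfin : (⋃ u ∈ J, {k : ℤ | u * B k ∈ cl S} ∪ Neg.neg ⁻¹' {k : ℤ | u * B k ∈ cl S}).Finite :=
    J.finite_toSet.biUnion fun u _ => (hinj u).finite.union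
      ((hinj u).finite.preimage neg_injective.injOn)
  obtain ⟨k, hk⟩ := hfin.exists_notMem
  refine ⟨k, fun u hu => ⟨fun h => hk ?_, fun h => hk ?_⟩⟩
  · exact Set.mem_biUnion hu (Or.inl h)
  · exact Set.mem_biUnion hu (Or.inr (by rw [hinv] at h; exact h))

/-- Elements in general position with respect to the state and `g`. -/
structure GenPos (S : Set (SLZ n)) (g β₁ β₂ : SLZ n) : Prop where
  self : g ∉ cl S
  left : β₁ ∉ cl S
  right : β₂ ∉ cl S
  mul_left : g * β₁ ∉ cl S
  mul_left_inv : g * β₁⁻¹ ∉ cl S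
  inv_right_mul : β₂⁻¹ * g ∉ cl S
  inv_right_mul_mul_inv : β₂⁻¹ * g * β₁⁻¹ ∉ cl S
  conj_mul_right : g * β₁ * g⁻¹ * β₂ ∉ cl S
  conj : g * β₁ * g⁻¹ ∉ cl S

lemma IsState.exists_genPos (hn : 3 ≤ n) (hst : IsState B₁ B₂ S F) {g : SLZ n} (hg : g ∉ cl S) :
    ∃ q ∈ F, ∃ β₁ β₂ : SLZ n, Ind (av g⁻¹ q) q 0 ∧ av β₁ q = q ∧ av β₂ q = q ∧
      av β₁ (av g⁻¹ q) = av g⁻¹ q ∧ GenPos S g β₁ β₂ := by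
  classical
  have hgc : g⁻¹ ∉ Subgroup.center (SLZ n) := fun h => hg (center_le_cl (by simpa using h))
  obtain ⟨q, hqF, hqr, hqI⟩ := (gen_ind_of_not_mem_center hgc).exists_isRat hst.isOpen hst.nonempty
  obtain ⟨ψ₀, hψ₀0, hψ₀q, hψ₀g⟩ := exists_dot_eq_zero hn q (av g⁻¹ q)
  obtain ⟨θ, hθ, hθr⟩ := exists_isRat_mem
    (isOpen_ne_fun (f := fun θ => ψ₀ ⬝ᵥ θ) (g := fun _ => 0) (continuous_dot ψ₀) continuous_const)
    ⟨ψ₀, fun h => hψ₀0 (dotProduct_self_eq_zero.1 h)⟩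
  set ψ := prj2 q (av g⁻¹ q) θ with hψ
  have hψq : ψ ⬝ᵥ q = 0 := prj2_dot_left ..
  have hψg : ψ ⬝ᵥ av g⁻¹ q = 0 := prj2_dot_right ..
  have hψr : IsRat ψ := hqr.prj2 (hqr.av _) hθr
  have hψ0 : ψ ≠ 0 := by
    intro h
    apply hθ
    have h1 : ψ₀ ⬝ᵥ ψ = ψ₀ ⬝ᵥ θ := by
      rw [hψ, prj2, dot_prj_of_dot_eq_zero, dot_prj_of_dot_eq_zero hψ₀q]
      rw [dot_prj_of_dot_eq_zero hψ₀q, hψ₀g]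
    show ψ₀ ⬝ᵥ θ = 0
    rw [← h1, h, dotProduct_zero]
  obtain ⟨D, hD, B, hB⟩ := exists_trans hqr hψr hψq
  have hfix (k : ℤ) (x : Fin n → ℝ) (hx : ψ ⬝ᵥ x = 0) : av (B k) x = x := by
    rw [av_apply, hB, add_mulVec, one_mulVec, smul_mulVec, vecMulVec_mulVec, hx]; simp
  obtain ⟨j, hj⟩ := hst.exists_not_mem_cl hqF hψ0 hψq hD hB {1, g}
  set β₁ := B j
  obtain ⟨k, hk⟩ := hst.exists_not_mem_cl hqF hψ0 hψq hD hB {1, g⁻¹, β₁ * g⁻¹, g * β₁ * g⁻¹}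
  set β₂ := B k
  have h1 := hj 1 (by simp)
  have h2 := hj g (by simp)
  have h3 := hk 1 (by simp)
  have h4 := hk g⁻¹ (by simp)
  have h5 := hk (β₁ * g⁻¹) (by simp)
  have h6 := hk (g * β₁ * g⁻¹) (by simp)
  rw [one_mul, one_mul] at h1 h3
  refine ⟨q, hqF, β₁, β₂, hqI, hfix j q hψq, hfix k q hψq, hfix j _ hψg, hg, h1.1, h3.1, h2.1, h2.2,
    fun h => h4.1 ?_, fun h => h5.1 ?_, h6.1, fun h => h1.1 (center_le_cl ?_)⟩
  · simpa using inv_mem h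
  · simpa [mul_assoc] using inv_mem h
  · have := hst.mem_center_of_fix h hqF (by
      rw [av_mul, av_mul, hfix j _ hψg, av_av_inv])
    have := mul_comm_mem_center this
    simpa [mul_assoc] using this

end Center

section Vectors

variable {n : ℕ}

lemma Ind.av {y u v : Fin n → ℝ} (h : Ind y u v) (g : SLZ n) :
    Ind (av g y) (av g u) (av g v) := by
  obtain ⟨f, hu, hv, hy⟩ := h
  exact ⟨f ᵥ* matR g⁻¹, by simpa [← dot_av] using hu, by simpa [← dot_av] using hv,
    by simpa [← dot_av] using hy⟩

lemma ind_of_ne_zero {x : Fin n → ℝ} (hx : x ≠ 0) : Ind x 0 0 :=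
  ⟨x, by simp, by simp, fun h => hx (dotProduct_self_eq_zero.1 h)⟩

lemma gen_ind_av_comp {g κ : SLZ n} (h : κ⁻¹ * g ∉ Subgroup.center (SLZ n)) :
    Gen {x | Ind (av g x) (av κ x) 0} :=
  (gen_ind_of_not_mem_center h).mono fun x (hx : Ind _ _ _) => by
    simpa [← av_mul] using hx.av κ

lemma gen_ind_av_mul {g κ : SLZ n} (h : g ∉ Subgroup.center (SLZ n)) :
    Gen {x | Ind (av g (av κ x)) (av κ x) 0} := by
  have h' : κ⁻¹ * (g * κ) ∉ Subgroup.center (SLZ n) := fun hc => h (by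
    simpa [mul_assoc] using mul_comm_mem_center hc)
  exact (gen_ind_av_comp h').mono fun x hx => by simpa only [av_mul] using hx

lemma gen_imp {p : Prop} {A : Set (Fin n → ℝ)} (h : p → Gen A) : Gen {x | p → x ∈ A} := by
  by_cases hp : p
  · exact (h hp).mono fun x hx _ => hx
  · exact gen_true.mono fun x _ h => absurd h hp

/-- Rational vectors in general position with respect to a finite set of group elements. -/
lemma exists_vectors (hn : 3 ≤ n) (J : Finset (SLZ n)) (κ : SLZ n) {Oa Ow : Set (Fin n → ℝ)}
    (hOa : IsOpen Oa) (hOa' : Oa.Nonempty) (hOw : IsOpen Ow) (hOw' : Ow.Nonempty)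
    (hw0 : ∀ x ∈ Ow, x ≠ 0) :
    ∃ a w : Bool → Fin n → ℝ, (∀ σ, a σ ∈ Oa ∧ IsRat (a σ)) ∧ (∀ σ, w σ ∈ Ow ∧ IsRat (w σ)) ∧
      ∀ γ ∈ J, ∀ σ τ, (γ ∉ Subgroup.center (SLZ n) ∨ σ ≠ τ → Ind (av γ (w τ)) (w σ) 0) ∧
        Ind (av γ (a τ)) (w σ) 0 ∧
        (γ ∉ Subgroup.center (SLZ n) ∨ σ ≠ τ → Ind (av γ (a τ)) (a σ) (av κ (w σ))) ∧
        (κ⁻¹ * γ ∉ Subgroup.center (SLZ n) ∨ σ ≠ τ →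
          Ind (av γ (w τ)) (a σ) (av κ (w σ))) := by
  set Z := Subgroup.center (SLZ n)
  have hself : Gen {x | ∀ γ ∈ J, x ∈ {x | (γ ∉ Z → x ∈ {x | Ind (av γ x) x 0}) ∧
      x ∈ {x | (γ ∉ Z → x ∈ {x | Ind (av γ (av κ x)) (av κ x) 0}) ∧
      x ∈ {x | κ⁻¹ * γ ∉ Z → x ∈ {x | Ind (av γ x) (av κ x) 0}}}}} :=
    gen_forall J fun γ _ => (gen_imp gen_ind_of_not_mem_center).and
      ((gen_imp gen_ind_av_mul).and (gen_imp gen_ind_av_comp))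
  obtain ⟨w₀, hw₀O, hw₀r, hw₀⟩ := hself.exists_isRat hOw hOw'
  have hav0 (γ : SLZ n) : Ind (av γ w₀) 0 0 := ind_of_ne_zero (av_ne_zero (hw0 _ hw₀O))
  obtain ⟨w₁, hw₁O, hw₁r, hw₁, hw₁'⟩ := (hself.and (gen_forall J fun γ _ =>
    (gen_ind_av hn γ w₀ 0).and ((gen_ind_left hn 1 (hav0 γ)).and
      ((gen_ind_av hn γ (av κ w₀) 0).and (gen_ind_left hn κ (hav0 γ)))))).exists_isRat hOw hOw'
  set w : Bool → Fin n → ℝ := fun σ => cond σ w₁ w₀ with hw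
  have hww (γ) (hγ : γ ∈ J) (σ τ) (h : γ ∉ Z ∨ σ ≠ τ) : Ind (av γ (w τ)) (w σ) 0 := by
    cases σ <;> cases τ
    · exact (hw₀ γ hγ).1 (by simpa using h)
    · exact (hw₁' γ hγ).1
    · have h1 : Ind (av γ w₀) (av 1 w₁) 0 := (hw₁' γ hγ).2.1
      rwa [av_one] at h1
    · exact (hw₁ γ hγ).1 (by simpa using h)
  have hwκ (γ) (hγ : γ ∈ J) (σ τ) (h : κ⁻¹ * γ ∉ Z ∨ σ ≠ τ) :
      Ind (av γ (w τ)) (av κ (w σ)) 0 := by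
    cases σ <;> cases τ
    · exact (hw₀ γ hγ).2.2 (by simpa using h)
    · exact (hw₁' γ hγ).2.2.1
    · exact (hw₁' γ hγ).2.2.2
    · exact (hw₁ γ hγ).2.2 (by simpa using h)
  have hκκ (γ) (hγ : γ ∈ J) (σ) (h : γ ∉ Z) : Ind (av γ (av κ (w σ))) (av κ (w σ)) 0 := by
    cases σ
    · exact (hw₀ γ hγ).2.1 h
    · exact (hw₁ γ hγ).2.1 h
  have hcommon (σ : Bool) : Gen {x | ∀ γ ∈ J, x ∈ {x | (∀ τ ∈ (Finset.univ : Finset Bool),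
      x ∈ {x | Ind (av γ x) (w τ) 0}) ∧
      x ∈ {x | (γ ∉ Z → x ∈ {x | Ind (av γ x) x (av κ (w σ))}) ∧
      x ∈ {x | ∀ τ ∈ (Finset.univ : Finset Bool), x ∈ {x | κ⁻¹ * γ ∉ Z ∨ σ ≠ τ →
        x ∈ {x | Ind (av γ (w τ)) (av 1 x) (av κ (w σ))}}}}}} :=
    gen_forall J fun γ hγ => (gen_forall _ fun τ _ => gen_ind_av hn γ _ _).and
      ((gen_imp fun h => gen_ind_self hn γ (hκκ γ hγ σ h)).and
      (gen_forall _ fun τ _ => gen_imp fun h => gen_ind_left hn 1 (hwκ γ hγ σ τ h)))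
  obtain ⟨a₀, ha₀O, ha₀r, ha₀, ha₀'⟩ := ((hcommon false).and (gen_forall J fun γ _ =>
    gen_ind_av hn γ (av κ w₁) 0)).exists_isRat hOa hOa'
  obtain ⟨a₁, ha₁O, ha₁r, ha₁, ha₁'⟩ := ((hcommon true).and (gen_forall J fun γ hγ =>
    (gen_ind_left hn 1 (ha₀' γ hγ)).and
      (gen_ind_av hn γ a₀ (av κ w₀)))).exists_isRat hOa hOa'
  refine ⟨fun σ => cond σ a₁ a₀, w, fun σ => ?_, fun σ => ?_, fun γ hγ σ τ =>
    ⟨hww γ hγ σ τ, ?_, fun h => ?_, fun h => ?_⟩⟩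
  · cases σ
    exacts [⟨ha₀O, ha₀r⟩, ⟨ha₁O, ha₁r⟩]
  · cases σ
    exacts [⟨hw₀O, hw₀r⟩, ⟨hw₁O, hw₁r⟩]
  · cases τ
    · exact (ha₀ γ hγ).1 σ (Finset.mem_univ _)
    · exact (ha₁ γ hγ).1 σ (Finset.mem_univ _)
  · cases σ <;> cases τ
    · exact (ha₀ γ hγ).2.1 (by simpa using h)
    · exact (ha₁' γ hγ).2
    · have h1 : Ind (av γ a₀) (av 1 a₁) (av κ w₁) := (ha₁' γ hγ).1
      rwa [av_one] at h1
    · exact (ha₁ γ hγ).2.1 (by simpa using h)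
  · cases σ
    · simpa using (ha₀ γ hγ).2.2 τ (Finset.mem_univ _) h
    · simpa using (ha₁ γ hγ).2.2 τ (Finset.mem_univ _) h

/-- A rational form vanishing at `u` and `v`, close to a given one, and nonzero at finitely many
vectors outside the span of `u` and `v`. -/
lemma exists_form_near {u v φ : Fin n → ℝ} (hu : IsRat u) (hv : IsRat v) {O : Set (Fin n → ℝ)}
    (hO : IsOpen O) (hφ : prj2 u v φ ∈ O) (Y : Finset (Fin n → ℝ)) :
    ∃ f ∈ O, IsRat f ∧ f ⬝ᵥ u = 0 ∧ f ⬝ᵥ v = 0 ∧ ∀ y ∈ Y, Ind y u v → f ⬝ᵥ y ≠ 0 := by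
  have hgen : Gen {θ | ∀ y ∈ Y, θ ∈ {θ | Ind y u v → θ ∈ {θ | prj2 u v θ ⬝ᵥ y ≠ 0}}} := by
    refine gen_forall Y fun y _ => gen_imp fun ⟨f, hfu, hfv, hfy⟩ => ?_
    obtain ⟨z, hz⟩ : ∃ z, ∀ θ, prj2 u v θ ⬝ᵥ y = z ⬝ᵥ θ := by
      refine ⟨fun i => prj2 u v (Pi.single i 1) ⬝ᵥ y, fun θ => ?_⟩
      have h1 : θ = ∑ i, θ i • (Pi.single i 1 : Fin n → ℝ) := (pi_eq_sum_univ' θ)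
      conv_lhs => rw [h1, ← prjL_apply, map_sum, sum_dotProduct]
      simp only [map_smul, smul_dotProduct, prjL_apply, smul_eq_mul]
      exact Finset.sum_congr rfl fun i _ => mul_comm _ _
    have hz0 : z ≠ 0 := by
      rintro rfl
      apply hfy
      rw [← prj2_eq_self hfu hfv, hz, zero_dotProduct]
    exact (gen_dot hz0).mono fun θ hθ => by
      show prj2 u v θ ⬝ᵥ y ≠ 0
      rw [hz]; exact hθ
  obtain ⟨θ, hθO, hθr, hθ⟩ := hgen.exists_isRat
    (hO.preimage (LinearMap.continuous_of_finiteDimensional (prjL u v))) ⟨φ, hφ⟩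
  exact ⟨_, hθO, hu.prj2 hv hθr, prj2_dot_left .., prj2_dot_right .., hθ⟩

end Vectors

section Base

variable {n : ℕ} {B₁ B₂ : Set (Submodule ℝ (Fin n → ℝ))} {S : Set (SLZ n)} {F : Set (Fin n → ℝ)}

/-- Zeros of a linear form along a transverse line persist under perturbation. -/
lemma eventually_exists_zero {p e f₀ : Fin n → ℝ} {O : Set (Fin n → ℝ)} (hO : IsOpen O)
    (hp : p ∈ O) (h0 : f₀ ⬝ᵥ p = 0) (he : f₀ ⬝ᵥ e ≠ 0) :
    ∀ᶠ f in 𝓝 f₀, ∃ s : ℝ, p + s • e ∈ O ∧ f ⬝ᵥ (p + s • e) = 0 := by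
  have hc (v : Fin n → ℝ) : Continuous fun f : Fin n → ℝ => f ⬝ᵥ v := by
    simpa only [dotProduct_comm] using continuous_dot v
  have h1 : Tendsto (fun f => p + (-(f ⬝ᵥ p) / (f ⬝ᵥ e)) • e) (𝓝 f₀) (𝓝 p) := by
    have := (((hc p).tendsto f₀).neg.div ((hc e).tendsto f₀) he).smul_const e |>.const_add p
    simpa [h0] using this
  filter_upwards [h1.eventually (hO.mem_nhds hp), (hc e).continuousAt.eventually_ne he]
    with f hf hfe
  refine ⟨_, hf, ?_⟩
  rw [dotProduct_add, dotProduct_smul, smul_eq_mul, div_mul_cancel₀ _ hfe, add_neg_cancel]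

lemma AwayOff.mono {H : Subgroup (SLZ n)} {Φ Φ' : Finset (SLZ n)} {φ : Fin n → ℝ}
    (h : AwayOff H Φ F φ) (hΦ : Φ ⊆ Φ') : AwayOff H Φ' F φ := by
  obtain ⟨κ, hκ, h⟩ := h
  exact ⟨κ, hκ, fun x hx hx' => h x hx fun h' => hx' (hΦ h')⟩

lemma IsState.exists_base (hn : 3 ≤ n) (hst : IsState B₁ B₂ S F) {κ : SLZ n} {q : Fin n → ℝ}
    {O : Set (Fin n → ℝ)} (hO : IsOpen O) (hq : q ∈ O) (hO0 : ∀ x ∈ O, x ≠ 0)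
    (hprj : ∀ a ∈ O, ∀ w ∈ O, prj a (av κ w) ≠ 0) (T : Finset (SLZ n)) :
    ∃ (O₁ O₂ Oa Ow : Set (Fin n → ℝ)) (Φ : Finset (SLZ n)) (φ₁ φ₂ : Fin n → ℝ),
      IsOpen O₁ ∧ IsOpen O₂ ∧
      (∀ φ ∈ O₁, ∀ τ ∈ T, AwayOff (Subgroup.closure S) Φ F (φ ᵥ* matR τ)) ∧
      (∀ φ ∈ O₂, ∀ τ ∈ T, AwayOff (Subgroup.closure S) Φ F (φ ᵥ* matR τ)) ∧
      IsOpen Oa ∧ Oa.Nonempty ∧ IsOpen Ow ∧ Ow.Nonempty ∧ Oa ⊆ O ∧ Ow ⊆ O ∧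
      ∀ a ∈ Oa, ∀ w ∈ Ow, prj2 a (av κ w) φ₁ ∈ O₁ ∧ prj2 w 0 φ₂ ∈ O₂ := by
  classical
  have hself {f : Fin n → ℝ} (hf : f ≠ 0) : f ⬝ᵥ f ≠ 0 := fun h => hf (dotProduct_self_eq_zero.1 h)
  obtain ⟨ψ, hψ0, hψq, hψκ⟩ := exists_dot_eq_zero hn q (av κ q)
  have hvm : Tendsto (fun f : Fin n → ℝ => f ᵥ* matR κ) (𝓝 ψ) (𝓝 (ψ ᵥ* matR κ)) :=
    (continuous_id.matrix_vecMul continuous_const).tendsto ψ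
  have hev : ∀ᶠ f in 𝓝 ψ, (∃ s : ℝ, q + s • ψ ∈ O ∧ f ⬝ᵥ (q + s • ψ) = 0) ∧
      ∃ s : ℝ, q + s • (ψ ᵥ* matR κ) ∈ O ∧ (f ᵥ* matR κ) ⬝ᵥ (q + s • (ψ ᵥ* matR κ)) = 0 :=
    (eventually_exists_zero hO hq hψq (hself hψ0)).and
      (hvm.eventually (eventually_exists_zero hO hq (by rw [← dot_av, hψκ])
        (hself (vecMul_matR_ne_zero hψ0 κ))))
  obtain ⟨V, hV, hVo, hψV⟩ := eventually_nhds_iff.1 hev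
  obtain ⟨φ₁, hφ₁V, δ₁, hδ₁, Φ₁, hΦ₁⟩ := hst.exists_away T hVo ⟨ψ, hψV⟩
  obtain ⟨⟨s, haO, ha0⟩, ⟨r, hwO, hw0⟩⟩ := hV φ₁ hφ₁V
  set a' := q + s • ψ
  set w₀ := q + r • (ψ ᵥ* matR κ)
  obtain ⟨e, he0, hew, heφ⟩ := exists_dot_eq_zero hn w₀ (φ₁ ᵥ* matR κ)
  obtain ⟨V₂, hV₂, hV₂o, heV⟩ :=
    eventually_nhds_iff.1 (eventually_exists_zero hO hwO hew (hself he0))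
  obtain ⟨φ₂, hφ₂V, δ₂, hδ₂, Φ₂, hΦ₂⟩ := hst.exists_away T hV₂o ⟨e, heV⟩
  obtain ⟨s₂, hw'O, hw'0⟩ := hV₂ φ₂ hφ₂V
  set w' := w₀ + s₂ • e
  have hφ₁w' : φ₁ ⬝ᵥ av κ w' = 0 := by
    rw [dot_av, dotProduct_add, hw0, dotProduct_smul, dotProduct_comm _ e, heφ, smul_zero, add_zero]
  have ht1 : Tendsto (fun z : (Fin n → ℝ) × (Fin n → ℝ) => prj2 z.1 (av κ z.2) φ₁)
      (𝓝 a' ×ˢ 𝓝 w') (𝓝 φ₁) := by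
    have h1 : Tendsto (fun z : (Fin n → ℝ) × (Fin n → ℝ) => av κ z.2) (𝓝 a' ×ˢ 𝓝 w')
        (𝓝 (av κ w')) := ((continuous_av κ).tendsto _).comp tendsto_snd
    have := tendsto_prj (hprj a' haO w' hw'O) (tendsto_prj (hO0 a' haO) tendsto_fst h1)
      (tendsto_prj (hO0 a' haO) (tendsto_fst (g := 𝓝 w')) (tendsto_const_nhds (x := φ₁)))
    rw [show prj (prj a' (av κ w')) (prj a' φ₁) = φ₁ from prj2_eq_self ha0 hφ₁w'] at this
    exact this
  have ht2 : Tendsto (fun w => prj2 w 0 φ₂) (𝓝 w') (𝓝 φ₂) := by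
    have := tendsto_prj (hO0 w' hw'O) (tendsto_id (x := 𝓝 w'))
      (tendsto_const_nhds (x := φ₂) (f := 𝓝 w'))
    rw [prj_eq_self hw'0] at this
    simpa only [prj2_zero, id] using this
  obtain ⟨Pa, hPa, Pw, hPw, hP⟩ := eventually_prod_iff.1
    (ht1.eventually (Metric.ball_mem_nhds φ₁ hδ₁))
  obtain ⟨Oa, hOa, hOao, haOa⟩ := eventually_nhds_iff.1 (hPa.and (hO.mem_nhds haO))
  obtain ⟨Ow, hOw, hOwo, hwOw⟩ := eventually_nhds_iff.1
    ((hPw.and (ht2.eventually (Metric.ball_mem_nhds φ₂ hδ₂))).and (hO.mem_nhds hw'O))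
  refine ⟨Metric.ball φ₁ δ₁, Metric.ball φ₂ δ₂, Oa, Ow, Φ₁ ∪ Φ₂, φ₁, φ₂, Metric.isOpen_ball,
    Metric.isOpen_ball, fun φ hφ τ hτ => ?_, fun φ hφ τ hτ => ?_, hOao, ⟨a', haOa⟩, hOwo,
    ⟨w', hwOw⟩, fun x hx => (hOa x hx).2, fun x hx => (hOw x hx).2, fun a ha w hw =>
    ⟨hP (hOa a ha).1 (hOw w hw).1.1, (hOw w hw).1.2⟩⟩
  · exact (hΦ₁ φ (mem_ball_iff_norm.1 hφ) τ hτ).mono Finset.subset_union_left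
  · exact (hΦ₂ φ (mem_ball_iff_norm.1 hφ) τ hτ).mono Finset.subset_union_right

end Base

section Letters

variable {n : ℕ} {B₁ B₂ : Set (Submodule ℝ (Fin n → ℝ))} {S : Set (SLZ n)} {F : Set (Fin n → ℝ)}

/-- The element moving `letterVec` to the attracting vector of a letter. -/
def letterL (g β₁ β₂ : SLZ n) : Option (Bool × Bool) × Bool → SLZ n
  | (some (false, _), true) => β₁
  | (some (true, _), true) => β₂
  | (some _, false) => 1
  | (none, _) => g * β₁ * (g⁻¹ * β₂)

/-- The element moving `letterForm` to the repelling form of a letter. -/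
def letterR (g β₁ β₂ : SLZ n) : Option (Bool × Bool) × Bool → SLZ n
  | (some _, true) => 1
  | (some (false, _), false) => β₁⁻¹
  | (some (true, _), false) => β₂⁻¹
  | (none, _) => (g * β₁)⁻¹

/-- The vector attached to a letter. -/
def letterVec (a w : Bool → Fin n → ℝ) : Option (Bool × Bool) × Bool → Fin n → ℝ
  | (some (false, σ), _) => a σ
  | (some (true, σ), _) => w σ
  | (none, s) => w (!s)

/-- The linear form attached to a letter. -/
def letterForm (f₁ f₂ : Bool → Fin n → ℝ) : Option (Bool × Bool) × Bool → Fin n → ℝ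
  | (some (false, σ), _) => f₁ σ
  | (some (true, σ), _) => f₂ σ
  | (none, s) => f₁ s

end Letters

section Letters

variable {n : ℕ} {B₁ B₂ : Set (Submodule ℝ (Fin n → ℝ))} {S : Set (SLZ n)} {F : Set (Fin n → ℝ)}

lemma IsState.letter_ne_zero (hst : IsState B₁ B₂ S F) {g β₁ β₂ : SLZ n} (hx : GenPos S g β₁ β₂)
    {J : Finset (SLZ n)} {a w f₁ f₂ : Bool → Fin n → ℝ}
    (h₁a : ∀ γ ∈ J, ∀ σ τ, γ ∉ Subgroup.center (SLZ n) ∨ σ ≠ τ → f₁ σ ⬝ᵥ av γ (a τ) ≠ 0)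
    (h₁w : ∀ γ ∈ J, ∀ σ τ, (g⁻¹ * β₂)⁻¹ * γ ∉ Subgroup.center (SLZ n) ∨ σ ≠ τ →
      f₁ σ ⬝ᵥ av γ (w τ) ≠ 0)
    (h₂a : ∀ γ ∈ J, ∀ σ τ, f₂ σ ⬝ᵥ av γ (a τ) ≠ 0)
    (h₂w : ∀ γ ∈ J, ∀ σ τ, γ ∉ Subgroup.center (SLZ n) ∨ σ ≠ τ → f₂ σ ⬝ᵥ av γ (w τ) ≠ 0)
    (x y : Option (Bool × Bool) × Bool) {h : SLZ n} (hh : h ∈ Subgroup.closure S)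
    (hxy : h = 1 → y ≠ flip2 x) (hJ : letterR g β₁ β₂ x * h * letterL g β₁ β₂ y ∈ J) :
    letterForm f₁ f₂ x ⬝ᵥ av (letterR g β₁ β₂ x * h * letterL g β₁ β₂ y) (letterVec a w y) ≠ 0 := by
  have key {u v : SLZ n} (hvu : v * u ∉ cl S) : u * h * v ∉ Subgroup.center (SLZ n) :=
    fun hc => hvu (mul_mem_cl_of_mem_center hh hc)
  have key1 {u v : SLZ n} (hvu : v * u = 1) (h1 : h ≠ 1) :
      u * h * v ∉ Subgroup.center (SLZ n) := fun hc => h1 <| hst.eq_one_of_mem_center hh <| by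
    have := mul_comm_mem_center (a := u) (b := h * v) (by rwa [← mul_assoc])
    rwa [mul_assoc, hvu, mul_one] at this
  have key2 {k u v : SLZ n} (hvu : v * (k * u) ∉ cl S) :
      k * (u * h * v) ∉ Subgroup.center (SLZ n) := by
    have := key hvu; rwa [mul_assoc k, mul_assoc k] at this
  have key3 {k u v : SLZ n} (hvu : v * (k * u) = 1) (h1 : h ≠ 1) :
      k * (u * h * v) ∉ Subgroup.center (SLZ n) := by
    have := key1 hvu h1; rwa [mul_assoc k, mul_assoc k] at this
  have hinv {z : SLZ n} (hz : z ∉ cl S) : z⁻¹ ∉ cl S := fun h' => hz (by simpa using inv_mem h')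
  have flipσ {σ τ : Bool} {P : Prop} (hP : σ = τ → P) : P ∨ σ ≠ τ := by
    by_cases h' : σ = τ
    exacts [Or.inl (hP h'), Or.inr h']
  obtain ⟨g1, g2, g3, g4, g5, g6, g7, g8, g9⟩ := hx
  have hz {u v : SLZ n} (huv : u = v) (hv : v ∉ cl S) : u ∉ cl S := huv ▸ hv
  rcases x with ⟨_ | ⟨_ | _, σ⟩, s⟩
  · rcases y with ⟨_ | ⟨_ | _, τ⟩, r⟩
    · refine h₁w _ hJ s (!r) (flipσ fun e => key3 ?_ fun h1 => hxy h1 ?_)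
      · simp [letterL, letterR, mul_assoc]
      · rw [e]; simp [flip2]
    · refine h₁a _ hJ s τ (Or.inl (key ?_))
      cases r
      · exact hz (by simp [letterL, letterR]) (hinv g4)
      · exact hz (by simp [letterL, letterR]) (hinv g1)
    · refine h₁w _ hJ s τ (Or.inl (key2 ?_))
      cases r
      · exact hz (by simp [letterL, letterR, mul_assoc]) (hinv g8)
      · exact hz (by simp [letterL, letterR, mul_assoc]) (hinv g9)
  · rcases y with ⟨_ | ⟨_ | _, τ⟩, r⟩
    · refine h₁w _ hJ σ (!r) (Or.inl (key2 ?_))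
      cases s
      · exact hz (by simp [letterL, letterR, mul_assoc]) g1
      · exact hz (by simp [letterL, letterR, mul_assoc]) g4
    · refine h₁a _ hJ σ τ ?_
      cases s <;> cases r
      · exact Or.inl (key (hz (by simp [letterL, letterR]) (hinv g2)))
      · refine flipσ fun e => key1 ?_ fun h1 => hxy h1 ?_
        · simp [letterL, letterR]
        · rw [e]; rfl
      · refine flipσ fun e => key1 ?_ fun h1 => hxy h1 ?_
        · simp [letterL, letterR]
        · rw [e]; rfl
      · exact Or.inl (key (hz (by simp [letterL, letterR]) g2))
    · refine h₁w _ hJ σ τ (Or.inl (key2 ?_))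
      cases s <;> cases r
      · exact hz (by simp [letterL, letterR]) g7
      · exact hz (by simp [letterL, letterR, mul_assoc]) g5
      · exact hz (by simp [letterL, letterR]) g6
      · exact hz (by simp [letterL, letterR]) g1
  · rcases y with ⟨_ | ⟨_ | _, τ⟩, r⟩
    · refine h₂w _ hJ σ (!r) (Or.inl (key ?_))
      cases s
      · exact hz (by simp [letterL, letterR, mul_assoc]) g9
      · exact hz (by simp [letterL, letterR, mul_assoc]) g8
    · exact h₂a _ hJ σ τ
    · refine h₂w _ hJ σ τ ?_
      cases s <;> cases r
      · exact Or.inl (key (hz (by simp [letterL, letterR]) (hinv g3)))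
      · refine flipσ fun e => key1 ?_ fun h1 => hxy h1 ?_
        · simp [letterL, letterR]
        · rw [e]; rfl
      · refine flipσ fun e => key1 ?_ fun h1 => hxy h1 ?_
        · simp [letterL, letterR]
        · rw [e]; rfl
      · exact Or.inl (key (hz (by simp [letterL, letterR]) g3))

end Letters

section Letters

variable {n : ℕ} {B₁ B₂ : Set (Submodule ℝ (Fin n → ℝ))} {S : Set (SLZ n)} {F : Set (Fin n → ℝ)}

/-- Vectors and forms in general position defining the letters that add `t` to the group. -/
structure Letters (S : Set (SLZ n)) (F : Set (Fin n → ℝ)) (g β₁ β₂ t : SLZ n)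
    (a w f₁ f₂ : Bool → Fin n → ℝ) : Prop where
  rat_a : ∀ σ, IsRat (a σ)
  rat_w : ∀ σ, IsRat (w σ)
  rat_f₁ : ∀ σ, IsRat (f₁ σ)
  rat_f₂ : ∀ σ, IsRat (f₂ σ)
  mem : ∀ x, av (letterL g β₁ β₂ x) (letterVec a w x) ∈ F
  dot_a : ∀ σ, f₁ σ ⬝ᵥ a σ = 0
  dot_κw : ∀ σ, f₁ σ ⬝ᵥ av (g⁻¹ * β₂) (w σ) = 0
  dot_w : ∀ σ, f₂ σ ⬝ᵥ w σ = 0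
  away : ∀ x, Away (Subgroup.closure S) F (letterForm f₁ f₂ x ᵥ* matR (letterR g β₁ β₂ x))
  ne_zero : ∀ x y, ∀ h ∈ Subgroup.closure S, (h = 1 → y ≠ flip2 x) →
    (letterForm f₁ f₂ x ᵥ* matR (letterR g β₁ β₂ x)) ⬝ᵥ
      av h (av (letterL g β₁ β₂ y) (letterVec a w y)) ≠ 0
  dot_tw : ∀ σ, f₂ σ ⬝ᵥ av t (w (!σ)) ≠ 0
  dot_tw_inv : ∀ σ, f₂ σ ⬝ᵥ av t⁻¹ (w (!σ)) ≠ 0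
  dot_κa : ∀ σ, f₂ σ ⬝ᵥ av (g⁻¹ * β₂)⁻¹ (a σ) ≠ 0

theorem IsState.exists_letters (hn : 3 ≤ n) (hst : IsState B₁ B₂ S F) {g : SLZ n} (hg : g ∉ cl S)
    (t : SLZ n) : ∃ β₁ β₂ a w f₁ f₂, Letters S F g β₁ β₂ t a w f₁ f₂ := by
  classical
  obtain ⟨q, hqF, β₁, β₂, hqI, hβ₁, hβ₂, hβg, haux⟩ := hst.exists_genPos hn hg
  set κ := g⁻¹ * β₂ with hκ
  have hκq : av κ q = av g⁻¹ q := by rw [hκ, av_mul, hβ₂]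
  have hcq : av (g * β₁ * κ) q = q := by rw [av_mul, hκq, av_mul, hβg, av_av_inv]
  have hq0 : q ≠ 0 := hst.ne_zero q hqF
  have hpr : prj q (av κ q) ≠ 0 := by
    obtain ⟨f, hfq, -, hf⟩ := hqI
    intro h
    apply hf
    rw [← hκq, ← dot_prj_of_dot_eq_zero hfq, h, dotProduct_zero]
  have ht : Tendsto (fun z : (Fin n → ℝ) × (Fin n → ℝ) => prj z.1 (av κ z.2)) (𝓝 q ×ˢ 𝓝 q)
      (𝓝 (prj q (av κ q))) :=
    tendsto_prj hq0 tendsto_fst (((continuous_av κ).tendsto _).comp tendsto_snd)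
  obtain ⟨Pa, hPa, Pw, hPw, hP⟩ := eventually_prod_iff.1 (ht.eventually_ne hpr)
  have hmem (γ : SLZ n) (hγ : av γ q = q) : ∀ᶠ x in 𝓝 q, av γ x ∈ F :=
    (continuous_av γ).continuousAt.eventually (by rw [hγ]; exact hst.isOpen.mem_nhds hqF)
  have hFev : ∀ᶠ x in 𝓝 q, x ∈ F := hst.isOpen.mem_nhds hqF
  obtain ⟨O, hO, hOo, hqO⟩ := eventually_nhds_iff.1 ((hPa.and hPw).and
    (hFev.and ((hmem β₁ hβ₁).and ((hmem β₂ hβ₂).and (hmem _ hcq)))))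
  obtain ⟨O₁, O₂, Oa, Ow, Φ, φ₁, φ₂, hO₁, hO₂, haw₁, haw₂, hOa, hOa', hOw, hOw', hOaO, hOwO, hpj⟩ :=
    hst.exists_base hn (κ := κ) hOo hqO (fun x hx => hst.ne_zero x (hO x hx).2.1)
      (fun a ha w hw => hP (hO a ha).1.1 (hO w hw).1.2)
      (Finset.univ.image (letterR g β₁ β₂))
  let J : Finset (SLZ n) := (Finset.univ ×ˢ Finset.univ ×ˢ Φ).image
    (fun z => letterR g β₁ β₂ z.1 * z.2.2 * letterL g β₁ β₂ z.2.1) ∪ {t, t⁻¹, κ⁻¹}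
  have hJ (x y h) (hh : h ∈ Φ) : letterR g β₁ β₂ x * h * letterL g β₁ β₂ y ∈ J :=
    Finset.mem_union_left _ (Finset.mem_image.2 ⟨(x, y, h), by simp [hh], rfl⟩)
  have ht : t ∈ J := Finset.mem_union_right _ (by simp)
  have ht' : t⁻¹ ∈ J := Finset.mem_union_right _ (by simp)
  have hκJ : κ⁻¹ ∈ J := Finset.mem_union_right _ (by simp)
  obtain ⟨a, w, ha, hw, hind⟩ := exists_vectors hn J κ hOa hOa' hOw hOw'
    (fun x hx => hst.ne_zero x (hO x (hOwO hx)).2.1)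
  let Y : Finset (Fin n → ℝ) := (J ×ˢ Finset.univ).image (fun z => av z.1 (a z.2)) ∪
    (J ×ˢ Finset.univ).image (fun z => av z.1 (w z.2))
  have hYa (γ) (hγ : γ ∈ J) (τ) : av γ (a τ) ∈ Y :=
    Finset.mem_union_left _ (Finset.mem_image.2 ⟨(γ, τ), by simp [hγ], rfl⟩)
  have hYw (γ) (hγ : γ ∈ J) (τ) : av γ (w τ) ∈ Y :=
    Finset.mem_union_right _ (Finset.mem_image.2 ⟨(γ, τ), by simp [hγ], rfl⟩)
  choose f₁ hf₁O hf₁r hf₁a hf₁w hf₁ using fun σ =>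
    exists_form_near (ha σ).2 ((hw σ).2.av κ) hO₁ (hpj _ (ha σ).1 _ (hw σ).1).1 Y
  choose f₂ hf₂O hf₂r hf₂w _hf₂0 hf₂ using fun σ =>
    exists_form_near (hw σ).2 isRat_zero hO₂ (hpj _ (ha σ).1 _ (hw σ).1).2 Y
  have hmem (x) : av (letterL g β₁ β₂ x) (letterVec a w x) ∈ F := by
    have haF (σ) := (hO _ (hOaO (ha σ).1)).2
    have hwF (σ) := (hO _ (hOwO (hw σ).1)).2
    rcases x with ⟨_ | ⟨_ | _, σ⟩, _ | _⟩
    · exact (hwF _).2.2.2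
    · exact (hwF _).2.2.2
    · simpa [letterL, letterVec] using (haF σ).1
    · exact (haF σ).2.1
    · simpa [letterL, letterVec] using (hwF σ).1
    · exact (hwF σ).2.2.1
  have haway (x) : AwayOff (Subgroup.closure S) Φ F
      (letterForm f₁ f₂ x ᵥ* matR (letterR g β₁ β₂ x)) := by
    have hx : letterR g β₁ β₂ x ∈ Finset.univ.image (letterR g β₁ β₂) :=
      Finset.mem_image_of_mem _ (Finset.mem_univ _)
    rcases x with ⟨_ | ⟨_ | _, σ⟩, s⟩
    · exact haw₁ _ (hf₁O s) _ hx
    · exact haw₁ _ (hf₁O σ) _ hx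
    · exact haw₂ _ (hf₂O σ) _ hx
  refine ⟨β₁, β₂, a, w, f₁, f₂, fun σ => (ha σ).2, fun σ => (hw σ).2, hf₁r, hf₂r, hmem, hf₁a, hf₁w,
    hf₂w, fun x => (haway x).away, fun x y h hh hxy => ?_,
    fun σ => hf₂ σ _ (hYw _ ht _) ((hind _ ht σ (!σ)).1 (by simp)),
    fun σ => hf₂ σ _ (hYw _ ht' _) ((hind _ ht' σ (!σ)).1 (by simp)),
    fun σ => hf₂ σ _ (hYa _ hκJ _) (hind _ hκJ σ σ).2.1⟩
  by_cases hΦ : h ∈ Φ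
  · have := hst.letter_ne_zero haux (J := J) (a := a) (w := w) (f₁ := f₁) (f₂ := f₂)
      (fun γ hγ σ τ h' => hf₁ σ _ (hYa _ hγ _) ((hind _ hγ σ τ).2.2.1 h'))
      (fun γ hγ σ τ h' => hf₁ σ _ (hYw _ hγ _) ((hind _ hγ σ τ).2.2.2 h'))
      (fun γ hγ σ τ => hf₂ σ _ (hYa _ hγ _) (hind _ hγ σ τ).2.1)
      (fun γ hγ σ τ h' => hf₂ σ _ (hYw _ hγ _) ((hind _ hγ σ τ).1 h')) x y hh hxy (hJ x y h hΦ)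
    rwa [av_mul, av_mul, dot_av] at this
  · obtain ⟨k, hk, hkx⟩ := haway x
    have h1 := hkx h hh hΦ _ (hmem y)
    have h2 : 0 < k * ‖av h (av (letterL g β₁ β₂ y) (letterVec a w y))‖ :=
      mul_pos hk (norm_pos_iff.2 (av_ne_zero (hst.ne_zero _ (hmem y))))
    exact abs_pos.1 (h2.trans_le h1)

end Letters

section Limits

variable {n : ℕ}

lemma tendsto_linear {M : Type*} [AddCommGroup M] [Module ℝ M] [TopologicalSpace M]
    [IsTopologicalAddGroup M] [ContinuousSMul ℝ M] (C E : M) :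
    Tendsto (fun N : ℕ => (N : ℝ)⁻¹ • (C + (N : ℝ) • E)) atTop (𝓝 E) := by
  have h0 : Tendsto (fun N : ℕ => (N : ℝ)⁻¹) atTop (𝓝 0) :=
    tendsto_inv_atTop_zero.comp tendsto_natCast_atTop_atTop
  have h1 : Tendsto (fun N : ℕ => (N : ℝ)⁻¹ • C + E) atTop (𝓝 E) := by
    simpa using (h0.smul_const C).add_const E
  refine h1.congr' ?_
  filter_upwards [eventually_gt_atTop 0] with N hN
  have : (N : ℝ) ≠ 0 := by positivity
  rw [smul_add, smul_smul, inv_mul_cancel₀ this, one_smul]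

lemma tendsto_quadratic {M : Type*} [AddCommGroup M] [Module ℝ M] [TopologicalSpace M]
    [IsTopologicalAddGroup M] [ContinuousSMul ℝ M] (C X E : M) :
    Tendsto (fun N : ℕ => ((N : ℝ) ^ 2)⁻¹ • (C + (N : ℝ) • X + (N : ℝ) ^ 2 • E)) atTop (𝓝 E) := by
  have h0 : Tendsto (fun N : ℕ => (N : ℝ)⁻¹) atTop (𝓝 0) :=
    tendsto_inv_atTop_zero.comp tendsto_natCast_atTop_atTop
  have h1 : Tendsto (fun N : ℕ => (N : ℝ)⁻¹ • ((N : ℝ)⁻¹ • (C + (N : ℝ) • X)) + E) atTop (𝓝 E) := by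
    simpa using (h0.smul (tendsto_linear C X)).add_const E
  refine h1.congr' ?_
  filter_upwards [eventually_gt_atTop 0] with N hN
  have : (N : ℝ) ^ 2 ≠ 0 := by positivity
  rw [smul_add _ _ (_ • E), smul_smul _ _ E, inv_mul_cancel₀ this, one_smul, smul_smul, sq, mul_inv]

lemma tendsto_cubic {M : Type*} [AddCommGroup M] [Module ℝ M] [TopologicalSpace M]
    [IsTopologicalAddGroup M] [ContinuousSMul ℝ M] (C X Y E : M) :
    Tendsto (fun N : ℕ => ((N : ℝ) ^ 3)⁻¹ • (C + (N : ℝ) • X + (N : ℝ) ^ 2 • Y + (N : ℝ) ^ 3 • E))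
      atTop (𝓝 E) := by
  have h0 : Tendsto (fun N : ℕ => (N : ℝ)⁻¹) atTop (𝓝 0) :=
    tendsto_inv_atTop_zero.comp tendsto_natCast_atTop_atTop
  have h1 : Tendsto (fun N : ℕ => (N : ℝ)⁻¹ • (((N : ℝ) ^ 2)⁻¹ •
      (C + (N : ℝ) • X + (N : ℝ) ^ 2 • Y)) + E) atTop (𝓝 E) := by
    simpa using (h0.smul (tendsto_quadratic C X Y)).add_const E
  refine h1.congr' ?_
  filter_upwards [eventually_gt_atTop 0] with N hN
  have : (N : ℝ) ^ 3 ≠ 0 := by positivity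
  rw [smul_add _ _ (_ • E), smul_smul _ _ E, inv_mul_cancel₀ this, one_smul, smul_smul,
    pow_succ' _ 2,
    mul_inv]

variable {a w f₁ f₂ : Fin n → ℝ} {g β₁ β₂ : SLZ n} {D₁ D₂ : ℝ} {T₁ T₂ : ℤ → SLZ n}

/-- The product of transvections used to build the letters. -/
def bigLetter (g β₁ β₂ : SLZ n) (T₁ T₂ : ℤ → SLZ n) (N : ℕ) : SLZ n :=
  g * (β₁ * T₁ N) * g⁻¹ * (β₂ * T₂ (N ^ 2 : ℕ))

lemma tendsto_bigLetter (hκ : f₁ ⬝ᵥ av (g⁻¹ * β₂) w = 0)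
    (hT₁ : ∀ k : ℤ, matR (T₁ k) = 1 + ((k : ℝ) * D₁) • vecMulVec a f₁)
    (hT₂ : ∀ k : ℤ, matR (T₂ k) = 1 + ((k : ℝ) * D₂) • vecMulVec w f₂) :
    Tendsto (fun N : ℕ => ((N : ℝ) ^ 2)⁻¹ • matR (bigLetter g β₁ β₂ T₁ T₂ N)) atTop
      (𝓝 (D₂ • vecMulVec (av (g * β₁ * (g⁻¹ * β₂)) w) f₂)) := by
  have hY (N : ℕ) : bigLetter g β₁ β₂ T₁ T₂ N
      = (g * β₁) * T₁ N * (g⁻¹ * β₂) * T₂ (N ^ 2 : ℕ) := by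
    simp [bigLetter, mul_assoc]
  refine (tendsto_quadratic (matR (g * β₁) * matR (g⁻¹ * β₂))
    (D₁ • (matR (g * β₁) * (vecMulVec a f₁ * matR (g⁻¹ * β₂)))) _).congr fun N => ?_
  congr 1
  have h0 : matR (g * β₁) * (vecMulVec a f₁ * (matR (g⁻¹ * β₂) * vecMulVec w f₂)) = 0 := by
    rw [mul_vecMulVec, ← av_apply, vecMulVec_mul_vecMulVec, hκ]; simp
  have h1 : vecMulVec (av (g * β₁ * (g⁻¹ * β₂)) w) f₂
      = matR (g * β₁) * (matR (g⁻¹ * β₂) * vecMulVec w f₂) := by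
    rw [av_apply, ← mul_vecMulVec, matR_mul, Matrix.mul_assoc]
  rw [hY, matR_mul _ (T₂ _), matR_mul _ (g⁻¹ * β₂), matR_mul _ (T₁ _), hT₁, hT₂, h1]
  simp only [mul_add, add_mul, mul_one, smul_mul_assoc, mul_smul_comm, Matrix.mul_assoc, h0]
  push_cast
  module

lemma tendsto_bigLetter_inv (ha : f₁ ⬝ᵥ a = 0) (hw : f₂ ⬝ᵥ w = 0)
    (hT₁ : ∀ k : ℤ, matR (T₁ k) = 1 + ((k : ℝ) * D₁) • vecMulVec a f₁)
    (hT₂ : ∀ k : ℤ, matR (T₂ k) = 1 + ((k : ℝ) * D₂) • vecMulVec w f₂) :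
    Tendsto (fun N : ℕ => ((N : ℝ) ^ 3)⁻¹ • matR (bigLetter g β₁ β₂ T₁ T₂ N)⁻¹) atTop
      (𝓝 ((D₁ * D₂ * (f₂ ⬝ᵥ av (g⁻¹ * β₂)⁻¹ a)) • vecMulVec w (f₁ ᵥ* matR (g * β₁)⁻¹))) := by
  have hY (N : ℕ) : (bigLetter g β₁ β₂ T₁ T₂ N)⁻¹
      = T₂ (-(N ^ 2 : ℕ)) * ((g⁻¹ * β₂)⁻¹ * (T₁ (-N) * (g * β₁)⁻¹)) := by
    rw [← trans_inv ha hT₁, ← trans_inv hw hT₂]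
    simp [bigLetter, mul_assoc]
  set K := matR (g⁻¹ * β₂)⁻¹ with hK
  set P := matR (g * β₁)⁻¹ with hP
  refine (tendsto_cubic (K * P) (-D₁ • (K * (vecMulVec a f₁ * P)))
    (-D₂ • (vecMulVec w f₂ * (K * P))) _).congr fun N => ?_
  congr 1
  have h1 : vecMulVec w f₂ * (K * (vecMulVec a f₁ * P))
      = (f₂ ⬝ᵥ av (g⁻¹ * β₂)⁻¹ a) • vecMulVec w (f₁ ᵥ* P) := by
    rw [vecMulVec_mul a f₁ P, mul_vecMulVec K, ← av_apply, vecMulVec_mul_vecMulVec]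
    simp [vecMulVec_smul]
  rw [hY, matR_mul, matR_mul, matR_mul, hT₁, hT₂, ← hK, ← hP]
  simp only [mul_add, add_mul, one_mul, smul_mul_assoc, mul_smul_comm, h1]
  push_cast
  module

end Limits

section Step

variable {n : ℕ} {B₁ B₂ : Set (Submodule ℝ (Fin n → ℝ))} {S : Set (SLZ n)} {F : Set (Fin n → ℝ)}

lemma tendsto_mul_trans {a f : Fin n → ℝ} {D : ℝ} (hD : 0 < D) {T : ℤ → SLZ n}
    (hT : ∀ k : ℤ, matR (T k) = 1 + ((k : ℝ) * D) • vecMulVec a f) (β : SLZ n) {m : ℕ → ℕ}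
    (hm : Tendsto m atTop atTop) :
    Tendsto (fun N => ((m N : ℝ) * D)⁻¹ • matR (β * T (m N))) atTop
      (𝓝 (vecMulVec (av β a) f)) := by
  have h := ((tendsto_linear (matR β) (D • vecMulVec (av β a) f)).comp hm).const_smul D⁻¹
  rw [smul_smul, inv_mul_cancel₀ hD.ne', one_smul] at h
  refine h.congr fun N => ?_
  rw [Function.comp_apply, smul_smul, mul_inv, mul_comm D⁻¹, matR_mul, hT, av_apply,
    ← mul_vecMulVec]
  simp only [mul_add, mul_one, mul_smul_comm, Int.cast_natCast, mul_smul]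

lemma tendsto_trans_inv {a f : Fin n → ℝ} {D : ℝ} (hD : 0 < D) (h0 : f ⬝ᵥ a = 0) {T : ℤ → SLZ n}
    (hT : ∀ k : ℤ, matR (T k) = 1 + ((k : ℝ) * D) • vecMulVec a f) (β : SLZ n) {m : ℕ → ℕ}
    (hm : Tendsto m atTop atTop) :
    Tendsto (fun N => (-((m N : ℝ) * D)⁻¹) • matR (β * T (m N))⁻¹) atTop
      (𝓝 (vecMulVec a (f ᵥ* matR β⁻¹))) := by
  have h := ((tendsto_linear (matR β⁻¹) (-D • vecMulVec a (f ᵥ* matR β⁻¹))).comp hm).const_smul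
    (-D⁻¹)
  rw [smul_smul, neg_mul_neg, inv_mul_cancel₀ hD.ne', one_smul] at h
  refine h.congr fun N => ?_
  rw [Function.comp_apply, smul_smul, mul_inv, neg_mul, mul_comm D⁻¹, _root_.mul_inv_rev,
    trans_inv h0 hT,
    matR_mul, hT, ← vecMulVec_mul]
  simp only [add_mul, one_mul, smul_mul_assoc, Int.cast_neg, Int.cast_natCast, mul_smul, neg_smul,
    smul_neg, neg_mul]

/-- The letters added to the free generating set. -/
def stepLetter (g β₁ β₂ t : SLZ n) (T₁ T₂ : Bool → ℤ → SLZ n) (N : ℕ) :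
    Option (Bool × Bool) × Bool → SLZ n
  | (some (false, σ), true) => β₁ * T₁ σ N
  | (some (false, σ), false) => (β₁ * T₁ σ N)⁻¹
  | (some (true, σ), true) => β₂ * T₂ σ (N ^ 2 : ℕ)
  | (some (true, σ), false) => (β₂ * T₂ σ (N ^ 2 : ℕ))⁻¹
  | (none, s) => bigLetter g β₁ β₂ (T₁ !s) (T₂ !s) N * cond s t t⁻¹ *
      (bigLetter g β₁ β₂ (T₁ s) (T₂ s) N)⁻¹

lemma stepLetter_flip2 (g β₁ β₂ t : SLZ n) (T₁ T₂ : Bool → ℤ → SLZ n) (N : ℕ)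
    (x : Option (Bool × Bool) × Bool) :
    stepLetter g β₁ β₂ t T₁ T₂ N (flip2 x) = (stepLetter g β₁ β₂ t T₁ T₂ N x)⁻¹ := by
  rcases x with ⟨_ | ⟨_ | _, σ⟩, _ | _⟩ <;> simp [stepLetter, flip2, mul_assoc]

lemma mem_closure_of_stepLetter (g β₁ β₂ t : SLZ n) (T₁ T₂ : Bool → ℤ → SLZ n) (N : ℕ)
    {H : Subgroup (SLZ n)} (hg : g ∈ H) (hH : ∀ i, stepLetter g β₁ β₂ t T₁ T₂ N (i, true) ∈ H) :
    t ∈ H := by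
  have hY (σ) : bigLetter g β₁ β₂ (T₁ σ) (T₂ σ) N ∈ H :=
    mul_mem (mul_mem (mul_mem hg (hH (some (false, σ)))) (inv_mem hg)) (hH (some (true, σ)))
  have h := mul_mem (mul_mem (inv_mem (hY false)) (hH none)) (hY true)
  simpa [stepLetter, mul_assoc] using h

lemma Letters.dot_cond {g β₁ β₂ t : SLZ n} {a w f₁ f₂ : Bool → Fin n → ℝ}
    (hL : Letters S F g β₁ β₂ t a w f₁ f₂) (s : Bool) :
    f₂ (!s) ⬝ᵥ av (cond s t t⁻¹) (w s) ≠ 0 := by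
  cases s
  · exact hL.dot_tw_inv true
  · exact hL.dot_tw false

lemma Letters.dot_flip2 {g β₁ β₂ t : SLZ n} {a w f₁ f₂ : Bool → Fin n → ℝ}
    (hL : Letters S F g β₁ β₂ t a w f₁ f₂) (x : Option (Bool × Bool) × Bool) :
    (letterForm f₁ f₂ (flip2 x) ᵥ* matR (letterR g β₁ β₂ (flip2 x))) ⬝ᵥ
      av (letterL g β₁ β₂ x) (letterVec a w x) = 0 := by
  rw [← dot_av, ← av_mul]
  rcases x with ⟨_ | ⟨_ | _, σ⟩, _ | _⟩ <;>
    simp [letterForm, letterR, letterL, letterVec, flip2, hL.dot_a, hL.dot_w, hL.dot_κw, mul_assoc]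

lemma Letters.exists_tendsto {g β₁ β₂ t : SLZ n} {a w f₁ f₂ : Bool → Fin n → ℝ}
    (hL : Letters S F g β₁ β₂ t a w f₁ f₂) {D₁ D₂ : Bool → ℝ} (hD₁ : ∀ σ, 0 < D₁ σ)
    (hD₂ : ∀ σ, 0 < D₂ σ) {T₁ T₂ : Bool → ℤ → SLZ n}
    (hT₁ : ∀ σ (k : ℤ), matR (T₁ σ k) = 1 + ((k : ℝ) * D₁ σ) • vecMulVec (a σ) (f₁ σ))
    (hT₂ : ∀ σ (k : ℤ), matR (T₂ σ k) = 1 + ((k : ℝ) * D₂ σ) • vecMulVec (w σ) (f₂ σ))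
    (x : Option (Bool × Bool) × Bool) :
    ∃ r : ℕ → ℝ, Tendsto (fun N => r N • matR (stepLetter g β₁ β₂ t T₁ T₂ N x)) atTop
      (𝓝 (vecMulVec (av (letterL g β₁ β₂ x) (letterVec a w x))
        (letterForm f₁ f₂ x ᵥ* matR (letterR g β₁ β₂ x)))) := by
  have hsq : Tendsto (fun N : ℕ => N ^ 2) atTop atTop := tendsto_pow_atTop two_ne_zero
  rcases x with ⟨_ | ⟨_ | _, σ⟩, s⟩
  · have h1 := tendsto_bigLetter (g := g) (β₁ := β₁) (hL.dot_κw !s) (hT₁ !s) (hT₂ !s)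
    have h2 := tendsto_bigLetter_inv (g := g) (β₁ := β₁) (β₂ := β₂) (hL.dot_a s) (hL.dot_w s)
      (hT₁ s) (hT₂ s)
    set c := D₂ (!s) * (f₂ (!s) ⬝ᵥ av (cond s t t⁻¹) (w s)) *
      (D₁ s * D₂ s * (f₂ s ⬝ᵥ av (g⁻¹ * β₂)⁻¹ (a s))) with hc
    have hc0 : c ≠ 0 := mul_ne_zero (mul_ne_zero (hD₂ _).ne' (hL.dot_cond s))
      (mul_ne_zero (mul_ne_zero (hD₁ _).ne' (hD₂ _).ne') (hL.dot_κa s))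
    have h := ((h1.mul_const (matR (cond s t t⁻¹))).mul h2).const_smul c⁻¹
    refine ⟨fun N => c⁻¹ * (((N : ℝ) ^ 2)⁻¹ * ((N : ℝ) ^ 3)⁻¹), ?_⟩
    convert h using 1
    · funext N
      simp only [stepLetter, matR_mul, smul_mul_assoc, mul_smul_comm, mul_smul]
      rw [smul_comm ((N : ℝ) ^ 2)⁻¹]
    · congr 1
      rw [smul_mul_assoc, smul_mul_assoc, mul_smul_comm, Matrix.mul_assoc, mul_vecMulVec,
        ← av_apply, vecMulVec_mul_vecMulVec]
      simp only [vecMulVec_smul, smul_smul]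
      have : c⁻¹ * (D₂ (!s) * (D₁ s * D₂ s * (f₂ s ⬝ᵥ av (g⁻¹ * β₂)⁻¹ (a s)) *
          (f₂ (!s) ⬝ᵥ av (cond s t t⁻¹) (w s)))) = 1 := by
        rw [inv_mul_eq_one₀ hc0, hc]; ring
      simp only [letterL, letterVec, letterForm, letterR, ← mul_assoc] at this ⊢
      rw [this, one_smul]
  · cases s
    · refine ⟨fun N => -((N : ℝ) * D₁ σ)⁻¹, ?_⟩
      simpa [letterL, letterVec, letterForm, letterR, stepLetter, matR_one] using
        tendsto_trans_inv (hD₁ σ) (hL.dot_a σ) (hT₁ σ) β₁ tendsto_id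
    · refine ⟨fun N => ((N : ℝ) * D₁ σ)⁻¹, ?_⟩
      simpa [letterL, letterVec, letterForm, letterR, stepLetter, matR_one] using
        tendsto_mul_trans (hD₁ σ) (hT₁ σ) β₁ tendsto_id
  · cases s
    · refine ⟨fun N => -(((N ^ 2 : ℕ) : ℝ) * D₂ σ)⁻¹, ?_⟩
      simpa [letterL, letterVec, letterForm, letterR, stepLetter, matR_one] using
        tendsto_trans_inv (hD₂ σ) (hL.dot_w σ) (hT₂ σ) β₂ hsq
    · refine ⟨fun N => (((N ^ 2 : ℕ) : ℝ) * D₂ σ)⁻¹, ?_⟩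
      simpa [letterL, letterVec, letterForm, letterR, stepLetter, matR_one] using
        tendsto_mul_trans (hD₂ σ) (hT₂ σ) β₂ hsq

theorem IsState.exists_generating (hn : 3 ≤ n) (hB : ∀ W ∈ B₁ ∪ B₂, Module.finrank ℝ W = n - 1)
    (hst : IsState B₁ B₂ S F) {g : SLZ n} (hg : g ∉ cl S) (t : SLZ n) :
    ∃ S' F', S ⊆ S' ∧ IsState B₁ B₂ S' F' ∧ t ∈ Subgroup.closure (S' ∪ {g}) := by
  obtain ⟨β₁, β₂, a, w, f₁, f₂, hL⟩ := hst.exists_letters hn hg t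
  choose D₁ hD₁ T₁ hT₁ using fun σ => exists_trans (hL.rat_a σ) (hL.rat_f₁ σ) (hL.dot_a σ)
  choose D₂ hD₂ T₂ hT₂ using fun σ => exists_trans (hL.rat_w σ) (hL.rat_f₂ σ) (hL.dot_w σ)
  choose r hr using hL.exists_tendsto hD₁ hD₂ hT₁ hT₂
  obtain ⟨N, F', hF'⟩ := (hst.extend (by omega) hB (stepLetter_flip2 g β₁ β₂ t T₁ T₂) hL.mem hr
    hL.dot_flip2 hL.away hL.ne_zero).exists
  refine ⟨_, F', Set.subset_union_left, hF',
    mem_closure_of_stepLetter g β₁ β₂ t T₁ T₂ N (Subgroup.subset_closure (Or.inr rfl)) fun i =>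
      Subgroup.subset_closure (Or.inl (Or.inr ⟨i, rfl⟩))⟩

end Step

section Union

lemma exists_freeGroup_map_eq {G : Type*} {S : ℕ → Set G} (hS : Monotone S)
    (x : FreeGroup (⋃ k, S k : Set G)) :
    ∃ k, ∀ j, k ≤ j → ∃ y : FreeGroup (S j),
      FreeGroup.map (Set.inclusion (Set.subset_iUnion S j)) y = x := by
  induction x using FreeGroup.induction_on with
  | C1 => exact ⟨0, fun j _ => ⟨1, map_one _⟩⟩
  | of x =>
    obtain ⟨k, hk⟩ := Set.mem_iUnion.1 x.2
    exact ⟨k, fun j hj => ⟨FreeGroup.of ⟨x, hS hj hk⟩, by simp⟩⟩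
  | inv_of x h =>
    obtain ⟨k, hk⟩ := h
    refine ⟨k, fun j hj => ?_⟩
    obtain ⟨y, hy⟩ := hk j hj
    exact ⟨y⁻¹, by rw [map_inv, hy]⟩
  | mul x y hx hy =>
    obtain ⟨k, hk⟩ := hx
    obtain ⟨l, hl⟩ := hy
    refine ⟨max k l, fun j hj => ?_⟩
    obtain ⟨x', hx'⟩ := hk j (le_of_max_le_left hj)
    obtain ⟨y', hy'⟩ := hl j (le_of_max_le_right hj)
    exact ⟨x' * y', by rw [map_mul, hx', hy']⟩

lemma injective_freeGroup_lift_iUnion {G : Type*} [Group G] {S : ℕ → Set G} (hS : Monotone S)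
    (h : ∀ k, Function.Injective (FreeGroup.lift ((↑) : S k → G))) :
    Function.Injective (FreeGroup.lift ((↑) : (⋃ k, S k : Set G) → G)) := by
  rw [injective_iff_map_eq_one]
  intro x hx
  obtain ⟨k, hk⟩ := exists_freeGroup_map_eq hS x
  obtain ⟨y, rfl⟩ := hk k le_rfl
  have : FreeGroup.lift ((↑) : S k → G) y = 1 := by
    rw [← hx, ← MonoidHom.comp_apply]
    congr 1
    ext; simp
  rw [(injective_iff_map_eq_one _).1 (h k) y this, map_one]

lemma nonempty_freeGroup_mulEquiv_closure {G : Type*} [Group G] {S : Set G}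
    (h : Function.Injective (FreeGroup.lift ((↑) : S → G))) :
    Nonempty (FreeGroup S ≃* Subgroup.closure S) := by
  have h1 : (FreeGroup.lift ((↑) : S → G)).range = Subgroup.closure S := by
    rw [FreeGroup.range_lift_eq_closure, Subtype.range_coe]
  exact ⟨(MonoidHom.ofInjective h).trans (MulEquiv.subgroupCongr h1)⟩

end Union

section FreeSubgroup

variable {n : ℕ} {B₁ B₂ : Set (Submodule ℝ (Fin n → ℝ))} {S : Set (SLZ n)} {F : Set (Fin n → ℝ)}

lemma isState_empty (hFo : IsOpen F) (hF : F.Nonempty) (hFc : IsCone F) (hF0 : ∀ x ∈ F, x ≠ 0)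
    (hmiss : ∀ W ∈ B₁ ∪ B₂, ∀ w ∈ W, w ∉ F) (hdisj : ∀ W ∈ B₂, W ∉ B₁) :
    IsState B₁ B₂ ∅ F where
  isOpen := hFo
  nonempty := hF
  cone := hFc
  ne_zero := hF0
  free := Function.injective_of_subsingleton _
  move h hh h1 := by simp_all
  tail := by
    refine ⟨lip F 1, fun ε hε => ⟨{1}, by simp, by simp, ?_⟩⟩
    refine Cov.mono ∅ _ 0 ε cov_empty ?_ hε.le
    rintro y ⟨h, hh, h1, -⟩
    simp_all
  miss W hW h hh w hw := by
    rw [Subgroup.closure_empty, Subgroup.mem_bot] at hh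
    simpa [hh] using hmiss W hW w hw
  sep W hW h hh := by
    rw [Subgroup.closure_empty, Subgroup.mem_bot] at hh
    have : W.map (av (1 : SLZ n)) = W := by
      ext; simp [Submodule.mem_map]
    rw [hh, this]
    exact hdisj W hW

lemma map_av_of_mem_center {z : SLZ n} (hz : z ∈ Subgroup.center (SLZ n))
    (W : Submodule ℝ (Fin n → ℝ)) : W.map (av z) = W := by
  obtain ⟨r, hr, h⟩ := exists_scalar_of_mem_center hz
  ext x
  simp only [Submodule.mem_map, h]
  constructor
  · rintro ⟨y, hy, rfl⟩
    exact W.smul_mem r hy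
  · intro hx
    exact ⟨r⁻¹ • x, W.smul_mem _ hx, by rw [smul_smul, mul_inv_cancel₀ hr, one_smul]⟩

lemma IsState.not_mem_cl (hst : IsState B₁ B₂ S F) {g : SLZ n} {W : Submodule ℝ (Fin n → ℝ)}
    (hW : W ∈ B₂) (hgW : W.map (av g) ∈ B₁) : g ∉ cl S := by
  intro hg
  obtain ⟨h, hh, z, hz, rfl⟩ := Subgroup.mem_sup_of_normal_right.1 hg
  refine hst.sep W hW h hh ?_
  have h1 : av (h * z) = (av h).comp (av z) := LinearMap.ext fun x => av_mul h z x
  rwa [h1, Submodule.map_comp, map_av_of_mem_center hz] at hgW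

instance : Countable (SLZ n) :=
  Function.Injective.countable (f := fun (g : SLZ n) i j => g.1 i j) fun _ _ h => Subtype.ext h

theorem IsState.exists_free_subgroup (hn : 3 ≤ n)
    (hB : ∀ W ∈ B₁ ∪ B₂, Module.finrank ℝ W = n - 1) (hst : IsState B₁ B₂ S F) :
    ∃ H : Subgroup (SLZ n), (∃ ι : Type, Nonempty (FreeGroup ι ≃* H)) ∧
      ∀ g, ∀ W ∈ B₂, W.map (av g) ∈ B₁ → Subgroup.closure ((H : Set (SLZ n)) ∪ {g}) = ⊤ := by
  classical
  obtain ⟨e, he⟩ := exists_surjective_nat (SLZ n × SLZ n)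
  have hstep (k : ℕ) (p : {p : Set (SLZ n) × Set (Fin n → ℝ) // IsState B₁ B₂ p.1 p.2}) :
      ∃ p' : {p : Set (SLZ n) × Set (Fin n → ℝ) // IsState B₁ B₂ p.1 p.2}, p.1.1 ⊆ p'.1.1 ∧
        ((e k).1 ∉ cl p.1.1 → (e k).2 ∈ Subgroup.closure (p'.1.1 ∪ {(e k).1})) := by
    by_cases h : (e k).1 ∈ cl p.1.1
    · exact ⟨p, subset_rfl, fun h' => absurd h h'⟩
    · obtain ⟨S', F', h1, h2, h3⟩ := p.2.exists_generating hn hB h (e k).2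
      exact ⟨⟨(S', F'), h2⟩, h1, fun _ => h3⟩
  choose next hle hnext using hstep
  let st (k : ℕ) : {p : Set (SLZ n) × Set (Fin n → ℝ) // IsState B₁ B₂ p.1 p.2} :=
    Nat.rec ⟨(S, F), hst⟩ next k
  have hmono : Monotone fun k => (st k).1.1 := monotone_nat_of_le_succ fun k => hle k (st k)
  refine ⟨Subgroup.closure (⋃ k, (st k).1.1), ⟨_, nonempty_freeGroup_mulEquiv_closure
    (injective_freeGroup_lift_iUnion hmono fun k => (st k).2.free)⟩, fun g W hW hgW => ?_⟩
  refine eq_top_iff.2 fun t _ => ?_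
  obtain ⟨k, hk⟩ := he (g, t)
  have h := hnext k (st k)
  rw [hk] at h
  refine Subgroup.closure_mono ?_ (h ((st k).2.not_mem_cl hW hgW))
  exact Set.union_subset_union_left _
    ((Set.subset_iUnion (fun k => (st k).1.1) (k + 1)).trans Subgroup.subset_closure)

end FreeSubgroup

section Metric

variable {n : ℕ} {d : Proj n → Proj n → ℝ}

/-- The metric space structure on `ℙ` given by a compatible metric. -/
@[reducible] noncomputable def IsCompatMetric.metricSpace (hd : IsCompatMetric d) :
    MetricSpace (Proj n) :=
  MetricSpace.ofDistTopology d hd.self hd.symm hd.triangle hd.inducing hd.eq_of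

lemma IsCompatMetric.mem_oThick_iff (hd : IsCompatMetric d) {A : Set (Proj n)} (hA : A.Nonempty)
    {ε : ℝ} {x : Proj n} : x ∈ oThick d A ε ↔ ∃ a ∈ A, d x a < ε := by
  let _ := hd.metricSpace
  have h0 : BddBelow (d x '' A) := ⟨0, by
    rintro _ ⟨a, -, rfl⟩
    exact dist_nonneg (x := x) (y := a)⟩
  change sInf (d x '' A) < ε ↔ _
  rw [csInf_lt_iff h0 (hA.image _)]
  simp

lemma mem_projSet {W : Submodule ℝ (Fin n → ℝ)} {v : Fin n → ℝ} (hv : v ≠ 0) :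
    Projectivization.mk ℝ v hv ∈ projSet W ↔ v ∈ W := by
  change (Projectivization.mk ℝ v hv).submodule ≤ W ↔ _
  rw [Projectivization.submodule_mk, Submodule.span_singleton_le_iff_mem]

lemma continuous_mk :
    Continuous fun v : {v : Fin n → ℝ // v ≠ 0} => Projectivization.mk ℝ v.1 v.2 :=
  continuous_quotient_mk'

lemma isClosed_projSet (W : Submodule ℝ (Fin n → ℝ)) : IsClosed (projSet W) := by
  have hq : IsQuotientMap fun v : {v : Fin n → ℝ // v ≠ 0} => Projectivization.mk ℝ v.1 v.2 :=
    isQuotientMap_quotient_mk'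
  rw [← hq.isClosed_preimage]
  have : (fun v : {v : Fin n → ℝ // v ≠ 0} => Projectivization.mk ℝ v.1 v.2) ⁻¹' projSet W
      = Subtype.val ⁻¹' (W : Set (Fin n → ℝ)) := by
    ext v; exact mem_projSet v.2
  rw [this]
  exact W.closed_of_finiteDimensional.preimage continuous_subtype_val

lemma exists_unit_mk_eq {x : Fin n → ℝ} (hx : x ≠ 0) : ∃ y, ∃ hy : y ≠ 0, ‖y‖ = 1 ∧
    x = ‖x‖ • y ∧ Projectivization.mk ℝ y hy = Projectivization.mk ℝ x hx := by
  have h := norm_ne_zero_iff.2 hx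
  refine ⟨‖x‖⁻¹ • x, smul_ne_zero (inv_ne_zero h) hx, ?_, ?_, ?_⟩
  · rw [norm_smul, norm_inv, norm_norm, inv_mul_cancel₀ h]
  · rw [smul_smul, mul_inv_cancel₀ h, one_smul]
  · rw [Projectivization.mk_eq_mk_iff']
    exact ⟨‖x‖⁻¹, rfl⟩

lemma isCompact_unit_mem {C : Set (Fin n → ℝ)} (hC : IsClosed C) :
    IsCompact {v : {v : Fin n → ℝ // v ≠ 0} | ‖v.1‖ = 1 ∧ v.1 ∈ C} := by
  have : Subtype.val '' {v : {v : Fin n → ℝ // v ≠ 0} | ‖v.1‖ = 1 ∧ v.1 ∈ C}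
      = Metric.sphere 0 1 ∩ C := by
    ext x
    rw [Set.mem_inter_iff, mem_sphere_zero_iff_norm]
    constructor
    · rintro ⟨v, hv, rfl⟩; exact hv
    · exact fun hv => ⟨⟨x, fun h => by simp [h] at hv⟩, hv, rfl⟩
  rw [IsEmbedding.subtypeVal.isCompact_iff, this]
  exact (isCompact_sphere 0 1).inter_right hC

lemma abs_dot_smul (φ : Fin n → ℝ) {c : ℝ} (hc : 0 ≤ c) (y : Fin n → ℝ) :
    |φ ⬝ᵥ c • y| = c * |φ ⬝ᵥ y| := by
  rw [dotProduct_smul, smul_eq_mul, abs_mul, abs_of_nonneg hc]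

variable {W : Submodule ℝ (Fin n → ℝ)} {φ : Fin n → ℝ}

lemma IsCompatMetric.exists_abs_dot_lt (hd : IsCompatMetric d) (hW : (projSet W).Nonempty)
    (hφ : ∀ w, w ∈ W ↔ φ ⬝ᵥ w = 0) {δ : ℝ} (hδ : 0 < δ) :
    ∃ ρ > 0, ∀ x (hx : x ≠ 0), Projectivization.mk ℝ x hx ∈ oThick d (projSet W) ρ →
      |φ ⬝ᵥ x| < δ * ‖x‖ := by
  let _ := hd.metricSpace
  have hK : IsCompact {v : {v : Fin n → ℝ // v ≠ 0} | ‖v.1‖ = 1 ∧ δ ≤ |φ ⬝ᵥ v.1|} :=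
    isCompact_unit_mem (isClosed_le continuous_const (continuous_dot φ).abs)
  have hdisj : Disjoint ((fun v : {v : Fin n → ℝ // v ≠ 0} => Projectivization.mk ℝ v.1 v.2) ''
      {v | ‖v.1‖ = 1 ∧ δ ≤ |φ ⬝ᵥ v.1|}) (projSet W) := by
    rw [Set.disjoint_left]
    rintro _ ⟨v, ⟨-, hv⟩, rfl⟩ hvW
    rw [mem_projSet, hφ] at hvW
    rw [hvW, abs_zero] at hv
    linarith
  obtain ⟨ρ, hρ, h⟩ := hdisj.exists_thickenings (hK.image continuous_mk) (isClosed_projSet W)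
  refine ⟨ρ, hρ, fun x hx hxW => ?_⟩
  by_contra! hlt
  obtain ⟨y, hy, hy1, hxy, hmk⟩ := exists_unit_mk_eq hx
  have hpos := norm_pos_iff.2 hx
  rw [hxy, abs_dot_smul _ (norm_nonneg x), ← hxy, mul_comm δ] at hlt
  rw [← hmk, hd.mem_oThick_iff hW] at hxW
  exact Set.disjoint_left.1 h (Metric.self_subset_thickening hρ _
    ⟨⟨y, hy⟩, ⟨hy1, le_of_mul_le_mul_left hlt hpos⟩, rfl⟩) (Metric.mem_thickening_iff.2 hxW)

lemma IsCompatMetric.exists_mem_oThick (hd : IsCompatMetric d) (hW : (projSet W).Nonempty)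
    (hφ : ∀ w, w ∈ W ↔ φ ⬝ᵥ w = 0) {ρ : ℝ} (hρ : 0 < ρ) :
    ∃ δ > 0, ∀ x (hx : x ≠ 0), |φ ⬝ᵥ x| < δ * ‖x‖ →
      Projectivization.mk ℝ x hx ∈ oThick d (projSet W) ρ := by
  let _ := hd.metricSpace
  have hth : oThick d (projSet W) ρ = Metric.thickening ρ (projSet W) := by
    ext x; rw [hd.mem_oThick_iff hW, Metric.mem_thickening_iff]; rfl
  set K := {v : {v : Fin n → ℝ // v ≠ 0} | ‖v.1‖ = 1 ∧
    Projectivization.mk ℝ v.1 v.2 ∉ oThick d (projSet W) ρ} with hKd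
  have hK : IsCompact K := by
    have h1 : IsClosed (oThick d (projSet W) ρ)ᶜ := by
      rw [hth]; exact Metric.isOpen_thickening.isClosed_compl
    have h2 := (isCompact_unit_mem (n := n) isClosed_univ).inter_right (h1.preimage continuous_mk)
    convert h2 using 1
    ext v
    simp [hKd]
  obtain ⟨δ, hδ, h⟩ : ∃ δ > 0, ∀ v ∈ K, δ ≤ |φ ⬝ᵥ v.1| := by
    rcases K.eq_empty_or_nonempty with h | h
    · exact ⟨1, one_pos, by simp [h]⟩
    · obtain ⟨v, hv, hmin⟩ := hK.exists_isMinOn h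
        ((continuous_dot φ).comp continuous_subtype_val).abs.continuousOn
      refine ⟨|φ ⬝ᵥ v.1|, abs_pos.2 fun h0 => hv.2 ?_, fun v' hv' => hmin hv'⟩
      rw [hth]
      exact Metric.self_subset_thickening hρ _ ((mem_projSet v.2).2 ((hφ _).2 h0))
  refine ⟨δ, hδ, fun x hx hlt => ?_⟩
  by_contra hxW
  obtain ⟨y, hy, hy1, hxy, hmk⟩ := exists_unit_mk_eq hx
  have hpos := norm_pos_iff.2 hx
  rw [hxy, abs_dot_smul _ (norm_nonneg x), ← hxy, mul_comm δ] at hlt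
  rw [← hmk] at hxW
  exact absurd (h ⟨y, hy⟩ ⟨hy1, hxW⟩) (not_le.2 (lt_of_mul_lt_mul_left hlt hpos.le))

end Metric

section Dense

variable {n : ℕ}

lemma trans_pow {p φ : Fin n → ℝ} (h0 : φ ⬝ᵥ p = 0) {D : ℝ} {A : ℤ → SLZ n}
    (hA : ∀ k : ℤ, matR (A k) = 1 + ((k : ℝ) * D) • vecMulVec p φ) (k : ℕ) : A 1 ^ k = A k := by
  induction k with
  | zero => apply matR_injective; simp [hA, matR_one]
  | succ k ih =>
    apply matR_injective
    rw [pow_succ, ih, matR_mul, hA, hA, hA]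
    simp only [add_mul, mul_add, smul_mul_assoc, mul_smul_comm, vecMulVec_mul_vecMulVec, h0]
    push_cast
    simp only [mul_one, one_mul, zero_smul, vecMulVec_zero, smul_zero, add_zero]
    module

lemma exists_isRat_dot {φ₁ φ₂ p₀ : Fin n → ℝ} (hφ₁ : φ₁ ≠ 0) (h₁ : φ₁ ⬝ᵥ p₀ = 0)
    (h₂ : φ₂ ⬝ᵥ p₀ ≠ 0) {O : Set (Fin n → ℝ)} (hO : IsOpen O) (hφO : φ₁ ∈ O) :
    ∃ φ ∈ O, ∃ p, IsRat φ ∧ IsRat p ∧ φ ⬝ᵥ p = 0 ∧ φ₂ ⬝ᵥ p ≠ 0 := by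
  have ht : Tendsto (fun z : (Fin n → ℝ) × (Fin n → ℝ) => φ₂ ⬝ᵥ prj z.1 z.2) (𝓝 φ₁ ×ˢ 𝓝 p₀)
      (𝓝 (φ₂ ⬝ᵥ p₀)) := by
    have h := tendsto_prj hφ₁ (tendsto_fst (f := 𝓝 φ₁) (g := 𝓝 p₀)) tendsto_snd
    rw [prj_eq_self (by rw [dotProduct_comm, h₁])] at h
    exact ((continuous_dot φ₂).tendsto _).comp h
  obtain ⟨P, hP, Q, hQ, hPQ⟩ := eventually_prod_iff.1 (ht.eventually_ne h₂)
  obtain ⟨V, hV, hVo, hφV⟩ := eventually_nhds_iff.1 hP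
  obtain ⟨V', hV', hVo', hpV⟩ := eventually_nhds_iff.1 hQ
  obtain ⟨φ, hφ, hφr⟩ := exists_isRat_mem (hO.inter hVo) ⟨φ₁, hφO, hφV⟩
  obtain ⟨p, hp, hpr⟩ := exists_isRat_mem hVo' ⟨p₀, hpV⟩
  exact ⟨φ, hφ.1, prj φ p, hφr, hφr.prj hpr, by rw [dotProduct_comm, prj_dot],
    hPQ (hV φ hφ.2) (hV' p hp)⟩

/-- Every finite-index normal subgroup contains an element moving the kernel of `φ₂` close to the
kernel of `φ₁`. -/
lemma exists_mem_abs_dot_lt {φ₁ φ₂ p₀ : Fin n → ℝ} (hφ₁ : φ₁ ≠ 0) (h₁ : φ₁ ⬝ᵥ p₀ = 0)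
    (h₂ : φ₂ ⬝ᵥ p₀ ≠ 0) {δ : ℝ} (hδ : 0 < δ) (N : Subgroup (SLZ n)) [N.Normal] [N.FiniteIndex] :
    ∃ g ∈ N, ∀ x, x ≠ 0 → φ₂ ⬝ᵥ x = 0 → |φ₁ ⬝ᵥ av g x| < δ * ‖av g x‖ := by
  have hO : IsOpen {φ : Fin n → ℝ | ∑ i, |(φ₁ - φ) i| < δ / 2} :=
    isOpen_lt (by simp only [Pi.sub_apply]; fun_prop) continuous_const
  obtain ⟨φ, hφ, p, hφr, hpr, hφp, hp⟩ := exists_isRat_dot hφ₁ h₁ h₂ hO (by simpa using hδ)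
  obtain ⟨D, hD, A, hA⟩ := exists_trans hpr hφr hφp
  set c := D * |φ₂ ⬝ᵥ p| with hc
  have hc0 : 0 < c := mul_pos hD (abs_pos.2 hp)
  obtain ⟨K, hK⟩ := exists_nat_gt ((∑ i, |φ₂ i|) / c / (δ / 2))
  have hi : 1 ≤ N.index := Nat.one_le_iff_ne_zero.2 Subgroup.FiniteIndex.index_ne_zero
  refine ⟨A (N.index * (K + 1) : ℕ), ?_, fun x hx hx2 => ?_⟩
  · rw [← trans_pow hφp hA, pow_mul]
    exact pow_mem (N.pow_index_mem _) _
  set k : ℕ := N.index * (K + 1) with hk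
  have hkK : (K : ℝ) + 1 ≤ k := by
    rw [hk]; exact_mod_cast Nat.le_mul_of_pos_left _ hi
  set y := av (A k) x with hy
  have hy0 : 0 < ‖y‖ := norm_pos_iff.2 (av_ne_zero hx)
  have hxy : x = y - ((k : ℝ) * D * (φ ⬝ᵥ y)) • p := by
    have : x = av (A k)⁻¹ y := by rw [hy, av_inv_av]
    rw [this, trans_inv hφp hA, av_apply, hA, Matrix.add_mulVec, Matrix.one_mulVec,
      Matrix.smul_mulVec, vecMulVec_mulVec]
    ext i
    simp
    ring
  rw [hxy, dotProduct_sub, dotProduct_smul, smul_eq_mul, sub_eq_zero] at hx2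
  have h3 : |φ ⬝ᵥ y| * (k * c) ≤ (∑ i, |φ₂ i|) * ‖y‖ := by
    refine le_trans (le_of_eq ?_) (abs_dot_le φ₂ y)
    rw [hx2, abs_mul, abs_mul, abs_of_nonneg (by positivity : 0 ≤ (k : ℝ) * D), hc]
    ring
  have h4 : ∑ i, |φ₂ i| < δ / 2 * (k * c) := by
    rw [div_div, div_lt_iff₀ (by positivity)] at hK
    have : (K : ℝ) * (c * (δ / 2)) ≤ k * (c * (δ / 2)) :=
      mul_le_mul_of_nonneg_right (by linarith) (by positivity)
    linarith
  have h5 : |φ ⬝ᵥ y| < δ / 2 * ‖y‖ := by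
    have hk0 : 0 < (k : ℝ) * c := mul_pos (by linarith [(Nat.cast_nonneg K : (0 : ℝ) ≤ K)]) hc0
    refine lt_of_mul_lt_mul_right (h3.trans_lt ?_) hk0.le
    calc (∑ i, |φ₂ i|) * ‖y‖ < δ / 2 * (k * c) * ‖y‖ := by gcongr
      _ = _ := by ring
  have h6 : |(φ₁ - φ) ⬝ᵥ y| ≤ δ / 2 * ‖y‖ := (abs_dot_le _ y).trans (by gcongr; exact hφ.le)
  have h7 : φ₁ ⬝ᵥ y = (φ₁ - φ) ⬝ᵥ y + φ ⬝ᵥ y := by rw [sub_dotProduct]; ring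
  rw [h7]
  linarith [abs_add_le ((φ₁ - φ) ⬝ᵥ y) (φ ⬝ᵥ y)]

/-- A hyperplane cannot be close to two distinct hyperplanes. -/
lemma exists_pos_forall_exists_le_abs_dot {φ₁ φ₂ a b : Fin n → ℝ} (ha₁ : φ₁ ⬝ᵥ a = 0)
    (ha₂ : φ₂ ⬝ᵥ a ≠ 0) (hb₁ : φ₁ ⬝ᵥ b ≠ 0) (hb₂ : φ₂ ⬝ᵥ b = 0) :
    ∃ δ > 0, ∀ f : Fin n → ℝ, ∃ x ≠ 0, f ⬝ᵥ x = 0 ∧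
      (δ * ‖x‖ ≤ |φ₁ ⬝ᵥ x| ∨ δ * ‖x‖ ≤ |φ₂ ⬝ᵥ x|) := by
  have ha : 0 < |φ₂ ⬝ᵥ a| := abs_pos.2 ha₂
  have hb : 0 < |φ₁ ⬝ᵥ b| := abs_pos.2 hb₁
  set m := min |φ₂ ⬝ᵥ a| |φ₁ ⬝ᵥ b|
  have hm : 0 < m := lt_min ha hb
  set M := ‖a‖ + ‖b‖ + 1
  have hM : 0 < M := by positivity
  refine ⟨m / (2 * M), by positivity, fun f => ?_⟩
  obtain ⟨s, r, hsr, hf⟩ : ∃ s r : ℝ, (s ≠ 0 ∨ r ≠ 0) ∧ f ⬝ᵥ (s • a + r • b) = 0 := by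
    by_cases h : f ⬝ᵥ a = 0
    · exact ⟨1, 0, by simp, by simp [h]⟩
    · refine ⟨f ⬝ᵥ b, -(f ⬝ᵥ a), Or.inr (neg_ne_zero.2 h), ?_⟩
      simp only [dotProduct_add, dotProduct_smul, smul_eq_mul]; ring
  set x := s • a + r • b
  have hx1 : φ₁ ⬝ᵥ x = r * (φ₁ ⬝ᵥ b) := by
    simp only [x, dotProduct_add, dotProduct_smul, smul_eq_mul, ha₁]; ring
  have hx2 : φ₂ ⬝ᵥ x = s * (φ₂ ⬝ᵥ a) := by
    simp only [x, dotProduct_add, dotProduct_smul, smul_eq_mul, hb₂]; ring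
  have hx0 : x ≠ 0 := by
    intro h
    rw [h, dotProduct_zero] at hx1 hx2
    rcases hsr with h' | h'
    · exact mul_ne_zero h' ha₂ hx2.symm
    · exact mul_ne_zero h' hb₁ hx1.symm
  refine ⟨x, hx0, hf, ?_⟩
  by_contra! hlt
  have h1 : m * |r| ≤ |φ₁ ⬝ᵥ x| := by
    rw [hx1, abs_mul, mul_comm]; gcongr; exact min_le_right _ _
  have h2 : m * |s| ≤ |φ₂ ⬝ᵥ x| := by
    rw [hx2, abs_mul, mul_comm]; gcongr; exact min_le_left _ _
  have h3 : ‖x‖ ≤ (|s| + |r|) * M := by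
    refine (norm_add_le _ _).trans ?_
    rw [norm_smul, norm_smul, Real.norm_eq_abs, Real.norm_eq_abs]
    nlinarith [norm_nonneg a, norm_nonneg b, abs_nonneg s, abs_nonneg r,
      mul_nonneg (abs_nonneg s) (norm_nonneg b), mul_nonneg (abs_nonneg r) (norm_nonneg a)]
  have h4 : m / (2 * M) * ‖x‖ ≤ m * (|s| + |r|) / 2 := by
    calc m / (2 * M) * ‖x‖ ≤ m / (2 * M) * ((|s| + |r|) * M) := by gcongr
      _ = _ := by field_simp
  linarith [hlt.1, hlt.2]

lemma exists_dot_eq_zero_dot_ne_zero {W₁ W₂ : Submodule ℝ (Fin n → ℝ)} {φ₁ φ₂ : Fin n → ℝ}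
    (h : Module.finrank ℝ W₁ = Module.finrank ℝ W₂) (hW : W₁ ≠ W₂)
    (hφ₁ : ∀ w, w ∈ W₁ ↔ φ₁ ⬝ᵥ w = 0) (hφ₂ : ∀ w, w ∈ W₂ ↔ φ₂ ⬝ᵥ w = 0) :
    ∃ a, φ₁ ⬝ᵥ a = 0 ∧ φ₂ ⬝ᵥ a ≠ 0 := by
  by_contra! H
  exact hW (Submodule.eq_of_le_of_finrank_eq (fun w hw => (hφ₂ w).2 (H w ((hφ₁ w).1 hw))) h)

lemma projSet_nonempty {W : Submodule ℝ (Fin n → ℝ)} (hn : 3 ≤ n)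
    (hW : Module.finrank ℝ W = n - 1) : (projSet W).Nonempty := by
  have : W ≠ ⊥ := by
    rintro rfl
    rw [finrank_bot] at hW
    omega
  obtain ⟨w, hw, hw0⟩ := W.ne_bot_iff.1 this
  exact ⟨_, (mem_projSet hw0).2 hw⟩

/-- The hyperplanes contained in the `ρ`-neighbourhood of `W`. -/
def nearHyp (d : Proj n → Proj n → ℝ) (W : Submodule ℝ (Fin n → ℝ)) (ρ : ℝ) :
    Set (Submodule ℝ (Fin n → ℝ)) :=
  {V | Module.finrank ℝ V = n - 1 ∧ projSet V ⊆ oThick d (projSet W) ρ}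

lemma finrank_map_av (g : SLZ n) (W : Submodule ℝ (Fin n → ℝ)) :
    Module.finrank ℝ (W.map (av g)) = Module.finrank ℝ W :=
  (Submodule.equivMapOfInjective _ (av_injective g) W).finrank_eq.symm

end Dense

/-- Proposition 4.1: for distinct projective hyperplanes `L₁ ≠ L₂` there are
`ρ > 0` and a profinitely dense free subgroup `H ≤ SL(n,ℤ)` such that whenever a
hyperplane `L ⊆ (L₂)_ρ` satisfies `g • L ⊆ (L₁)_ρ`, the group `⟨H, g⟩` is all of
`SL(n,ℤ)`. -/
theorem prop_dense (n : ℕ) (hn : 3 ≤ n) (d : Proj n → Proj n → ℝ)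
    (hd : IsCompatMetric d) (W₁ W₂ : Submodule ℝ (Fin n → ℝ))
    (hW₁ : Module.finrank ℝ W₁ = n - 1) (hW₂ : Module.finrank ℝ W₂ = n - 1)
    (hW : W₁ ≠ W₂) :
    ∃ ρ : ℝ, 0 < ρ ∧ ∃ H : Subgroup (SLZ n), ProfinitelyDense H ∧
      (∃ ι : Type, Nonempty (FreeGroup ι ≃* H)) ∧
      ∀ (g : SLZ n) (W : Submodule ℝ (Fin n → ℝ)), Module.finrank ℝ W = n - 1 →
        projSet W ⊆ oThick d (projSet W₂) ρ →
        projSet (actSub g W) ⊆ oThick d (projSet W₁) ρ →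
        Subgroup.closure ((H : Set (SLZ n)) ∪ {g}) = ⊤ := by
  obtain ⟨φ₁, hφ₁0, hφ₁⟩ := exists_form (by omega) hW₁
  obtain ⟨φ₂, hφ₂0, hφ₂⟩ := exists_form (by omega) hW₂
  have hne₁ := projSet_nonempty hn hW₁
  have hne₂ := projSet_nonempty hn hW₂
  obtain ⟨a, ha₁, ha₂⟩ := exists_dot_eq_zero_dot_ne_zero (hW₁.trans hW₂.symm) hW hφ₁ hφ₂
  obtain ⟨b, hb₂, hb₁⟩ := exists_dot_eq_zero_dot_ne_zero (hW₂.trans hW₁.symm) hW.symm hφ₂ hφ₁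
  obtain ⟨δ₀, hδ₀, hsep⟩ := exists_pos_forall_exists_le_abs_dot ha₁ ha₂ hb₁ hb₂
  have hab₁ : φ₁ ⬝ᵥ (a + b) ≠ 0 := by rwa [dotProduct_add, ha₁, zero_add]
  have hab₂ : φ₂ ⬝ᵥ (a + b) ≠ 0 := by rwa [dotProduct_add, hb₂, add_zero]
  have hab0 : 0 < ‖a + b‖ := norm_pos_iff.2 fun h => hab₁ (by rw [h, dotProduct_zero])
  set m := min |φ₁ ⬝ᵥ (a + b)| |φ₂ ⬝ᵥ (a + b)|
  have hm : 0 < m := lt_min (abs_pos.2 hab₁) (abs_pos.2 hab₂)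
  set δ := min δ₀ (m / (2 * ‖a + b‖))
  have hδ : 0 < δ := lt_min hδ₀ (by positivity)
  have hδab : δ * ‖a + b‖ < m := by
    calc δ * ‖a + b‖ ≤ m / (2 * ‖a + b‖) * ‖a + b‖ := by gcongr; exact min_le_right _ _
      _ = m / 2 := by field_simp
      _ < m := by linarith
  obtain ⟨ρ₁, hρ₁, hth₁⟩ := hd.exists_abs_dot_lt hne₁ hφ₁ hδ
  obtain ⟨ρ₂, hρ₂, hth₂⟩ := hd.exists_abs_dot_lt hne₂ hφ₂ hδ
  set ρ := min ρ₁ ρ₂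
  have hρ : 0 < ρ := lt_min hρ₁ hρ₂
  have hnear₁ : ∀ V ∈ nearHyp d W₁ ρ, ∀ v ∈ V, v ≠ 0 → |φ₁ ⬝ᵥ v| < δ * ‖v‖ :=
    fun V hV v hv hv0 => hth₁ v hv0
      (lt_of_lt_of_le (b := ρ) (hV.2 ((mem_projSet hv0).2 hv)) (min_le_left _ _))
  have hnear₂ : ∀ V ∈ nearHyp d W₂ ρ, ∀ v ∈ V, v ≠ 0 → |φ₂ ⬝ᵥ v| < δ * ‖v‖ :=
    fun V hV v hv hv0 => hth₂ v hv0
      (lt_of_lt_of_le (b := ρ) (hV.2 ((mem_projSet hv0).2 hv)) (min_le_right _ _))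
  have hdisj : ∀ V ∈ nearHyp d W₂ ρ, V ∉ nearHyp d W₁ ρ := by
    intro V hV₂ hV₁
    obtain ⟨f, -, hf⟩ := exists_form (by omega) hV₁.1
    obtain ⟨x, hx0, hfx, hx⟩ := hsep f
    have h1 := hnear₁ V hV₁ x ((hf x).2 hfx) hx0
    have h2 := hnear₂ V hV₂ x ((hf x).2 hfx) hx0
    have h3 : δ * ‖x‖ ≤ δ₀ * ‖x‖ := by gcongr; exact min_le_left _ _
    rcases hx with hx | hx <;> linarith
  set F : Set (Fin n → ℝ) := {v | δ * ‖v‖ < |φ₁ ⬝ᵥ v| ∧ δ * ‖v‖ < |φ₂ ⬝ᵥ v|} with hF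
  have hFo : IsOpen F :=
    (isOpen_lt (by fun_prop) (continuous_dot φ₁).abs).inter
      (isOpen_lt (by fun_prop) (continuous_dot φ₂).abs)
  have hFc : IsCone F := by
    rintro x ⟨h1, h2⟩ c hc
    have hc' := abs_pos.2 hc
    refine ⟨?_, ?_⟩ <;>
    · rw [dotProduct_smul, smul_eq_mul, abs_mul, norm_smul, Real.norm_eq_abs, mul_left_comm]
      gcongr
  have hF0 : ∀ x ∈ F, x ≠ 0 := by
    rintro x ⟨h1, -⟩ rfl
    simp at h1
  have hmiss : ∀ V ∈ nearHyp d W₁ ρ ∪ nearHyp d W₂ ρ, ∀ w ∈ V, w ∉ F := by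
    rintro V (hV | hV) w hw hwF
    · exact lt_asymm (hnear₁ V hV w hw (hF0 w hwF)) hwF.1
    · exact lt_asymm (hnear₂ V hV w hw (hF0 w hwF)) hwF.2
  have hst := isState_empty hFo
    ⟨a + b, hδab.trans_le (min_le_left _ _), hδab.trans_le (min_le_right _ _)⟩ hFc hF0 hmiss hdisj
  obtain ⟨H, hfree, hH⟩ := hst.exists_free_subgroup hn (by rintro V (hV | hV) <;> exact hV.1)
  have hgen (g : SLZ n) (W : Submodule ℝ (Fin n → ℝ)) (h : Module.finrank ℝ W = n - 1)
      (h₂ : projSet W ⊆ oThick d (projSet W₂) ρ)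
      (h₁ : projSet (actSub g W) ⊆ oThick d (projSet W₁) ρ) :
      Subgroup.closure ((H : Set (SLZ n)) ∪ {g}) = ⊤ :=
    hH g W ⟨h, h₂⟩ ⟨(finrank_map_av g W).trans h, h₁⟩
  refine ⟨ρ, hρ, H, fun N hN hNi => ?_, hfree, hgen⟩
  obtain ⟨ε, hε, hεth⟩ := hd.exists_mem_oThick hne₁ hφ₁ hρ
  obtain ⟨g, hgN, hg⟩ := exists_mem_abs_dot_lt hφ₁0 ha₁ ha₂ hε N
  refine eq_top_iff.2 ((hgen g W₂ hW₂ (fun x hx => ?_) fun x hx => ?_).ge.trans ?_)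
  · exact (hd.mem_oThick_iff hne₂).2 ⟨x, hx, by rwa [hd.self]⟩
  · induction x using Projectivization.ind with
    | h v hv =>
      obtain ⟨w, hw, rfl⟩ := (mem_projSet hv).1 hx
      exact hεth _ hv (hg w (fun h => hv (by rw [h, map_zero])) ((hφ₂ w).1 hw))
  · rw [Subgroup.closure_le]
    exact Set.union_subset (le_sup_left : H ≤ H ⊔ N)
      (Set.singleton_subset_iff.2 (Subgroup.mem_sup_right hgN))
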